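/- Let P = B ∪ R be a bichromatic set of 2n points in the plane in general position with |B| = |R| = n, let M be a BR-matching on P, and let ℓ be a ham-sandwich cut of P such that at least one edge of M crosses ℓ. Then there exists a BR-matching M' on P compatible with M such that the number of edges of M' crossing ℓ is at most |C_{M,ℓ}| − 2, where C_{M,ℓ} is the set of edges of M crossing ℓ. -/

import Mathlib

open Finset
open scoped Classical

/-- Points in the plane. -/
abbrev Pt : Type := ℝ × ℝ

/-- A finite point set is in general position if no three distinct points are collinear. -/
def GenPos (S : Finset Pt) : Prop :=
  ∀ p ∈ S, ∀ q ∈ S, ∀ r ∈ S, p ≠ q → p ≠ r → q ≠ r →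
    ¬ Collinear ℝ ({p, q, r} : Set Pt)

/-- `M` is a plane perfect bichromatic (BR-) matching on the bichromatic point set `B ∪ R`:
each edge `e ∈ M` is a pair (blue endpoint, red endpoint); every blue point is the blue
endpoint of exactly one edge, every red point is the red endpoint of exactly one edge, and
the (closed) segments of distinct edges are disjoint. -/
def IsBRMatching (B R : Finset Pt) (M : Finset (Pt × Pt)) : Prop :=
  (∀ e ∈ M, e.1 ∈ B ∧ e.2 ∈ R) ∧
  (∀ b ∈ B, ∃! e, e ∈ M ∧ e.1 = b) ∧
  (∀ r ∈ R, ∃! e, e ∈ M ∧ e.2 = r) ∧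
  (∀ e ∈ M, ∀ e' ∈ M, e ≠ e' →
    segment ℝ e.1 e.2 ∩ segment ℝ e'.1 e'.2 = ∅)

/-- Two matchings are compatible if any two of their segments intersect in at most a
common endpoint (shared edges are allowed). -/
def Compatible (M M' : Finset (Pt × Pt)) : Prop :=
  ∀ e ∈ M, ∀ e' ∈ M', e = e' ∨
    segment ℝ e.1 e.2 ∩ segment ℝ e'.1 e'.2 ⊆
      {x : Pt | (x = e.1 ∨ x = e.2) ∧ (x = e'.1 ∨ x = e'.2)}

/-- `M` and `M'` are `t`-compatible: there is a transformation (sequence of BR-matchings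
on `B ∪ R` in which consecutive matchings are compatible) of length `k ≤ t` between them. -/
def TCompatible (B R : Finset Pt) (t : ℕ) (M M' : Finset (Pt × Pt)) : Prop :=
  ∃ k ≤ t, ∃ f : ℕ → Finset (Pt × Pt),
    f 0 = M ∧ f k = M' ∧ (∀ i ≤ k, IsBRMatching B R (f i)) ∧
    ∀ i < k, Compatible (f i) (f (i + 1))

/-- The line `{p | a * p.1 + b * p.2 = c}`. -/
def lineSet (a b c : ℝ) : Set Pt := {p : Pt | a * p.1 + b * p.2 = c}

/-- The line given by `a * x + b * y = c` is a ham-sandwich cut of the bichromatic point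
set `B ∪ R` (with `|B| = |R| = n`): it contains no point of `B ∪ R`, and one of its open
sides contains exactly `⌊n/2⌋` blue and `⌊n/2⌋` red points while the other open side
contains exactly `⌈n/2⌉` blue and `⌈n/2⌉` red points. -/
def IsHamSandwichCut (a b c : ℝ) (B R : Finset Pt) (n : ℕ) : Prop :=
  (a, b) ≠ ((0 : ℝ), (0 : ℝ)) ∧
  (∀ p ∈ B ∪ R, a * p.1 + b * p.2 ≠ c) ∧
  (((B.filter fun p => a * p.1 + b * p.2 < c).card = n / 2 ∧
    (R.filter fun p => a * p.1 + b * p.2 < c).card = n / 2 ∧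
    (B.filter fun p => a * p.1 + b * p.2 > c).card = (n + 1) / 2 ∧
    (R.filter fun p => a * p.1 + b * p.2 > c).card = (n + 1) / 2) ∨
   ((B.filter fun p => a * p.1 + b * p.2 < c).card = (n + 1) / 2 ∧
    (R.filter fun p => a * p.1 + b * p.2 < c).card = (n + 1) / 2 ∧
    (B.filter fun p => a * p.1 + b * p.2 > c).card = n / 2 ∧
    (R.filter fun p => a * p.1 + b * p.2 > c).card = n / 2))

/-- The edge `e` crosses the line `a * x + b * y = c`: its segment meets the line. -/
def Crosses (a b c : ℝ) (e : Pt × Pt) : Prop :=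
  ∃ x ∈ segment ℝ e.1 e.2, a * x.1 + b * x.2 = c

/-- The determinant of two plane vectors. -/
def det (u v : Pt) : ℝ := u.1 * v.2 - u.2 * v.1

/-- Every point of `W` is an interior point of a nondegenerate segment contained in `W`. -/
def Thru (W : Set Pt) (p : Pt) : Prop :=
  ∃ u : Pt, u ≠ 0 ∧ ∃ ε : ℝ, 0 < ε ∧ ∀ t : ℝ, |t| < ε → p + t • u ∈ W

lemma Thru.mono {W W' : Set Pt} {p : Pt} (h : Thru W p) (hW : W ⊆ W') : Thru W' p := by
  obtain ⟨u, hu, ε, hε, h⟩ := h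
  exact ⟨u, hu, ε, hε, fun t ht => hW (h t ht)⟩

lemma exists_coords {u v : Pt} (h : det u v ≠ 0) (w : Pt) :
    w = (det w v / det u v) • u + (det u w / det u v) • v := by
  ext <;> simp only [Prod.fst_add, Prod.snd_add, Prod.smul_fst, Prod.smul_snd, smul_eq_mul] <;>
    field_simp <;> simp only [det] <;> ring

lemma exists_smul_of_det_eq_zero {u v : Pt} (hu : u ≠ 0) (h : det u v = 0) :
    ∃ k : ℝ, v = k • u := by
  have hu' : u.1 ≠ 0 ∨ u.2 ≠ 0 := by
    by_contra! h'
    exact hu (Prod.ext h'.1 h'.2)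
  unfold det at h
  rcases hu' with h1 | h1
  · refine ⟨v.1 / u.1, ?_⟩
    ext <;> simp only [Prod.smul_fst, Prod.smul_snd, smul_eq_mul] <;> field_simp
    linarith
  · refine ⟨v.2 / u.2, ?_⟩
    ext <;> simp only [Prod.smul_fst, Prod.smul_snd, smul_eq_mul] <;> field_simp
    linarith

/-- If both `[y, x)` and `[y, z)` avoid `W`, then the triangle `y x z` without the side `[x, z]`
avoids `W`. -/
lemma triangle_free {W : Set Pt} (hc : IsClosed W) (hT : ∀ p ∈ W, Thru W p) {x y z : Pt}
    (hx : ∀ t : ℝ, 0 ≤ t → t < 1 → y + t • (x - y) ∉ W)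
    (hz : ∀ t : ℝ, 0 ≤ t → t < 1 → y + t • (z - y) ∉ W)
    {s t : ℝ} (hs : 0 ≤ s) (ht : 0 ≤ t) (hst : s + t < 1) :
    y + s • (x - y) + t • (z - y) ∉ W := by
  by_cases hd : det (x - y) (z - y) = 0
  · by_cases hxy : x - y = 0
    · simpa [hxy] using hz t ht (by linarith)
    obtain ⟨k, hk⟩ := exists_smul_of_det_eq_zero hxy hd
    rcases le_or_gt 0 (s + t * k) with h0 | h0
    · rcases lt_or_ge (s + t * k) 1 with h1 | h1
      · have := hx _ h0 h1
        rwa [add_smul, mul_smul, ← hk, ← add_assoc] at this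
      · have hk1 : 1 < k := by nlinarith
        have h2 := hz ((s + t * k) / k) (by positivity) (by
          rw [div_lt_one (by linarith)]; nlinarith)
        rw [hk, smul_smul, div_mul_cancel₀ _ (by linarith)] at h2
        rwa [hk, smul_smul, add_assoc, ← add_smul]
    · have hk0 : k < 0 := by
        by_contra! h
        nlinarith [mul_nonneg ht h]
      have h2 := hz ((s + t * k) / k) (div_nonneg_of_nonpos h0.le hk0.le) (by
          rw [div_lt_one_of_neg hk0]; nlinarith)
      rw [hk, smul_smul, div_mul_cancel₀ _ hk0.ne] at h2
      rwa [hk, smul_smul, add_assoc, ← add_smul]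
  · intro hmem
    set f : ℝ × ℝ → Pt := fun a => y + a.1 • (x - y) + a.2 • (z - y) with hf
    have hfc : Continuous f := by fun_prop
    set K : Set (ℝ × ℝ) := {a | a ∈ Set.Icc (0 : ℝ) 1 ×ˢ Set.Icc (0 : ℝ) 1 ∧ f a ∈ W} with hK
    have hKc : IsCompact K := (isCompact_Icc.prod isCompact_Icc).inter_right (hc.preimage hfc)
    obtain ⟨a, haK, ha⟩ := hKc.exists_isMinOn (f := fun a => a.1 + a.2)
      ⟨(s, t), ⟨⟨hs, by linarith⟩, ⟨ht, by linarith⟩⟩, hmem⟩ (by fun_prop)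
    have hK'c : IsCompact (K ∩ {b | b.1 + b.2 = a.1 + a.2}) :=
      hKc.inter_right (isClosed_eq (by fun_prop) (by fun_prop))
    obtain ⟨b, ⟨hbK, hba⟩, hb⟩ := hK'c.exists_isMaxOn (f := fun a => a.1)
      ⟨a, haK, rfl⟩ (by fun_prop)
    simp only [Set.mem_ofPred_eq] at hba
    have hmin : ∀ d ∈ K, b.1 + b.2 ≤ d.1 + d.2 := fun d hd' => hba ▸ ha hd'
    have hmax : ∀ d ∈ K, d.1 + d.2 = b.1 + b.2 → d.1 ≤ b.1 := fun d hd' h =>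
      hb ⟨hd', h.trans hba⟩
    have hb1 : b.1 + b.2 < 1 :=
      (hmin (s, t) ⟨⟨⟨hs, by linarith⟩, ⟨ht, by linarith⟩⟩, hmem⟩).trans_lt hst
    obtain ⟨⟨⟨hb10, hb11⟩, hb20, hb21⟩, hbW⟩ := hbK
    have hbp1 : 0 < b.1 := by
      refine hb10.lt_of_ne fun h => hz b.2 hb20 (by linarith) ?_
      simpa [hf, ← h] using hbW
    have hbp2 : 0 < b.2 := by
      refine hb20.lt_of_ne fun h => hx b.1 hb10 (by linarith) ?_
      simpa [hf, ← h] using hbW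
    obtain ⟨u, hu, ε, hε, huW⟩ := hT _ hbW
    obtain ⟨p, q, hpq⟩ : ∃ p q : ℝ, u = p • (x - y) + q • (z - y) :=
      ⟨_, _, exists_coords hd u⟩
    have hev : ∀ᶠ τ in nhds (0 : ℝ), b + τ • (p, q) ∈ K := by
      have h1 : ∀ᶠ τ in nhds (0 : ℝ), |τ| < ε := by
        have : Filter.Tendsto (fun τ : ℝ => |τ|) (nhds 0) (nhds 0) := by
          simpa using (continuous_abs.tendsto (0 : ℝ))
        exact this.eventually (gt_mem_nhds hε)
      have hcont : ∀ g : ℝ → ℝ, Continuous g → ∀ k, k < g 0 → ∀ᶠ τ in nhds (0 : ℝ), k < g τ :=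
        fun g hg k hk => (hg.tendsto 0).eventually (lt_mem_nhds hk)
      have h2 := hcont (fun τ => b.1 + τ * p) (by fun_prop) 0 (by simpa)
      have h3 := hcont (fun τ => b.2 + τ * q) (by fun_prop) 0 (by simpa)
      have h4 := hcont (fun τ => 1 - (b.1 + τ * p + (b.2 + τ * q))) (by fun_prop) 0
        (by simp; linarith)
      filter_upwards [h1, h2, h3, h4] with τ h1 h2 h3 h4
      refine ⟨⟨⟨?_, ?_⟩, ⟨?_, ?_⟩⟩, ?_⟩
      any_goals simp only [Prod.fst_add, Prod.snd_add, Prod.smul_fst, Prod.smul_snd, smul_eq_mul]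
      any_goals linarith
      convert huW τ h1 using 1
      simp only [hf, hpq, Prod.fst_add, Prod.snd_add, Prod.smul_fst, Prod.smul_snd, smul_eq_mul]
      module
    obtain ⟨δ, hδ, hball⟩ := Metric.eventually_nhds_iff.1 hev
    have hp := hball (y := δ / 2) (by rw [Real.dist_eq, sub_zero, abs_of_pos] <;> linarith)
    have hm := hball (y := -(δ / 2)) (by rw [Real.dist_eq, sub_zero, abs_neg, abs_of_pos] <;> linarith)
    have e1 := hmin _ hp
    have e2 := hmin _ hm
    simp only [Prod.fst_add, Prod.snd_add, Prod.smul_fst, Prod.smul_snd, smul_eq_mul] at e1 e2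
    have hpq0 : p + q = 0 := by nlinarith
    have e3 := hmax _ hp (by
      simp only [Prod.fst_add, Prod.snd_add, Prod.smul_fst, Prod.smul_snd, smul_eq_mul]
      linear_combination (δ / 2) * hpq0)
    have e4 := hmax _ hm (by
      simp only [Prod.fst_add, Prod.snd_add, Prod.smul_fst, Prod.smul_snd, smul_eq_mul]
      linear_combination (-δ / 2) * hpq0)
    simp only [Prod.fst_add, Prod.smul_fst, smul_eq_mul] at e3 e4
    have hp0 : p = 0 := by nlinarith
    have hq0 : q = 0 := by linarith
    exact hu (by simp [hpq, hp0, hq0])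

/-- The half-open segment `[c, v)` avoids `W`. -/
def Reach (W : Set Pt) (c v : Pt) : Prop :=
  ∀ t : ℝ, 0 ≤ t → t < 1 → c + t • (v - c) ∉ W

lemma Reach.not_mem {W : Set Pt} {c v : Pt} (h : Reach W c v) : c ∉ W := by
  simpa using h 0 le_rfl one_pos

lemma open_segment_free_or_subset {W : Set Pt} (hc : IsClosed W) (hT : ∀ p ∈ W, Thru W p)
    {x y z : Pt} (hx : Reach W y x) (hz : Reach W y z) :
    (∀ t : ℝ, 0 < t → t < 1 → x + t • (z - x) ∉ W) ∨
      ∀ t : ℝ, 0 < t → t < 1 → x + t • (z - x) ∈ W := by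
  by_cases hxz : z = x
  · by_cases h : x ∈ W <;> simp [hxz, h]
  by_cases hd : det (x - y) (z - y) = 0
  · left
    intro t ht0 ht1
    by_cases hxy : x - y = 0
    · rw [sub_eq_zero.1 hxy]
      exact hz t ht0.le ht1
    obtain ⟨k, hk⟩ := exists_smul_of_det_eq_zero hxy hd
    have hk1 : k ≠ 1 := fun h => hxz (by simpa [h] using hk)
    have hp : x + t • (z - x) = y + (1 - t + t * k) • (x - y) := by
      have : z = y + k • (x - y) := by rw [← hk]; abel
      rw [this]; module
    rw [hp]
    have hz' : k ≠ 0 → 0 ≤ (1 - t + t * k) / k → (1 - t + t * k) / k < 1 →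
        y + (1 - t + t * k) • (x - y) ∉ W := by
      intro hk0 h1 h2
      have := hz _ h1 h2
      rwa [hk, smul_smul, div_mul_cancel₀ _ hk0] at this
    rcases lt_or_ge (1 - t + t * k) 0 with h0 | h0
    · have hk0 : k < 0 := by nlinarith
      exact hz' hk0.ne (div_nonneg_of_nonpos h0.le hk0.le) (by
        rw [div_lt_one_of_neg hk0]; nlinarith)
    · rcases lt_or_ge (1 - t + t * k) 1 with h1 | h1
      · exact hx _ h0 h1
      · have hk1 : 1 < k := lt_of_le_of_ne (by nlinarith) hk1.symm
        exact hz' (by linarith) (by positivity) (by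
          rw [div_lt_one (by linarith)]; nlinarith)
  · set f : ℝ → Pt := fun t => x + t • (z - x) with hf
    have hfc : Continuous f := by fun_prop
    have hopen : IsOpen {t | t ∈ Set.Ioo (0 : ℝ) 1 ∧ f t ∈ W} := by
      rw [isOpen_iff_mem_nhds]
      rintro t ⟨⟨ht0, ht1⟩, htW⟩
      obtain ⟨u, hu, ε, hε, huW⟩ := hT _ htW
      obtain ⟨p, q, hpq⟩ : ∃ p q : ℝ, u = p • (x - y) + q • (z - y) :=
        ⟨_, _, exists_coords hd u⟩
      have hcont : ∀ g : ℝ → ℝ, Continuous g → ∀ k, k < g 0 → ∀ᶠ τ in nhds (0 : ℝ), k < g τ :=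
        fun g hg k hk => (hg.tendsto 0).eventually (lt_mem_nhds hk)
      have hev : ∀ᶠ τ in nhds (0 : ℝ), 0 ≤ τ * (p + q) := by
        filter_upwards [hcont (fun τ => ε - |τ|) (by fun_prop) 0 (by simpa),
          hcont (fun τ => 1 - t + τ * p) (by fun_prop) 0 (by simpa),
          hcont (fun τ => t + τ * q) (by fun_prop) 0 (by simpa)] with τ h1 h2 h3
        by_contra! hneg
        refine triangle_free hc hT hx hz h2.le h3.le (by linarith) ?_
        convert huW τ (by linarith) using 1
        simp only [hf, hpq]
        module
      obtain ⟨δ, hδ, hball⟩ := Metric.eventually_nhds_iff.1 hev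
      have hp := hball (y := δ / 2) (by rw [Real.dist_eq, sub_zero, abs_of_pos] <;> linarith)
      have hm := hball (y := -(δ / 2))
        (by rw [Real.dist_eq, sub_zero, abs_neg, abs_of_pos] <;> linarith)
      have hpq0 : p + q = 0 := by nlinarith
      have hq : q ≠ 0 := by
        rintro rfl
        exact hu (by simp [hpq, show p = 0 by linarith])
      have hev2 : ∀ᶠ τ in nhds t, |(τ - t) / q| < ε := by
        have hc2 : Continuous fun τ : ℝ => |(τ - t) / q| := by fun_prop
        exact (hc2.tendsto t).eventually (gt_mem_nhds (by simpa))
      filter_upwards [hev2, Ioo_mem_nhds ht0 ht1] with τ h1 h2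
      refine ⟨h2, ?_⟩
      convert huW _ h1 using 1
      simp only [hf, hpq, show p = -q by linarith]
      have : -q • (x - y) + q • (z - y) = q • (z - x) := by module
      rw [this, smul_smul, div_mul_cancel₀ _ hq]
      module
    have hopen' : IsOpen {t | f t ∉ W} := (hc.preimage hfc).isOpen_compl
    rcases isPreconnected_Ioo.subset_or_subset hopen hopen'
      (Set.disjoint_left.2 fun t h h' => h' h.2)
      (fun t ht => (em (f t ∈ W)).imp (fun h => ⟨ht, h⟩) id) with h | h
    · exact Or.inr fun t h0 h1 => (h ⟨h0, h1⟩).2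
    · exact Or.inl fun t h0 h1 => h ⟨h0, h1⟩

/-- If `[y, x)` and `[y, z)` avoid `W` and `x` is not in `W`, then `[x, z)` avoids `W`. -/
lemma Reach.trans {W : Set Pt} (hc : IsClosed W) (hT : ∀ p ∈ W, Thru W p)
    {x y z : Pt} (hx : Reach W y x) (hxW : x ∉ W) (hz : Reach W y z) : Reach W x z := by
  intro t ht0 ht1
  rcases ht0.eq_or_lt with rfl | ht0
  · simpa using hxW
  rcases open_segment_free_or_subset hc hT hx hz with h | h
  · exact h t ht0 ht1
  · have hcont : Continuous fun t : ℝ => x + t • (z - x) := by fun_prop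
    have := (hcont.tendsto 0).eventually (hc.isOpen_compl.mem_nhds (by simpa using hxW))
    obtain ⟨δ, hδ, hball⟩ := Metric.eventually_nhds_iff.1 this
    have hmin : 0 < min (δ / 2) (1 / 2) := by positivity
    refine absurd (h (min (δ / 2) (1 / 2)) hmin ?_) (hball ?_)
    · exact (min_le_right _ _).trans_lt (by norm_num)
    · rw [Real.dist_eq, sub_zero, abs_of_pos hmin]
      exact (min_le_left _ _).trans_lt (by linarith)

/-- Mutual visibility: the closed segment `[x, y]` avoids `W`. -/
def Vis (W : Set Pt) (x y : Pt) : Prop := Reach W x y ∧ y ∉ W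

lemma Vis.symm {W : Set Pt} {x y : Pt} (h : Vis W x y) : Vis W y x := by
  refine ⟨fun t ht0 ht1 => ?_, h.1.not_mem⟩
  rcases ht0.eq_or_lt with rfl | ht0
  · simpa using h.2
  · have := h.1 (1 - t) (by linarith) (by linarith)
    convert this using 2
    module

lemma Vis.trans_reach {W : Set Pt} (hc : IsClosed W) (hT : ∀ p ∈ W, Thru W p)
    {x y z : Pt} (hx : Vis W x y) (hz : Reach W y z) : Reach W x z :=
  Reach.trans hc hT hx.symm.1 hx.1.not_mem hz

lemma Vis.trans {W : Set Pt} (hc : IsClosed W) (hT : ∀ p ∈ W, Thru W p)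
    {x y z : Pt} (hx : Vis W x y) (hz : Vis W y z) : Vis W x z :=
  ⟨hx.trans_reach hc hT hz.1, hz.2⟩

lemma Vis.refl {W : Set Pt} {x : Pt} (hx : x ∉ W) : Vis W x x :=
  ⟨fun t _ _ => by simpa using hx, hx⟩

lemma Reach.vis {W : Set Pt} {c v : Pt} (h : Reach W c v) {t : ℝ} (ht0 : 0 ≤ t) (ht1 : t < 1) :
    Vis W c (c + t • (v - c)) := by
  refine ⟨fun s hs0 hs1 => ?_, h t ht0 ht1⟩
  have := h (s * t) (by positivity) (by nlinarith)
  rwa [add_sub_cancel_left, smul_smul]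

lemma Vis.of_convex {W S : Set Pt} (hS : Convex ℝ S) (hd : ∀ p ∈ S, p ∉ W) {x y : Pt}
    (hx : x ∈ S) (hy : y ∈ S) : Vis W x y :=
  ⟨fun _ ht0 ht1 => hd _ (hS.add_smul_sub_mem hx hy ⟨ht0, ht1.le⟩), hd _ hy⟩

/-- The orientation of `q` relative to the directed edge `e`. -/
def crs (e : Pt × Pt) (q : Pt) : ℝ := det (e.2 - e.1) (q - e.1)

/-- `q` is strictly on the left (`true`) or on the right (`false`) of the edge `e`. -/
def OnSide : Bool → Pt × Pt → Pt → Prop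
  | true, e, q => 0 < crs e q
  | false, e, q => crs e q < 0

/-- `v` is an endpoint of the edge `e ∈ M`, and `v'` is its other endpoint. -/
def Tip (M : Finset (Pt × Pt)) (e : Pt × Pt) (v v' : Pt) : Prop :=
  e ∈ M ∧ (v = e.1 ∧ v' = e.2 ∨ v = e.2 ∧ v' = e.1)

/-- Disjoint segments whose endpoints are in general position. -/
structure Good (M : Finset (Pt × Pt)) : Prop where
  ne : ∀ e ∈ M, e.1 ≠ e.2
  disj : ∀ e ∈ M, ∀ s ∈ M, ∀ p ∈ segment ℝ e.1 e.2, p ∈ segment ℝ s.1 s.2 → e = s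
  gp : ∀ e v v', Tip M e v v' → ∀ s ∈ M, s ≠ e → crs s v ≠ 0

/-- The union of the segments of `M` and of the walls in `L`. -/
def WSet (M : Finset (Pt × Pt)) (L : Set (Set Pt × Bool)) : Set Pt :=
  {p | (∃ e ∈ M, p ∈ segment ℝ e.1 e.2) ∨ ∃ A ∈ L, p ∈ A.1}

/-- A system of walls with states; `U` is the set of endpoints of `M` whose segments have not been
extended yet. -/
structure Walls (M : Finset (Pt × Pt)) (L : Set (Set Pt × Bool)) (U : Set Pt) : Prop where
  fin : L.Finite
  closed : ∀ A ∈ L, IsClosed A.1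
  tips : ∀ v ∈ U, ∃ e v', Tip M e v v'
  thru : ∀ p ∈ WSet M L, p ∉ U → Thru (WSet M L) p
  agree : ∀ A ∈ L, ∀ A' ∈ L, ∀ p ∈ A.1, p ∈ A'.1 → (∀ e ∈ M, p ∉ segment ℝ e.1 e.2) → A.2 = A'.2
  side : ∀ A ∈ L, ∀ e ∈ M, ∀ p ∈ A.1, p ∈ segment ℝ e.1 e.2 → p ≠ e.1 → p ≠ e.2 →
    ∀ q ∈ A.1, q ≠ p → OnSide A.2 e q
  undone : ∀ e v v', Tip M e v v' → v ∈ U → ∀ A ∈ L, v ∉ A.1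
  done : ∀ e v v', Tip M e v v' → v ∉ U → ∃ A ∈ L, v ∈ A.1 ∧ (∀ A' ∈ L, v ∈ A'.1 → A' = A) ∧
    ∀ q ∈ A.1, ∃ t : ℝ, 0 ≤ t ∧ q = v + t • (v - v')

/-- A wall with state `σ` may be attached at `x` in the direction of `y`. -/
structure Att (M : Finset (Pt × Pt)) (L : Set (Set Pt × Bool)) (x y : Pt) (σ : Bool) : Prop where
  mem : x ∈ WSet M L
  ntip : ∀ e v v', Tip M e v v' → x ≠ v
  wall : ∀ A ∈ L, x ∈ A.1 → (∀ e ∈ M, x ∉ segment ℝ e.1 e.2) → A.2 = σ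
  body : ∀ e ∈ M, x ∈ segment ℝ e.1 e.2 → OnSide σ e y

lemma crs_line (e : Pt × Pt) (x y : Pt) (t : ℝ) :
    crs e (x + t • (y - x)) = (1 - t) * crs e x + t * crs e y := by
  simp only [crs, det, Prod.fst_add, Prod.snd_add, Prod.smul_fst, Prod.smul_snd, smul_eq_mul,
    Prod.fst_sub, Prod.snd_sub]
  ring

lemma mem_segment_iff' {x y p : Pt} :
    p ∈ segment ℝ x y ↔ ∃ t : ℝ, 0 ≤ t ∧ t ≤ 1 ∧ p = x + t • (y - x) := by
  rw [segment_eq_image']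
  simp only [Set.mem_image, Set.mem_Icc]
  exact ⟨fun ⟨t, h, h'⟩ => ⟨t, h.1, h.2, h'.symm⟩, fun ⟨t, h, h', h''⟩ => ⟨t, ⟨h, h'⟩, h''.symm⟩⟩

lemma crs_fst (e : Pt × Pt) : crs e e.1 = 0 := by simp [crs, det]

lemma crs_snd (e : Pt × Pt) : crs e e.2 = 0 := by
  simp only [crs, det, Prod.fst_sub, Prod.snd_sub]
  ring

lemma crs_eq_zero_of_mem {e : Pt × Pt} {p : Pt} (h : p ∈ segment ℝ e.1 e.2) : crs e p = 0 := by
  obtain ⟨t, -, -, rfl⟩ := mem_segment_iff'.1 h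
  rw [crs_line, crs_fst, crs_snd]
  ring

lemma OnSide.line {σ : Bool} {e : Pt × Pt} {x y : Pt} (hx : crs e x = 0) (hy : OnSide σ e y)
    {t : ℝ} (ht : 0 < t) : OnSide σ e (x + t • (y - x)) := by
  cases σ <;> simp only [OnSide, crs_line, hx] at hy ⊢ <;> nlinarith

lemma OnSide.ne_zero {σ : Bool} {e : Pt × Pt} {y : Pt} (hy : OnSide σ e y) : crs e y ≠ 0 := by
  cases σ <;> simp only [OnSide] at hy
  exacts [hy.ne, hy.ne']

lemma onSide_of_ne {e : Pt × Pt} {y : Pt} (h : crs e y ≠ 0) :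
    OnSide (decide (0 < crs e y)) e y := by
  by_cases h' : 0 < crs e y
  · simp [h', OnSide]
  · simpa [h', OnSide] using lt_of_le_of_ne (not_lt.1 h') h

lemma OnSide.eq_decide {σ : Bool} {e : Pt × Pt} {y : Pt} (hy : OnSide σ e y) :
    σ = decide (0 < crs e y) := by
  cases σ <;> simp only [OnSide] at hy
  · simpa using hy.le
  · simpa using hy

lemma Tip.mem {M : Finset (Pt × Pt)} {e : Pt × Pt} {v v' : Pt} (h : Tip M e v v') :
    v ∈ segment ℝ e.1 e.2 := by
  rcases h.2 with ⟨rfl, -⟩ | ⟨rfl, -⟩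
  exacts [left_mem_segment _ _ _, right_mem_segment _ _ _]

lemma Tip.unique {M : Finset (Pt × Pt)} (hM : Good M) {e s : Pt × Pt} {v v' w' : Pt}
    (h : Tip M e v v') (h' : Tip M s v w') : e = s ∧ v' = w' := by
  obtain rfl := hM.disj e h.1 s h'.1 v h.mem h'.mem
  have := hM.ne e h.1
  refine ⟨rfl, ?_⟩
  rcases h.2 with ⟨h1, h2⟩ | ⟨h1, h2⟩ <;> rcases h'.2 with ⟨h3, h4⟩ | ⟨h3, h4⟩
  · rw [h2, h4]
  · exact absurd (h1.symm.trans h3) this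
  · exact absurd (h3.symm.trans h1) this
  · rw [h2, h4]

lemma Tip.ne {M : Finset (Pt × Pt)} (hM : Good M) {e : Pt × Pt} {v v' : Pt}
    (h : Tip M e v v') : v ≠ v' := by
  have := hM.ne e h.1
  rcases h.2 with ⟨rfl, rfl⟩ | ⟨rfl, rfl⟩
  exacts [this, this.symm]

lemma Tip.segment_eq {M : Finset (Pt × Pt)} {e : Pt × Pt} {v v' : Pt}
    (h : Tip M e v v') : segment ℝ e.1 e.2 = segment ℝ v v' := by
  rcases h.2 with ⟨rfl, rfl⟩ | ⟨rfl, rfl⟩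
  exacts [rfl, segment_symm _ _ _]

lemma Tip.mem_wset {M : Finset (Pt × Pt)} {L : Set (Set Pt × Bool)} {e : Pt × Pt} {v v' : Pt}
    (h : Tip M e v v') : v ∈ WSet M L := Or.inl ⟨e, h.1, h.mem⟩

lemma segment_closed (x y : Pt) : IsClosed (segment ℝ x y) := by
  rw [segment_eq_image']
  exact (isCompact_Icc.image (by fun_prop)).isClosed

lemma isClosed_wset (M : Finset (Pt × Pt)) {L : Set (Set Pt × Bool)} (hfin : L.Finite)
    (hcl : ∀ A ∈ L, IsClosed A.1) : IsClosed (WSet M L) := by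
  have : WSet M L = (⋃ e ∈ (M : Set (Pt × Pt)), segment ℝ e.1 e.2) ∪ ⋃ A ∈ L, A.1 := by
    ext p
    simp only [WSet, Set.mem_union, Set.mem_iUnion, exists_prop, Finset.mem_coe]
    rfl
  rw [this]
  exact (M.finite_toSet.isClosed_biUnion fun e _ => segment_closed _ _).union
    (hfin.isClosed_biUnion hcl)

lemma Walls.isClosed {M : Finset (Pt × Pt)} {L : Set (Set Pt × Bool)} {U : Set Pt}
    (h : Walls M L U) : IsClosed (WSet M L) := isClosed_wset M h.fin h.closed

lemma WSet.insert_mem {M : Finset (Pt × Pt)} {L : Set (Set Pt × Bool)} {A : Set Pt × Bool}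
    {p : Pt} : p ∈ WSet M (insert A L) ↔ p ∈ A.1 ∨ p ∈ WSet M L := by
  simp only [WSet, Set.mem_ofPred_eq, Set.exists_mem_insert]
  exact or_left_comm

lemma mem_segment_of_wset {W : Set Pt} {x y p : Pt}
    (hfree : ∀ t : ℝ, 0 < t → t < 1 → x + t • (y - x) ∉ W) (hp : p ∈ segment ℝ x y)
    (hpW : p ∈ W) : p = x ∨ p = y := by
  obtain ⟨t, h0, h1, rfl⟩ := mem_segment_iff'.1 hp
  rcases h0.eq_or_lt with rfl | h0
  · simp
  rcases h1.eq_or_lt with rfl | h1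
  · simp
  exact absurd hpW (hfree t h0 h1)

theorem Walls.add {M : Finset (Pt × Pt)} {L : Set (Set Pt × Bool)} {U : Set Pt} (hM : Good M)
    (h : Walls M L U) {x y : Pt} {σ : Bool} (hxy : x ≠ y)
    (hfree : ∀ t : ℝ, 0 < t → t < 1 → x + t • (y - x) ∉ WSet M L) (hy : Att M L y x σ)
    (hx : Att M L x y σ ∨
      x ∈ U ∧ ∃ e v', Tip M e x v' ∧ ∃ k : ℝ, 0 < k ∧ y - x = k • (x - v')) :
    Walls M (insert (segment ℝ x y, σ) L) (U \ {x}) := by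
  have hend : ∀ p ∈ segment ℝ x y, p ∈ WSet M L → p = x ∨ p = y :=
    fun p hp hpW => mem_segment_of_wset hfree hp hpW
  have hagree : ∀ A ∈ L, ∀ p ∈ segment ℝ x y, p ∈ A.1 → (∀ e ∈ M, p ∉ segment ℝ e.1 e.2) →
      A.2 = σ := by
    intro A hA p hp hpA hpe
    rcases hend p hp (Or.inr ⟨A, hA, hpA⟩) with rfl | rfl
    · rcases hx with hx | ⟨hxU, e, v', ht, -⟩
      · exact hx.wall A hA hpA hpe
      · exact absurd hpA (h.undone e _ v' ht hxU A hA)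
    · exact hy.wall A hA hpA hpe
  have hsub : WSet M L ⊆ WSet M (insert (segment ℝ x y, σ) L) :=
    fun p hp => WSet.insert_mem.2 (Or.inr hp)
  refine ⟨h.fin.insert _, ?_, fun v hv => h.tips v hv.1, ?_, ?_, ?_, ?_, ?_⟩
  · rintro A (rfl | hA)
    exacts [segment_closed _ _, h.closed A hA]
  · intro p hp hpU
    have hmain : p ∈ WSet M L → Thru (WSet M (insert (segment ℝ x y, σ) L)) p := by
      intro hpW
      by_cases hpU' : p ∈ U
      · obtain rfl : p = x := by
          by_contra hpx
          exact hpU ⟨hpU', hpx⟩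
        rcases hx with hx | ⟨-, e, v', ht, k, hk, hkv⟩
        · obtain ⟨e, v', ht⟩ := h.tips _ hpU'
          exact absurd rfl (hx.ntip _ _ _ ht)
        refine ⟨p - v', sub_ne_zero.2 (ht.ne hM), min k 1, by positivity, fun t ht' => ?_⟩
        rw [lt_min_iff, abs_lt, abs_lt] at ht'
        rcases le_or_gt 0 t with h0 | h0
        · refine WSet.insert_mem.2 (Or.inl (mem_segment_iff'.2
            ⟨t / k, by positivity, (div_le_one hk).2 ht'.1.2.le, ?_⟩))
          rw [hkv, smul_smul, div_mul_cancel₀ _ hk.ne']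
        · refine hsub (Or.inl ⟨e, ht.1, ?_⟩)
          rw [ht.segment_eq, mem_segment_iff']
          exact ⟨-t, by linarith, by linarith, by module⟩
      · exact (h.thru p hpW hpU').mono hsub
    by_cases hpW : p ∈ WSet M L
    · exact hmain hpW
    rcases WSet.insert_mem.1 hp with hp | hp
    · obtain ⟨t, h0, h1, rfl⟩ := mem_segment_iff'.1 hp
      have h0' : 0 < t ∧ t < 1 := by
        constructor
        · refine h0.lt_of_ne ?_
          rintro rfl
          refine hpW ?_
          rcases hx with hx | ⟨-, e, v', ht, -⟩
          · simpa using hx.mem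
          · simpa using ht.mem_wset
        · refine h1.lt_of_ne ?_
          rintro rfl
          exact hpW (by simpa using hy.mem)
      refine ⟨y - x, sub_ne_zero.2 hxy.symm, min t (1 - t), by
        have := h0'.1; have : 0 < 1 - t := by linarith [h0'.2]
        positivity, fun r hr => WSet.insert_mem.2 (Or.inl (mem_segment_iff'.2
          ⟨t + r, ?_, ?_, by module⟩))⟩ <;>
      · rw [lt_min_iff, abs_lt, abs_lt] at hr
        linarith
    · exact hmain hp
  · rintro A (rfl | hA) A' (rfl | hA') p hp hp' hpe
    · rfl
    · exact (hagree A' hA' p hp hp' hpe).symm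
    · exact hagree A hA p hp' hp hpe
    · exact h.agree A hA A' hA' p hp hp' hpe
  · rintro A (rfl | hA) e he p hp hpe h1 h2 q hq hqp
    · have hpy : ∀ {x y : Pt}, Att M L x y σ → x ∈ segment ℝ e.1 e.2 → q ∈ segment ℝ x y →
          q ≠ x → OnSide σ e q := by
        intro x y hxy hx hq hqx
        obtain ⟨t, h0, h1, rfl⟩ := mem_segment_iff'.1 hq
        refine (hxy.body e he hx).line (crs_eq_zero_of_mem hx) (h0.lt_of_ne ?_)
        rintro rfl
        simp at hqx
      rcases hend p hp (Or.inl ⟨e, he, hpe⟩) with rfl | rfl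
      · rcases hx with hx | ⟨-, s, v', ht, -⟩
        · exact hpy hx hpe hq hqp
        · obtain rfl := hM.disj e he s ht.1 _ hpe ht.mem
          rcases ht.2 with ⟨h3, -⟩ | ⟨h3, -⟩
          exacts [absurd h3 h1, absurd h3 h2]
      · exact hpy hy hpe (by rwa [segment_symm]) hqp
    · exact h.side A hA e he p hp hpe h1 h2 q hq hqp
  · rintro e v v' ht ⟨hv, hvx⟩ A (rfl | hA) hvA
    · rcases hend v hvA ht.mem_wset with rfl | rfl
      · exact hvx rfl
      · exact hy.ntip _ _ _ ht rfl
    · exact h.undone e v v' ht hv A hA hvA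
  · intro e v v' ht hv
    by_cases hvU : v ∈ U
    · obtain rfl : v = x := by
        by_contra hvx
        exact hv ⟨hvU, hvx⟩
      rcases hx with hx | ⟨-, s, w', ht', k, hk, hkv⟩
      · exact absurd rfl (hx.ntip _ _ _ ht)
      obtain ⟨rfl, rfl⟩ := ht.unique hM ht'
      refine ⟨_, Set.mem_insert _ _, left_mem_segment _ _ _, ?_, ?_⟩
      · rintro A' (rfl | hA') hvA
        · rfl
        · exact absurd hvA (h.undone e v v' ht hvU A' hA')
      · intro q hq
        obtain ⟨t, h0, h1, rfl⟩ := mem_segment_iff'.1 hq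
        exact ⟨t * k, by positivity, by rw [hkv, smul_smul]⟩
    · obtain ⟨A, hA, hvA, huniq, hray⟩ := h.done e v v' ht hvU
      refine ⟨A, Set.mem_insert_of_mem _ hA, hvA, ?_, hray⟩
      rintro A' (rfl | hA') hvA'
      · rcases hend v hvA' ht.mem_wset with rfl | rfl
        · rcases hx with hx | ⟨hxU, -⟩
          · exact absurd rfl (hx.ntip _ _ _ ht)
          · exact absurd hxU hvU
        · exact absurd rfl (hy.ntip _ _ _ ht)
      · exact huniq A' hA' hvA'

lemma Att.insert {M : Finset (Pt × Pt)} {L : Set (Set Pt × Bool)} {U : Set Pt} {x y g z : Pt}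
    {σ ρ : Bool} (hg : Att M L g z ρ)
    (hfree : ∀ t : ℝ, 0 < t → t < 1 → x + t • (y - x) ∉ WSet M L) (hy : Att M L y x σ)
    (hx : Att M L x y σ ∨
      x ∈ U ∧ ∃ e v', Tip M e x v' ∧ ∃ k : ℝ, 0 < k ∧ y - x = k • (x - v')) :
    Att M (insert (segment ℝ x y, σ) L) g z ρ := by
  refine ⟨WSet.insert_mem.2 (Or.inr hg.mem), hg.ntip, ?_, hg.body⟩
  rintro A (rfl | hA) hgA hge
  · obtain ⟨A, hA, hgA'⟩ : ∃ A ∈ L, g ∈ A.1 := by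
      rcases hg.mem with ⟨e, he, hge'⟩ | h
      exacts [absurd hge' (hge e he), h]
    rw [← hg.wall A hA hgA' hge]
    rcases mem_segment_of_wset hfree hgA hg.mem with rfl | rfl
    · rcases hx with hx | ⟨-, e, v', ht, -⟩
      · exact (hx.wall A hA hgA' hge).symm
      · exact absurd rfl (hg.ntip _ _ _ ht)
    · exact (hy.wall A hA hgA' hge).symm
  · exact hg.wall A hA hgA hge

lemma Att.redirect {M : Finset (Pt × Pt)} {L : Set (Set Pt × Bool)} {x y : Pt}
    {σ : Bool} (h : Att M L x y σ) {t : ℝ} (ht : 0 < t) : Att M L x (x + t • (y - x)) σ :=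
  ⟨h.mem, h.ntip, h.wall, fun e he hxe => (h.body e he hxe).line (crs_eq_zero_of_mem hxe) ht⟩

/-- An open segment `g` avoiding the walls, at whose two ends walls with states `σ` and `ρ` may be
attached. -/
def Gap (M : Finset (Pt × Pt)) (F : Pt → ℝ) (L : Set (Set Pt × Bool)) (g : Set Pt)
    (σ ρ : Bool) : Prop :=
  ∃ x y : Pt, F x = 0 ∧ F y = 0 ∧ x ≠ y ∧ g = openSegment ℝ x y ∧ (∀ p ∈ g, p ∉ WSet M L) ∧
    Att M L x y σ ∧ Att M L y x ρ

lemma Gap.symm {M : Finset (Pt × Pt)} {F : Pt → ℝ} {L : Set (Set Pt × Bool)} {g : Set Pt}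
    {σ ρ : Bool} (h : Gap M F L g σ ρ) : Gap M F L g ρ σ := by
  obtain ⟨x, y, hx, hy, hxy, rfl, hfree, h1, h2⟩ := h
  exact ⟨y, x, hy, hx, hxy.symm, openSegment_symm _ _ _, hfree, h2, h1⟩

/-- A system of walls together with the gaps that it leaves open on the line `F = 0` inside the
region `D`. -/
structure Sys (M : Finset (Pt × Pt)) (F : Pt → ℝ) (D : Set Pt) {ι : Type} (I : Finset ι)
    (L : Set (Set Pt × Bool)) (U : Set Pt) (G : ι → Set Pt) : Prop where
  walls : Walls M L U
  hit : ∀ c ∈ D, ∀ u : Pt, u ≠ 0 → ∃ t : ℝ, 0 < t ∧ c + t • u ∈ WSet M L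
  gap : ∀ i ∈ I, ∃ σ, Gap M F L (G i) σ (!σ)
  disj : ∀ i ∈ I, ∀ j ∈ I, i ≠ j → Disjoint (G i) (G j)
  cover : ∀ p ∈ D, F p = 0 → p ∉ WSet M L → ∃ i ∈ I, p ∈ G i

lemma mem_openSegment_iff' {x y p : Pt} :
    p ∈ openSegment ℝ x y ↔ ∃ t : ℝ, 0 < t ∧ t < 1 ∧ p = x + t • (y - x) := by
  rw [openSegment_eq_image']
  simp only [Set.mem_image, Set.mem_Ioo]
  exact ⟨fun ⟨t, h, h'⟩ => ⟨t, h.1, h.2, h'.symm⟩, fun ⟨t, h, h', h''⟩ => ⟨t, ⟨h, h'⟩, h''.symm⟩⟩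

/-- The first point of `W` on a ray starting outside the closed set `W`. -/
lemma exists_first_hit {W : Set Pt} (hW : IsClosed W) {c u : Pt} (hc : c ∉ W)
    (h : ∃ t : ℝ, 0 < t ∧ c + t • u ∈ W) :
    ∃ t : ℝ, 0 < t ∧ c + t • u ∈ W ∧ ∀ s : ℝ, 0 ≤ s → s < t → c + s • u ∉ W := by
  obtain ⟨T, hT, hTW⟩ := h
  have hcont : Continuous fun t : ℝ => c + t • u := by fun_prop
  have hK : IsCompact (Set.Icc 0 T ∩ {t | c + t • u ∈ W}) :=
    isCompact_Icc.inter_right (hW.preimage hcont)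
  obtain ⟨t, ⟨⟨ht0, htT⟩, htW⟩, hmin⟩ := hK.exists_isLeast ⟨T, ⟨hT.le, le_rfl⟩, hTW⟩
  refine ⟨t, ht0.lt_of_ne ?_, htW, fun s hs0 hst hsW => ?_⟩
  · rintro rfl
    exact hc (by simpa using htW)
  · exact absurd (hmin ⟨⟨hs0, hst.le.trans htT⟩, hsW⟩) (not_le.2 hst)

/-- Extending the segment of an endpoint `v` beyond `v` until it meets a wall. -/
lemma Walls.shoot {M : Finset (Pt × Pt)} {L : Set (Set Pt × Bool)} {U : Set Pt} (hM : Good M)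
    (h : Walls M L U) {e : Pt × Pt} {v v' : Pt} (hv : v ∈ U) (ht : Tip M e v v')
    (hit : ∃ t : ℝ, 0 < t ∧ v + t • (v - v') ∈ WSet M L) :
    ∃ k : ℝ, 0 < k ∧ ∃ σ,
      (∀ t : ℝ, 0 < t → t < 1 → v + t • ((v + k • (v - v')) - v) ∉ WSet M L) ∧
      Att M L (v + k • (v - v')) v σ := by
  have hvv' := ht.ne hM
  have hoff : ∀ t : ℝ, 0 < t → v + t • (v - v') ∉ segment ℝ e.1 e.2 := by
    intro t h0 hmem
    rw [ht.segment_eq] at hmem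
    obtain ⟨s, hs, -, hs'⟩ := mem_segment_iff'.1 hmem
    have : (t + s) • (v - v') = 0 := by
      have := sub_eq_zero.2 hs'
      rw [← this]; module
    rcases smul_eq_zero.1 this with h1 | h1
    · linarith
    · exact hvv' (sub_eq_zero.1 h1)
  have hcrs : ∀ s ∈ M, s ≠ e → crs s v ≠ 0 := hM.gp e v v' ht
  set Z : Set Pt := WSet (M.erase e) L with hZ
  have hZc : IsClosed Z := isClosed_wset _ h.fin h.closed
  have hvZ : v ∉ Z := by
    rintro (⟨s, hs, hvs⟩ | ⟨A, hA, hvA⟩)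
    · rw [Finset.mem_erase] at hs
      exact hs.1 (hM.disj s hs.2 e ht.1 v hvs ht.mem)
    · exact h.undone e v v' ht hv A hA hvA
  have hWZ : ∀ t : ℝ, 0 < t → (v + t • (v - v') ∈ WSet M L ↔ v + t • (v - v') ∈ Z) := by
    intro t h0
    constructor
    · rintro (⟨s, hs, hvs⟩ | hA)
      · refine Or.inl ⟨s, Finset.mem_erase.2 ⟨?_, hs⟩, hvs⟩
        rintro rfl
        exact hoff t h0 hvs
      · exact Or.inr hA
    · rintro (⟨s, hs, hvs⟩ | hA)
      · exact Or.inl ⟨s, Finset.mem_of_mem_erase hs, hvs⟩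
      · exact Or.inr hA
  obtain ⟨k, hk, hkZ, hkfree⟩ := exists_first_hit hZc hvZ
    (hit.imp fun t h => ⟨h.1, (hWZ t h.1).1 h.2⟩)
  have hcrse : ∀ t : ℝ, crs e (v + t • (v - v')) = 0 := by
    intro t
    have : v + t • (v - v') = v + (-t) • (v' - v) := by module
    rw [this, crs_line]
    rcases ht.2 with ⟨rfl, rfl⟩ | ⟨rfl, rfl⟩ <;> simp [crs_fst, crs_snd]
  have hfree : ∀ t : ℝ, 0 < t → t < 1 → v + t • ((v + k • (v - v')) - v) ∉ WSet M L := by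
    intro t h0 h1
    rw [add_sub_cancel_left, smul_smul, hWZ _ (by positivity)]
    exact hkfree _ (by positivity) (by nlinarith)
  have hntip : ∀ s w w', Tip M s w w' → v + k • (v - v') ≠ w := by
    rintro s w w' hw rfl
    by_cases hse : s = e
    · exact hoff k hk (hse ▸ hw.mem)
    · exact hM.gp s _ w' hw e ht.1 (Ne.symm hse) (hcrse k)
  have hpW := (hWZ k hk).2 hkZ
  by_cases hb : ∃ s ∈ M, v + k • (v - v') ∈ segment ℝ s.1 s.2
  · obtain ⟨s, hs, hps⟩ := hb
    have hse : s ≠ e := by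
      rintro rfl
      exact hoff k hk hps
    refine ⟨k, hk, decide (0 < crs s v), hfree, hpW, hntip, fun A _ _ hn => absurd hps (hn s hs),
      fun s' hs' hps' => ?_⟩
    obtain rfl := hM.disj s hs s' hs' _ hps hps'
    exact onSide_of_ne (hcrs s hs hse)
  · have hnb : ∀ s ∈ M, v + k • (v - v') ∉ segment ℝ s.1 s.2 := fun s hs hps => hb ⟨s, hs, hps⟩
    obtain ⟨A, hA, hpA⟩ : ∃ A ∈ L, v + k • (v - v') ∈ A.1 := hpW.resolve_left hb
    exact ⟨k, hk, A.2, hfree, hpW, hntip,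
      fun A' hA' hpA' _ => h.agree A' hA' A hA _ hpA' hpA hnb,
      fun s hs hps => absurd hps (hnb s hs)⟩

set_option maxHeartbeats 1000000 in
theorem Sys.step {M : Finset (Pt × Pt)} (hM : Good M) {F : Pt → ℝ}
    (hF : ∀ x y : Pt, ∀ t : ℝ, F (x + t • (y - x)) = (1 - t) * F x + t * F y)
    (hFt : ∀ e v v', Tip M e v v' → F v ≠ 0) {D : Set Pt} (hD : ∀ e v v', Tip M e v v' → v ∈ D)
    {ι : Type} {I : Finset ι} {L : Set (Set Pt × Bool)} {U : Set Pt} {G : ι → Set Pt}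
    (h : Sys M F D I L U G) {v : Pt} (hv : v ∈ U) :
    ∃ L' G', Sys M F D I L' (U \ {v}) G' := by
  obtain ⟨e, v', ht⟩ := h.walls.tips v hv
  have hvv' := ht.ne hM
  have hFv := hFt e v v' ht
  obtain ⟨k, hk, σ, hfree, hatt⟩ := h.walls.shoot hM hv ht
    (h.hit v (hD e v v' ht) _ (sub_ne_zero.2 hvv'))
  set p := v + k • (v - v') with hp
  have hvp : v ≠ p := by
    intro h'
    have : k • (v - v') = 0 := by simpa [hp] using h'.symm
    rcases smul_eq_zero.1 this with h1 | h1
    · exact hk.ne' h1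
    · exact hvv' (sub_eq_zero.1 h1)
  have hleft : Att M L v p σ ∨
      v ∈ U ∧ ∃ e v', Tip M e v v' ∧ ∃ k : ℝ, 0 < k ∧ p - v = k • (v - v') :=
    Or.inr ⟨hv, e, v', ht, k, hk, by simp [hp]⟩
  have hW1 := h.walls.add hM hvp hfree hatt hleft
  set L1 := insert (segment ℝ v p, σ) L with hL1
  have hsub1 : WSet M L ⊆ WSet M L1 := fun q hq => WSet.insert_mem.2 (Or.inr hq)
  have huniq : ∀ q ∈ segment ℝ v p, ∀ q' ∈ segment ℝ v p, F q = 0 → F q' = 0 → q = q' := by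
    intro q hq q' hq' h0 h0'
    obtain ⟨s, -, -, rfl⟩ := mem_segment_iff'.1 hq
    obtain ⟨s', -, -, rfl⟩ := mem_segment_iff'.1 hq'
    rw [hF] at h0 h0'
    have : (s - s') * F v = 0 := by
      linear_combination (-s') * h0 + s * h0'
    rcases mul_eq_zero.1 this with h1 | h1
    · rw [sub_eq_zero.1 h1]
    · exact absurd h1 hFv
  have hgF : ∀ i ∈ I, ∀ q ∈ G i, F q = 0 := by
    intro i hi q hq
    obtain ⟨τ, x, y, hx, hy, -, hg, -⟩ := h.gap i hi
    rw [hg] at hq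
    obtain ⟨s, -, -, rfl⟩ := mem_openSegment_iff'.1 hq
    rw [hF, hx, hy]; ring
  have hgW : ∀ i ∈ I, ∀ q ∈ G i, q ∉ WSet M L := by
    intro i hi
    obtain ⟨τ, x, y, -, -, -, -, hfr, -⟩ := h.gap i hi
    exact hfr
  by_cases hpierce : ∃ i ∈ I, ∃ w ∈ G i, w ∈ segment ℝ v p
  · obtain ⟨i, hi, w, hwG, hwv⟩ := hpierce
    obtain ⟨x, y, hx, hy, hxy, hg, hfr, hax, hay⟩ : Gap M F L (G i) σ (!σ) := by
      obtain ⟨τ, hτ⟩ := h.gap i hi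
      by_cases hστ : σ = τ
      · rwa [hστ]
      · have : σ = !τ := by revert hστ; cases σ <;> cases τ <;> simp
        rw [this, Bool.not_not]
        exact hτ.symm
    have hFw := hgF i hi w hwG
    have hwW := hgW i hi w hwG
    obtain ⟨t, ht0, ht1, hwt⟩ : ∃ t : ℝ, 0 < t ∧ t < 1 ∧ w = x + t • (y - x) :=
      mem_openSegment_iff'.1 (hg ▸ hwG)
    have hyw : y - w = (1 - t) • (y - x) := by rw [hwt]; module
    have hxw : x - w = -(t • (y - x)) := by rw [hwt]; module
    have hyx0 : y - x ≠ 0 := sub_ne_zero.2 hxy.symm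
    have hwx : w ≠ x := by
      rw [← sub_ne_zero, ← neg_ne_zero, neg_sub, hxw, neg_ne_zero]
      exact smul_ne_zero ht0.ne' hyx0
    have hwy : w ≠ y := by
      rw [← sub_ne_zero, ← neg_ne_zero, neg_sub, hyw]
      exact smul_ne_zero (by linarith) hyx0
    have hfree1 : ∀ q ∈ G i, q ≠ w → q ∉ WSet M L1 := by
      intro q hq hqw hqW
      rcases WSet.insert_mem.1 hqW with hqv | hqW
      · exact hqw (huniq q hqv w hwv (hgF i hi q hq) hFw)
      · exact hgW i hi q hq hqW
    have hfree2 : ∀ s : ℝ, 0 < s → s < 1 → w + s • (x - w) ∉ WSet M L1 := by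
      intro s hs0 hs1
      refine hfree1 _ ?_ ?_
      · rw [hg, mem_openSegment_iff']
        refine ⟨t * (1 - s), mul_pos ht0 (by linarith), by nlinarith, ?_⟩
        rw [hxw, hwt]; module
      · intro h'
        rw [add_eq_left, smul_eq_zero, sub_eq_zero] at h'
        exact h'.elim hs0.ne' fun h' => hwx h'.symm
    have hattw : ∀ z, Att M L1 w z σ := by
      intro z
      refine ⟨WSet.insert_mem.2 (Or.inl hwv), ?_, ?_, ?_⟩
      · rintro e v v' ht rfl
        exact hFt e w v' ht hFw
      · rintro A (rfl | hA) hwA -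
        · rfl
        · exact absurd (Or.inr ⟨A, hA, hwA⟩) hwW
      · intro e he hwe
        exact absurd (Or.inl ⟨e, he, hwe⟩) hwW
    have hattx : Att M L1 x w σ := by
      rw [hwt]
      exact (hax.insert hfree hatt hleft).redirect ht0
    have hatty : Att M L1 y w (!σ) := by
      have : w = y + (1 - t) • (x - y) := by rw [hwt]; module
      rw [this]
      exact (hay.insert hfree hatt hleft).redirect (by linarith)
    have hwU : w ∉ U := fun hwU => by
      obtain ⟨s, w', hs⟩ := h.walls.tips w hwU
      exact hFt s w w' hs hFw
    have hW2 := hW1.add hM hwx hfree2 hattx (Or.inl (hattw x))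
    have hUw : (U \ {v}) \ {w} = U \ {v} :=
      Set.sdiff_singleton_eq_self fun h' => hwU h'.1
    rw [hUw] at hW2
    set L2 := insert (segment ℝ w x, σ) L1 with hL2
    have hsub2 : WSet M L1 ⊆ WSet M L2 := fun q hq => WSet.insert_mem.2 (Or.inr hq)
    refine ⟨L2, Function.update G i (openSegment ℝ w y), hW2, ?_, ?_, ?_, ?_⟩
    · intro c hc u hu
      obtain ⟨s, hs, hsW⟩ := h.hit c hc u hu
      exact ⟨s, hs, hsub2 (hsub1 hsW)⟩
    · intro j hj
      by_cases hji : j = i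
      · subst hji
        rw [Function.update_self]
        refine ⟨σ, w, y, hFw, hy, hwy, rfl, ?_,
          (hattw y).insert (U := U) hfree2 hattx (Or.inl (hattw x)),
          hatty.insert (U := U) hfree2 hattx (Or.inl (hattw x))⟩
        intro q hq hqW
        obtain ⟨s, hs0, hs1, rfl⟩ := mem_openSegment_iff'.1 hq
        rcases WSet.insert_mem.1 hqW with hq' | hq'
        · obtain ⟨r, hr0, -, hr⟩ := mem_segment_iff'.1 hq'
          rw [add_right_inj, hyw, hxw, smul_smul, smul_neg, ← neg_smul, smul_smul] at hr
          have := smul_left_injective ℝ hyx0 hr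
          nlinarith [mul_pos hs0 (sub_pos.2 ht1), mul_nonneg hr0 ht0.le]
        · refine hfree1 _ ?_ ?_ hq'
          · rw [hg, mem_openSegment_iff']
            refine ⟨t + s * (1 - t), by nlinarith, by nlinarith, ?_⟩
            rw [hyw, hwt]; module
          · intro h'
            rw [add_eq_left, smul_eq_zero, sub_eq_zero] at h'
            exact h'.elim hs0.ne' fun h' => hwy h'.symm
      · rw [Function.update_of_ne hji]
        obtain ⟨τ, x', y', hx', hy', hxy', hg', hfr', hax', hay'⟩ := h.gap j hj
        refine ⟨τ, x', y', hx', hy', hxy', hg', ?_,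
          (hax'.insert hfree hatt hleft).insert (U := U) hfree2 hattx (Or.inl (hattw x)),
          (hay'.insert hfree hatt hleft).insert (U := U) hfree2 hattx (Or.inl (hattw x))⟩
        have hd := Set.disjoint_left.1 (h.disj j hj i hi hji)
        intro q hq hqW
        rcases WSet.insert_mem.1 hqW with hq' | hq'
        · obtain ⟨r, hr0, hr1, rfl⟩ := mem_segment_iff'.1 hq'
          rcases hr1.eq_or_lt with rfl | hr1
          · refine hfr' _ hq ?_
            simpa using hax.mem
          · refine hd hq ?_
            rw [hg, mem_openSegment_iff']
            refine ⟨t * (1 - r), mul_pos ht0 (by linarith), by nlinarith, ?_⟩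
            rw [hxw, hwt]; module
        · rcases WSet.insert_mem.1 hq' with hq' | hq'
          · refine hd hq ?_
            rwa [huniq q hq' w hwv (hgF j hj q hq) hFw]
          · exact hfr' q hq hq'
    · have hsubG : ∀ j, Function.update G i (openSegment ℝ w y) j ⊆ G j := by
        intro j
        by_cases hji : j = i
        · subst hji
          rw [Function.update_self, hg]
          intro q hq
          obtain ⟨s, hs0, hs1, rfl⟩ := mem_openSegment_iff'.1 hq
          rw [mem_openSegment_iff']
          refine ⟨t + s * (1 - t), by nlinarith, by nlinarith, ?_⟩
          rw [hyw, hwt]; module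
        · rw [Function.update_of_ne hji]
      exact fun j hj l hl hjl => (h.disj j hj l hl hjl).mono (hsubG j) (hsubG l)
    · intro q hqD hq0 hqW
      obtain ⟨j, hj, hqj⟩ := h.cover q hqD hq0 fun h' => hqW (hsub2 (hsub1 h'))
      refine ⟨j, hj, ?_⟩
      by_cases hji : j = i
      · subst hji
        rw [Function.update_self]
        rw [hg] at hqj
        obtain ⟨s, hs0, hs1, hqs⟩ := mem_openSegment_iff'.1 hqj
        rcases le_or_gt s t with hst | hst
        · refine absurd (WSet.insert_mem.2 (Or.inl (mem_segment_iff'.2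
            ⟨1 - s / t, ?_, ?_, ?_⟩))) hqW
          · rw [sub_nonneg, div_le_one ht0]; exact hst
          · have : 0 ≤ s / t := by positivity
            linarith
          · rw [hxw, hqs, hwt, smul_neg, smul_smul, sub_mul, div_mul_cancel₀ _ ht0.ne']
            module
        · rw [mem_openSegment_iff']
          have h1t : 0 < 1 - t := by linarith
          refine ⟨(s - t) / (1 - t), div_pos (by linarith) h1t, ?_, ?_⟩
          · rw [div_lt_one h1t]; linarith
          · rw [hyw, hqs, hwt, smul_smul, div_mul_cancel₀ _ h1t.ne']
            module
      · rwa [Function.update_of_ne hji]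
  · push Not at hpierce
    refine ⟨L1, G, hW1, ?_, ?_, h.disj, ?_⟩
    · intro c hc u hu
      obtain ⟨s, hs, hsW⟩ := h.hit c hc u hu
      exact ⟨s, hs, hsub1 hsW⟩
    · intro j hj
      obtain ⟨τ, x', y', hx', hy', hxy', hg', hfr', hax', hay'⟩ := h.gap j hj
      refine ⟨τ, x', y', hx', hy', hxy', hg', ?_, hax'.insert hfree hatt hleft,
        hay'.insert hfree hatt hleft⟩
      intro q hq hqW
      rcases WSet.insert_mem.1 hqW with hq' | hq'
      · exact hpierce j hj q hq hq'
      · exact hfr' q hq hq'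
    · exact fun q hqD hq0 hqW => h.cover q hqD hq0 fun h' => hqW (hsub1 h')

theorem Sys.exists_done {M : Finset (Pt × Pt)} (hM : Good M) {F : Pt → ℝ}
    (hF : ∀ x y : Pt, ∀ t : ℝ, F (x + t • (y - x)) = (1 - t) * F x + t * F y)
    (hFt : ∀ e v v', Tip M e v v' → F v ≠ 0) {D : Set Pt} (hD : ∀ e v v', Tip M e v v' → v ∈ D)
    {ι : Type} {I : Finset ι} {U : Set Pt} (hU : U.Finite) :
    ∀ {L : Set (Set Pt × Bool)} {G : ι → Set Pt}, Sys M F D I L U G →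
      ∃ L' G', Sys M F D I L' ∅ G' := by
  induction U, hU using Set.Finite.induction_on with
  | empty => exact fun h => ⟨_, _, h⟩
  | @insert v U hvU _ ih =>
    intro L G h
    obtain ⟨L', G', h'⟩ := h.step hM hF hFt hD (Set.mem_insert v U)
    rw [Set.insert_sdiff_of_mem _ (Set.mem_singleton v), Set.sdiff_singleton_eq_self hvU] at h'
    exact ih h'

section

open Filter Topology

/-- The state of the wall extending the segment of the endpoint `v`. -/
noncomputable def tipState (L : Set (Set Pt × Bool)) (v : Pt) : Bool :=
  decide (∃ A ∈ L, v ∈ A.1 ∧ A.2 = true)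

/-- `v` is a jump for the state seen from `c`. -/
def Tog (L : Set (Set Pt × Bool)) (c : Pt) (e : Pt × Pt) (v : Pt) : Prop :=
  OnSide (!tipState L v) e c

/-- The state seen from `c` at the point `p` of a wall; at a jump this is the limit from the
clockwise side. -/
noncomputable def st (M : Finset (Pt × Pt)) (L : Set (Set Pt × Bool)) (c p : Pt) : Bool :=
  if ∃ e ∈ M, p = e.1 ∧ Tog L c e p then false
  else if ∃ e ∈ M, p = e.2 ∧ Tog L c e p then true
  else if ∃ e ∈ M, p ∈ segment ℝ e.1 e.2 then
    decide (∃ e ∈ M, p ∈ segment ℝ e.1 e.2 ∧ 0 < crs e c)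
  else decide (∃ A ∈ L, p ∈ A.1 ∧ A.2 = true)

section

variable {M : Finset (Pt × Pt)} {L : Set (Set Pt × Bool)} {c : Pt}

lemma tipState_eq (hW : Walls M L ∅) {e : Pt × Pt} {v v' : Pt} (ht : Tip M e v v')
    {A : Set Pt × Bool} (hA : A ∈ L) (hv : v ∈ A.1) : tipState L v = A.2 := by
  obtain ⟨A', hA', hvA', huniq, -⟩ := hW.done e v v' ht (Set.notMem_empty v)
  have hAA := huniq A hA hv
  unfold tipState
  by_cases h : A.2 = true
  · rw [h, decide_eq_true_iff]
    exact ⟨A, hA, hv, h⟩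
  · rw [Bool.eq_false_of_not_eq_true h, decide_eq_false_iff_not]
    rintro ⟨A'', hA'', hv'', h''⟩
    rw [huniq A'' hA'' hv'', ← hAA] at h''
    exact h h''

lemma Good.eq_fst (hM : Good M) {e s : Pt × Pt} (he : e ∈ M) (hs : s ∈ M) {p : Pt}
    (hp : p ∈ segment ℝ e.1 e.2) (h : p = s.1 ∨ p = s.2) : e = s := by
  refine hM.disj e he s hs p hp ?_
  rcases h with rfl | rfl
  exacts [left_mem_segment _ _ _, right_mem_segment _ _ _]

lemma st_of_body (hM : Good M) {e : Pt × Pt} (he : e ∈ M) {p : Pt}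
    (hp : p ∈ segment ℝ e.1 e.2) (h : p = e.1 ∨ p = e.2 → ¬ Tog L c e p) :
    st M L c p = decide (0 < crs e c) := by
  have h1 : ¬ ∃ e ∈ M, p = e.1 ∧ Tog L c e p := by
    rintro ⟨s, hs, hps, hT⟩
    obtain rfl := hM.eq_fst he hs hp (Or.inl hps)
    exact h (Or.inl hps) hT
  have h2 : ¬ ∃ e ∈ M, p = e.2 ∧ Tog L c e p := by
    rintro ⟨s, hs, hps, hT⟩
    obtain rfl := hM.eq_fst he hs hp (Or.inr hps)
    exact h (Or.inr hps) hT
  rw [st, if_neg h1, if_neg h2, if_pos ⟨e, he, hp⟩]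
  congr 1
  refine propext ⟨?_, fun h => ⟨e, he, hp, h⟩⟩
  rintro ⟨s, hs, hps, h⟩
  rwa [hM.disj e he s hs p hp hps]

lemma st_of_wall (hW : Walls M L ∅) {A : Set Pt × Bool} (hA : A ∈ L) {p : Pt} (hp : p ∈ A.1)
    (h : ∀ e ∈ M, p ∉ segment ℝ e.1 e.2) : st M L c p = A.2 := by
  have h1 : ¬ ∃ e ∈ M, p = e.1 ∧ Tog L c e p := by
    rintro ⟨s, hs, rfl, -⟩
    exact h s hs (left_mem_segment _ _ _)
  have h2 : ¬ ∃ e ∈ M, p = e.2 ∧ Tog L c e p := by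
    rintro ⟨s, hs, rfl, -⟩
    exact h s hs (right_mem_segment _ _ _)
  rw [st, if_neg h1, if_neg h2, if_neg (by rintro ⟨s, hs, hps⟩; exact h s hs hps)]
  by_cases hA2 : A.2 = true
  · rw [hA2, decide_eq_true_iff]
    exact ⟨A, hA, hp, hA2⟩
  · rw [Bool.eq_false_of_not_eq_true hA2, decide_eq_false_iff_not]
    rintro ⟨A', hA', hp', h'⟩
    exact hA2 (by rw [hW.agree A hA A' hA' p hp hp' h, h'])

lemma st_fst {e : Pt × Pt} (he : e ∈ M) (h : Tog L c e e.1) : st M L c e.1 = false := by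
  rw [st, if_pos ⟨e, he, rfl, h⟩]

lemma st_snd (hM : Good M) {e : Pt × Pt} (he : e ∈ M) (h : Tog L c e e.2) :
    st M L c e.2 = true := by
  have h1 : ¬ ∃ s ∈ M, e.2 = s.1 ∧ Tog L c s e.2 := by
    rintro ⟨s, hs, hps, -⟩
    obtain rfl := hM.eq_fst he hs (right_mem_segment _ _ _) (Or.inl hps)
    exact hM.ne e he hps.symm
  rw [st, if_neg h1, if_pos ⟨e, he, rfl, h⟩]

/-- `t` is the parameter of the first point of `W` on the ray from `c` in direction `u`. -/
def FirstHit (W : Set Pt) (c u : Pt) (t : ℝ) : Prop :=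
  0 < t ∧ c + t • u ∈ W ∧ ∀ s : ℝ, 0 ≤ s → s < t → c + s • u ∉ W

lemma det_continuous_left (w : Pt) : Continuous fun u : Pt => det u w := by
  unfold det; fun_prop

lemma det_continuous_right (w : Pt) : Continuous fun u : Pt => det w u := by
  unfold det; fun_prop

lemma det_self (u : Pt) : det u u = 0 := by unfold det; ring

lemma det_smul_left (k : ℝ) (u w : Pt) : det (k • u) w = k * det u w := by
  simp only [det, Prod.smul_fst, Prod.smul_snd, smul_eq_mul]; ring

lemma det_smul_right (k : ℝ) (u w : Pt) : det u (k • w) = k * det u w := by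
  simp only [det, Prod.smul_fst, Prod.smul_snd, smul_eq_mul]; ring

lemma det_swap (u w : Pt) : det u w = -det w u := by unfold det; ring

/-- Rays close to a ray crossing a segment cross this segment nearby. -/
lemma eventually_cross {c u₀ w : Pt} {t₀ ε δ : ℝ} (hε : 0 < ε) (hδ : 0 < δ)
    (ht₀ : 0 < t₀) (hd : det w u₀ ≠ 0) :
    ∀ᶠ u in 𝓝 u₀, ∃ t, 0 < t ∧ t < t₀ + δ ∧ ∃ s, |s| < ε ∧ c + t • u = c + t₀ • u₀ + s • w := by
  have hd1 := det_continuous_right w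
  have h1 : ∀ᶠ u in 𝓝 u₀, det w u ≠ 0 := hd1.continuousAt.eventually_ne hd
  have ht : ContinuousAt (fun u => t₀ * det w u₀ / det w u) u₀ :=
    continuousAt_const.div hd1.continuousAt hd
  have hs : ContinuousAt (fun u => |t₀ * det u u₀ / det w u|) u₀ :=
    (((continuous_const.mul (det_continuous_left u₀)).continuousAt).div hd1.continuousAt hd).abs
  have h2 : ∀ᶠ u in 𝓝 u₀, 0 < t₀ * det w u₀ / det w u :=
    ht.eventually (lt_mem_nhds (by beta_reduce; rw [mul_div_cancel_right₀ _ hd]; exact ht₀))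
  have h3 : ∀ᶠ u in 𝓝 u₀, t₀ * det w u₀ / det w u < t₀ + δ :=
    ht.eventually (gt_mem_nhds (by beta_reduce; rw [mul_div_cancel_right₀ _ hd]; linarith))
  have h4 : ∀ᶠ u in 𝓝 u₀, |t₀ * det u u₀ / det w u| < ε :=
    hs.eventually (gt_mem_nhds (by simpa [det_self] using hε))
  filter_upwards [h1, h2, h3, h4] with u h1 h2 h3 h4
  refine ⟨_, h2, h3, _, h4, ?_⟩
  rw [add_assoc, add_right_inj]
  ext <;> simp only [Prod.fst_add, Prod.snd_add, Prod.smul_fst, Prod.smul_snd, smul_eq_mul] <;>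
    field_simp <;> simp only [det] <;> ring

lemma FirstHit.det_ne {W : Set Pt} {c u₀ w : Pt} {t₀ ε : ℝ} (h : FirstHit W c u₀ t₀)
    (hε : 0 < ε) (hw : w ≠ 0) (hwW : ∀ s : ℝ, |s| < ε → c + t₀ • u₀ + s • w ∈ W) :
    det w u₀ ≠ 0 := by
  intro hd
  obtain ⟨ht₀, -, hfree⟩ := h
  obtain ⟨k, hk⟩ := exists_smul_of_det_eq_zero hw hd
  have hη : 0 < min t₀ (ε / (|k| + 1)) := by positivity
  set η := min t₀ (ε / (|k| + 1))
  refine hfree (t₀ - η) (by linarith [min_le_left t₀ (ε / (|k| + 1))]) (by linarith) ?_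
  convert hwW (-(η * k)) ?_ using 1
  · rw [neg_smul, mul_smul, ← hk]; module
  · rw [abs_neg, abs_mul, abs_of_pos hη]
    have h1 : η ≤ ε / (|k| + 1) := min_le_right _ _
    rw [le_div_iff₀ (by positivity)] at h1
    nlinarith

/-- The first hits of rays close to `u₀` only lie in pieces containing the first hit of `u₀`. -/
lemma eventually_pieces (hW : Walls M L ∅) {u₀ : Pt} {t₀ : ℝ}
    (h : FirstHit (WSet M L) c u₀ t₀) :
    ∀ᶠ u in 𝓝 u₀, ∀ t, FirstHit (WSet M L) c u t →
      (∀ e ∈ M, c + t • u ∈ segment ℝ e.1 e.2 → c + t₀ • u₀ ∈ segment ℝ e.1 e.2) ∧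
      ∀ A ∈ L, c + t • u ∈ A.1 → c + t₀ • u₀ ∈ A.1 := by
  set p := c + t₀ • u₀ with hp
  set Z : Set Pt := WSet (M.filter fun e => p ∉ segment ℝ e.1 e.2) {A ∈ L | p ∉ A.1} with hZ
  have hZc : IsClosed Z :=
    isClosed_wset _ (hW.fin.subset fun A hA => hA.1) fun A hA => hW.closed A hA.1
  have hpZ : p ∉ Z := by
    rintro (⟨e, he, hpe⟩ | ⟨A, hA, hpA⟩)
    · exact (Finset.mem_filter.1 he).2 hpe
    · exact hA.2 hpA
  have hZW : Z ⊆ WSet M L := by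
    rintro q (⟨e, he, hpe⟩ | ⟨A, hA, hpA⟩)
    · exact Or.inl ⟨e, (Finset.mem_filter.1 he).1, hpe⟩
    · exact Or.inr ⟨A, hA.1, hpA⟩
  have hcont : Continuous fun z : Pt × ℝ => c + z.2 • z.1 := by fun_prop
  have hδ : ∃ δ > 0, ∀ t, 0 ≤ t → t ≤ t₀ + δ → c + t • u₀ ∉ Z := by
    have hc1 : Continuous fun t : ℝ => c + t • u₀ := by fun_prop
    have := hc1.continuousAt.eventually (hZc.isOpen_compl.mem_nhds hpZ)
    obtain ⟨δ, hδ, hball⟩ := Metric.eventually_nhds_iff.1 this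
    refine ⟨δ / 2, by positivity, fun t h0 h1 => ?_⟩
    rcases lt_or_ge t t₀ with h2 | h2
    · exact fun h' => h.2.2 t h0 h2 (hZW h')
    · exact hball (by rw [Real.dist_eq, abs_of_nonneg] <;> linarith)
  obtain ⟨δ, hδ, hδZ⟩ := hδ
  have h1 : ∀ᶠ u in 𝓝 u₀, ∀ t ∈ Set.Icc 0 (t₀ + δ), c + t • u ∉ Z := by
    refine isCompact_Icc.eventually_forall_of_forall_eventually fun t ht => ?_
    exact (hcont.continuousAt (x := (u₀, t))).eventually
      (hZc.isOpen_compl.mem_nhds (hδZ t ht.1 ht.2))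
  obtain ⟨w, hw, ε, hε, hwW⟩ := hW.thru p h.2.1 (Set.notMem_empty _)
  filter_upwards [h1, eventually_cross (c := c) hε hδ h.1 (h.det_ne hε hw hwW)] with u h1 h2 t ht
  obtain ⟨t', ht'0, ht', s, hs, hts⟩ := h2
  have htt' : t ≤ t' := by
    by_contra! hlt
    refine ht.2.2 t' ht'0.le hlt ?_
    rw [hts]
    exact hwW s hs
  have hq := h1 t ⟨ht.1.le, by linarith⟩
  constructor
  · intro e he hqe
    by_contra hpe
    exact hq (Or.inl ⟨e, Finset.mem_filter.2 ⟨he, hpe⟩, hqe⟩)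
  · intro A hA hqA
    by_contra hpA
    exact hq (Or.inr ⟨A, ⟨hA, hpA⟩, hqA⟩)
/-- Near a point, only the pieces containing this point matter. -/
lemma near_pieces (hW : Walls M L ∅) (p : Pt) :
    ∀ᶠ q in 𝓝 p, (∀ e ∈ M, q ∈ segment ℝ e.1 e.2 → p ∈ segment ℝ e.1 e.2) ∧
      ∀ A ∈ L, q ∈ A.1 → p ∈ A.1 := by
  refine Filter.Eventually.and ?_ ?_
  · refine (Filter.eventually_all_finset M).2 fun e _ => ?_
    by_cases h : p ∈ segment ℝ e.1 e.2
    · exact Eventually.of_forall fun _ _ => h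
    · filter_upwards [(segment_closed e.1 e.2).isOpen_compl.mem_nhds h] with q hq hq'
      exact absurd hq' hq
  · refine (Filter.eventually_all_finite hW.fin).2 fun A hA => ?_
    by_cases h : p ∈ A.1
    · exact Eventually.of_forall fun _ _ => h
    · filter_upwards [(hW.closed A hA).isOpen_compl.mem_nhds h] with q hq hq'
      exact absurd hq' hq

lemma crs_add_smul (e : Pt × Pt) (q w : Pt) (s : ℝ) :
    crs e (q + s • w) = crs e q + s * det (e.2 - e.1) w := by
  simp only [crs, det, Prod.fst_add, Prod.snd_add, Prod.smul_fst, Prod.smul_snd, smul_eq_mul,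
    Prod.fst_sub, Prod.snd_sub]
  ring

lemma Tip.crs_eq_zero {e : Pt × Pt} {v v' : Pt} (h : Tip M e v v') : crs e v = 0 :=
  crs_eq_zero_of_mem h.mem

lemma Tip.symm {e : Pt × Pt} {v v' : Pt} (h : Tip M e v v') : Tip M e v' v :=
  ⟨h.1, h.2.symm.imp And.symm And.symm⟩

lemma Tip.done_line (hM : Good M) (hW : Walls M L ∅) {e : Pt × Pt} {v v' : Pt}
    (h : Tip M e v v') :
    ∀ q, (∀ s ∈ M, q ∈ segment ℝ s.1 s.2 → v ∈ segment ℝ s.1 s.2) →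
      (∀ A ∈ L, q ∈ A.1 → v ∈ A.1) → q ∈ WSet M L →
      q ∈ segment ℝ e.1 e.2 ∨ (∃ t : ℝ, 0 < t ∧ q = v + t • (v - v')) ∧
        ∃ A ∈ L, q ∈ A.1 ∧ tipState L v = A.2 := by
  intro q h1 h2 hq
  rcases hq with ⟨s, hs, hqs⟩ | ⟨A, hA, hqA⟩
  · rw [hM.disj e h.1 s hs v h.mem (h1 s hs hqs)]
    exact Or.inl hqs
  · have hvA := h2 A hA hqA
    obtain ⟨A', hA', hvA', huniq, hray⟩ := hW.done e v v' h (Set.notMem_empty v)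
    obtain rfl := huniq A hA hvA
    obtain ⟨t, ht, rfl⟩ := hray q hqA
    rcases ht.eq_or_lt with rfl | ht
    · left
      simpa using h.mem
    · exact Or.inr ⟨⟨t, ht, rfl⟩, A, hA, hqA, tipState_eq hW h hA hvA⟩

lemma Tip.near (hM : Good M) (hW : Walls M L ∅) {e : Pt × Pt} {v v' : Pt}
    (h : Tip M e v v') : ∀ᶠ q in 𝓝 v, q ∈ WSet M L → crs e q = 0 := by
  filter_upwards [near_pieces hW v] with q hq hqW
  rcases h.done_line hM hW q hq.1 hq.2 hqW with h' | ⟨⟨t, -, rfl⟩, -⟩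
  · exact crs_eq_zero_of_mem h'
  · have : v + t • (v - v') = v + (-t) • (v' - v) := by module
    rw [this, crs_line, h.crs_eq_zero, h.symm.crs_eq_zero]
    ring

/-- A point seeing an endpoint of an edge is not on the line of this edge. -/
lemma Tip.crs_ne_of_reach (hM : Good M) (hW : Walls M L ∅) {e : Pt × Pt} {v v' : Pt}
    (h : Tip M e v v') (hc : Reach (WSet M L) c v) : crs e c ≠ 0 := by
  intro h0
  obtain ⟨w, hw, ε, hε, hwW⟩ := hW.thru v h.mem_wset (Set.notMem_empty _)
  have hee : e.2 - e.1 ≠ 0 := sub_ne_zero.2 (hM.ne e h.1).symm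
  have hdw : det (e.2 - e.1) w = 0 := by
    have hcont : ContinuousAt (fun s : ℝ => v + s • w) 0 := by fun_prop
    have h1 := hcont.eventually (by simpa using h.near hM hW)
    obtain ⟨δ, hδ, hball⟩ := Metric.eventually_nhds_iff.1 h1
    have hpos : 0 < min (ε / 2) (δ / 2) := by positivity
    have h2 := hball (y := min (ε / 2) (δ / 2)) (by
      rw [Real.dist_eq, sub_zero, abs_of_pos hpos]
      linarith [min_le_right (ε / 2) (δ / 2)]) (hwW _ (by
        rw [abs_of_pos hpos]
        linarith [min_le_left (ε / 2) (δ / 2)]))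
    rw [crs_add_smul, h.crs_eq_zero, zero_add] at h2
    exact (mul_eq_zero.1 h2).resolve_left hpos.ne'
  have hdc : det (e.2 - e.1) (v - c) = 0 := by
    have h1 := crs_add_smul e c (v - c) 1
    rw [h0, one_smul, add_sub_cancel, h.crs_eq_zero] at h1
    linarith
  have hdwc : det w (v - c) = 0 := by
    obtain ⟨k, hk⟩ := exists_smul_of_det_eq_zero hee hdw
    rw [hk, det_smul_left, hdc, mul_zero]
  obtain ⟨k, hk⟩ := exists_smul_of_det_eq_zero hw hdwc
  have hη : 0 < min 1 (ε / (|k| + 1)) := by positivity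
  refine hc (1 - min 1 (ε / (|k| + 1))) (by linarith [min_le_left 1 (ε / (|k| + 1))])
    (by linarith) ?_
  convert hwW (-(min 1 (ε / (|k| + 1)) * k)) ?_ using 1
  · rw [neg_smul, mul_smul, ← hk]; module
  · rw [abs_neg, abs_mul, abs_of_pos hη]
    have h1 : min 1 (ε / (|k| + 1)) ≤ ε / (|k| + 1) := min_le_right _ _
    rw [le_div_iff₀ (by positivity)] at h1
    nlinarith

lemma FirstHit.reach {W : Set Pt} {u : Pt} {t : ℝ} (h : FirstHit W c u t) :
    Reach W c (c + t • u) := by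
  intro s hs0 hs1
  rw [add_sub_cancel_left, smul_smul]
  exact h.2.2 _ (mul_nonneg hs0 h.1.le) (by nlinarith [h.1])

/-- The states close to the first hit of a ray which is not on a segment. -/
lemma FirstHit.state_wall (hW : Walls M L ∅) {u₀ : Pt} {t₀ : ℝ}
    (h : FirstHit (WSet M L) c u₀ t₀) (hp : ∀ e ∈ M, c + t₀ • u₀ ∉ segment ℝ e.1 e.2) :
    ∀ᶠ u in 𝓝 u₀, ∀ t, FirstHit (WSet M L) c u t →
      st M L c (c + t • u) = st M L c (c + t₀ • u₀) := by
  filter_upwards [eventually_pieces hW h] with u hu t ht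
  obtain ⟨h1, h2⟩ := hu t ht
  rcases ht.2.1 with ⟨e, he, hq⟩ | ⟨A, hA, hq⟩
  · exact absurd (h1 e he hq) (hp e he)
  · rw [st_of_wall hW hA hq fun e he h' => hp e he (h1 e he h'),
      st_of_wall hW hA (h2 A hA hq) hp]

/-- The states close to the first hit of a ray which is inside a segment. -/
lemma FirstHit.state_body (hM : Good M) (hW : Walls M L ∅) {u₀ : Pt} {t₀ : ℝ}
    (h : FirstHit (WSet M L) c u₀ t₀) {e : Pt × Pt} (he : e ∈ M)
    (hp : c + t₀ • u₀ ∈ segment ℝ e.1 e.2) (hp1 : c + t₀ • u₀ ≠ e.1) (hp2 : c + t₀ • u₀ ≠ e.2) :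
    ∀ᶠ u in 𝓝 u₀, ∀ t, FirstHit (WSet M L) c u t →
      st M L c (c + t • u) = st M L c (c + t₀ • u₀) := by
  have hstp : st M L c (c + t₀ • u₀) = decide (0 < crs e c) :=
    st_of_body hM he hp fun h' => (h'.elim hp1 hp2).elim
  obtain ⟨r, hr0, hr1, hr⟩ := mem_segment_iff'.1 hp
  have hr0' : 0 < r := hr0.lt_of_ne (by rintro rfl; simp at hr; exact hp1 (by simpa using hr))
  have hr1' : r < 1 := hr1.lt_of_ne (by rintro rfl; exact hp2 (by rw [hr]; module))
  have hε : 0 < min r (1 - r) := lt_min hr0' (by linarith)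
  have hseg : ∀ s : ℝ, |s| < min r (1 - r) →
      c + t₀ • u₀ + s • (e.2 - e.1) ∈ segment ℝ e.1 e.2 := by
    intro s hs
    rw [lt_min_iff] at hs
    have := abs_lt.1 hs.1
    have := abs_lt.1 hs.2
    exact mem_segment_iff'.2 ⟨r + s, by linarith, by linarith, by rw [hr]; module⟩
  have hee : e.2 - e.1 ≠ 0 := sub_ne_zero.2 (hM.ne e he).symm
  have hd := h.det_ne hε hee fun s hs => Or.inl ⟨e, he, hseg s hs⟩
  have hcc := crs_add_smul e c u₀ t₀
  rw [crs_eq_zero_of_mem hp] at hcc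
  have hc0 : crs e c ≠ 0 := by
    intro h0
    rw [h0, zero_add] at hcc
    exact (mul_ne_zero h.1.ne' hd) hcc.symm
  have hu0 : t₀ • u₀ = e.1 + r • (e.2 - e.1) - c := by rw [← hr]; module
  have hd1 : det (e.1 - c) u₀ ≠ 0 := by
    intro h0
    have h1 : t₀ * det (e.1 - c) u₀ = r * crs e c := by
      rw [← det_smul_right, hu0]
      simp only [crs, det, Prod.fst_add, Prod.snd_add, Prod.smul_fst, Prod.smul_snd, smul_eq_mul,
        Prod.fst_sub, Prod.snd_sub]
      ring
    rw [h0, mul_zero] at h1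
    exact mul_ne_zero hr0'.ne' hc0 h1.symm
  have hd2 : det (e.2 - c) u₀ ≠ 0 := by
    intro h0
    have h1 : t₀ * det (e.2 - c) u₀ = -((1 - r) * crs e c) := by
      rw [← det_smul_right, hu0]
      simp only [crs, det, Prod.fst_add, Prod.snd_add, Prod.smul_fst, Prod.smul_snd, smul_eq_mul,
        Prod.fst_sub, Prod.snd_sub]
      ring
    rw [h0, mul_zero, eq_comm, neg_eq_zero] at h1
    exact mul_ne_zero (sub_pos.2 hr1').ne' hc0 h1
  filter_upwards [eventually_pieces hW h, eventually_cross hε one_pos h.1 hd,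
    (det_continuous_right _).continuousAt.eventually_ne hd1,
    (det_continuous_right _).continuousAt.eventually_ne hd2] with u hu hu' hu1 hu2 t ht
  obtain ⟨h1, h2⟩ := hu t ht
  have hq1 : c + t • u ≠ e.1 := by
    intro h'
    rw [← h', add_sub_cancel_left, det_smul_left, det_self, mul_zero] at hu1
    exact hu1 rfl
  have hq2 : c + t • u ≠ e.2 := by
    intro h'
    rw [← h', add_sub_cancel_left, det_smul_left, det_self, mul_zero] at hu2
    exact hu2 rfl
  rw [hstp]
  by_cases hqe : c + t • u ∈ segment ℝ e.1 e.2
  · exact st_of_body hM he hqe fun h' => (h'.elim hq1 hq2).elim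
  have hqb : ∀ s ∈ M, c + t • u ∉ segment ℝ s.1 s.2 := by
    intro s hs hqs
    obtain rfl := hM.disj e he s hs _ hp (h1 s hs hqs)
    exact hqe hqs
  rcases ht.2.1 with ⟨s, hs, hqs⟩ | ⟨A, hA, hqA⟩
  · exact absurd hqs (hqb s hs)
  rw [st_of_wall hW hA hqA hqb]
  have hside := hW.side A hA e he _ (h2 A hA hqA) hp hp1 hp2 _ hqA
    (by intro h'; rw [h'] at hqe; exact hqe hp)
  rw [hside.eq_decide]
  congr 1
  obtain ⟨t', ht'0, -, s, hs, hts⟩ := hu'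
  have hmem := hseg s hs
  rw [← hts] at hmem
  have htt : t < t' := by
    by_contra! hlt
    rcases hlt.eq_or_lt with rfl | hlt
    · exact hqe hmem
    · exact ht.2.2 t' ht'0.le hlt (Or.inl ⟨e, he, hmem⟩)
  have e1 := crs_add_smul e c u t
  have e2 := crs_add_smul e c u t'
  rw [crs_eq_zero_of_mem hmem] at e2
  have e3 : t' * crs e (c + t • u) = (t' - t) * crs e c := by
    rw [e1]; linear_combination (-t) * e2
  refine propext ⟨fun hh => ?_, fun hh => ?_⟩
  · have := mul_pos ht'0 hh
    rw [e3] at this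
    exact (pos_iff_pos_of_mul_pos this).1 (sub_pos.2 htt)
  · have := mul_pos (sub_pos.2 htt) hh
    rw [← e3] at this
    exact (pos_iff_pos_of_mul_pos this).1 ht'0

/-- The states close to the first hit of a ray which is an endpoint of a segment. -/
lemma FirstHit.state_tip (hM : Good M) (hW : Walls M L ∅) {u₀ : Pt} {t₀ : ℝ}
    (h : FirstHit (WSet M L) c u₀ t₀) {e : Pt × Pt} {v v' : Pt} (hv : Tip M e v v')
    (hp : c + t₀ • u₀ = v) :
    ∀ᶠ u in 𝓝 u₀, ∀ t, FirstHit (WSet M L) c u t → c + t • u = v ∨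
      0 < det (v - c) (v' - v) * det (v - c) u ∧ st M L c (c + t • u) = decide (0 < crs e c) ∨
      det (v - c) (v' - v) * det (v - c) u < 0 ∧ st M L c (c + t • u) = tipState L v := by
  have hc0 : crs e c ≠ 0 := hv.crs_ne_of_reach hM hW (by rw [← hp]; exact h.reach)
  have hd : det (v - c) (v' - v) ≠ 0 := by
    rcases hv.2 with ⟨rfl, rfl⟩ | ⟨rfl, rfl⟩
    · convert hc0 using 1
      simp only [crs, det, Prod.fst_sub, Prod.snd_sub]
      ring
    · convert neg_ne_zero.2 hc0 using 1
      simp only [crs, det, Prod.fst_sub, Prod.snd_sub]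
      ring
  have hdv' : det (v' - c) u₀ ≠ 0 := by
    intro h0
    have h1 : t₀ * det (v' - c) u₀ = -det (v - c) (v' - v) := by
      rw [← det_smul_right, show t₀ • u₀ = v - c by rw [← hp]; module]
      simp only [det, Prod.fst_sub, Prod.snd_sub]
      ring
    rw [h0, mul_zero, eq_comm, neg_eq_zero] at h1
    exact hd h1
  filter_upwards [eventually_pieces hW h,
    (det_continuous_right _).continuousAt.eventually_ne hdv'] with u hu hu1 t ht
  obtain ⟨h1, h2⟩ := hu t ht
  rw [hp] at h1 h2
  by_cases hqv : c + t • u = v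
  · exact Or.inl hqv
  refine Or.inr ?_
  have hqv' : c + t • u ≠ v' := by
    intro h'
    rw [← h', add_sub_cancel_left, det_smul_left, det_self, mul_zero] at hu1
    exact hu1 rfl
  by_cases hqe : c + t • u ∈ segment ℝ e.1 e.2
  · refine Or.inl ⟨?_, ?_⟩
    · rw [hv.segment_eq] at hqe
      obtain ⟨s, hs0, -, hs⟩ := mem_segment_iff'.1 hqe
      have hs0' : 0 < s := hs0.lt_of_ne (by rintro rfl; exact hqv (by simpa using hs))
      have h3 : t * det (v - c) u = s * det (v - c) (v' - v) := by
        rw [← det_smul_right, show t • u = v + s • (v' - v) - c by rw [← hs]; module]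
        simp only [det, Prod.fst_add, Prod.snd_add, Prod.smul_fst, Prod.smul_snd, smul_eq_mul,
          Prod.fst_sub, Prod.snd_sub]
        ring
      have h4 : 0 < t * (det (v - c) (v' - v) * det (v - c) u) := by
        rw [mul_left_comm, h3, mul_left_comm]
        exact mul_pos hs0' (mul_self_pos.2 hd)
      exact (pos_iff_pos_of_mul_pos h4).1 ht.1
    · refine st_of_body hM hv.1 hqe fun h' => ?_
      rcases hv.2 with ⟨rfl, rfl⟩ | ⟨rfl, rfl⟩
      exacts [(h'.elim hqv hqv').elim, (h'.elim hqv' hqv).elim]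
  · rcases hv.done_line hM hW _ h1 h2 ht.2.1 with h' | ⟨⟨s, hs0, hs⟩, A, hA, hqA, hAs⟩
    · exact absurd h' hqe
    refine Or.inr ⟨?_, ?_⟩
    · have h3 : t * det (v - c) u = -(s * det (v - c) (v' - v)) := by
        rw [← det_smul_right, show t • u = v + s • (v - v') - c by rw [← hs]; module]
        simp only [det, Prod.fst_add, Prod.snd_add, Prod.smul_fst, Prod.smul_snd, smul_eq_mul,
          Prod.fst_sub, Prod.snd_sub]
        ring
      have h4 : t * (det (v - c) (v' - v) * det (v - c) u) < 0 := by
        rw [mul_left_comm, h3, mul_neg, mul_left_comm, neg_lt_zero]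
        exact mul_pos hs0 (mul_self_pos.2 hd)
      exact (pos_iff_neg_of_mul_neg h4).1 ht.1
    · rw [hAs]
      refine st_of_wall hW hA hqA fun s' hs' hq' => ?_
      rw [← hM.disj e hv.1 s' hs' v hv.mem (h1 s' hs' hq')] at hq'
      exact hqe hq'

end

/-- `c` sees the endpoint `v` of the edge `e`, and the state seen from `c` jumps at `v`. -/
def Sees (M : Finset (Pt × Pt)) (L : Set (Set Pt × Bool)) (c : Pt) (e : Pt × Pt) (v : Pt) : Prop :=
  Reach (WSet M L) c v ∧ Tog L c e v

section

variable {M : Finset (Pt × Pt)} {L : Set (Set Pt × Bool)} {c : Pt}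

/-- The indicator that `v` is a jump on the left of `d` which is on the left of `u`. -/
noncomputable def passed (M : Finset (Pt × Pt)) (L : Set (Set Pt × Bool)) (c d : Pt)
    (e : Pt × Pt) (v u : Pt) : ℤ :=
  if Sees M L c e v ∧ 0 < det d (v - c) ∧ 0 < det (v - c) u then 1 else 0

lemma FirstHit.unique {W : Set Pt} {u : Pt} {s t : ℝ} (hs : FirstHit W c u s)
    (ht : FirstHit W c u t) : s = t := by
  rcases lt_trichotomy s t with h | h | h
  · exact absurd hs.2.1 (ht.2.2 s hs.1.le h)
  · exact h
  · exact absurd ht.2.1 (hs.2.2 t ht.1.le h)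

lemma Reach.firstHit {W : Set Pt} {v u : Pt} {k : ℝ} (h : Reach W c v) (hv : v ∈ W) (hk : 0 < k)
    (hu : v - c = k • u) : FirstHit W c u k := by
  refine ⟨hk, ?_, fun s hs0 hsk => ?_⟩
  · rw [← hu]
    simpa using hv
  · have := h (s / k) (by positivity) ((div_lt_one hk).2 hsk)
    rwa [hu, smul_smul, div_mul_cancel₀ _ hk.ne'] at this

/-- The indicators are locally constant except for the endpoint which is hit. -/
lemma passed_eventually_eq {d u₀ : Pt} {t₀ : ℝ} (h : FirstHit (WSet M L) c u₀ t₀)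
    (hu₀ : ∀ w, 0 < det d w → det w u₀ = 0 → ∃ k : ℝ, 0 < k ∧ w = k • u₀) {e : Pt × Pt} {v v' : Pt}
    (hv : Tip M e v v') (hne : c + t₀ • u₀ ≠ v ∨ ¬ Tog L c e v) :
    ∀ᶠ u in 𝓝 u₀, passed M L c d e v u = passed M L c d e v u₀ := by
  by_cases h1 : Sees M L c e v ∧ 0 < det d (v - c)
  · have h0 : det (v - c) u₀ ≠ 0 := by
      intro h0
      obtain ⟨k, hk, hkv⟩ := hu₀ _ h1.2 h0
      have := h.unique (h1.1.1.firstHit hv.mem_wset hk hkv)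
      rcases hne with hne | hne
      · rw [this, ← hkv] at hne
        exact hne (by abel)
      · exact hne h1.1.2
    have hcont := (det_continuous_right (v - c)).continuousAt (x := u₀)
    rcases h0.lt_or_gt with h0 | h0
    · filter_upwards [hcont.eventually (gt_mem_nhds h0)] with u hu
      rw [passed, passed, if_neg (by rintro ⟨-, -, h'⟩; exact lt_asymm h' hu),
        if_neg (by rintro ⟨-, -, h'⟩; exact lt_asymm h' h0)]
    · filter_upwards [hcont.eventually (lt_mem_nhds h0)] with u hu
      rw [passed, passed, if_pos ⟨h1.1, h1.2, hu⟩, if_pos ⟨h1.1, h1.2, h0⟩]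
  · refine Eventually.of_forall fun u => ?_
    rw [passed, passed, if_neg fun h' => h1 ⟨h'.1, h'.2.1⟩, if_neg fun h' => h1 ⟨h'.1, h'.2.1⟩]

/-- The state seen from `c` in direction `u`, as an integer. -/
noncomputable def stHit (M : Finset (Pt × Pt)) (L : Set (Set Pt × Bool)) (c u : Pt) : ℤ :=
  if ∃ t, FirstHit (WSet M L) c u t ∧ st M L c (c + t • u) = true then 1 else 0

lemma FirstHit.stHit {u : Pt} {t : ℝ} (h : FirstHit (WSet M L) c u t) :
    stHit M L c u = if st M L c (c + t • u) = true then 1 else 0 := by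
  rw [_root_.stHit]
  refine if_congr ⟨?_, fun h' => ⟨t, h, h'⟩⟩ rfl rfl
  rintro ⟨s, hs, hst⟩
  rwa [h.unique hs]

lemma sum_eventually_eq {d u₀ : Pt} {t₀ : ℝ} (h : FirstHit (WSet M L) c u₀ t₀)
    (hu₀ : ∀ w, 0 < det d w → det w u₀ = 0 → ∃ k : ℝ, 0 < k ∧ w = k • u₀)
    {S : Finset (Pt × Pt)} (hS : S ⊆ M)
    (hne : ∀ e ∈ S, (c + t₀ • u₀ ≠ e.1 ∨ ¬ Tog L c e e.1) ∧
      (c + t₀ • u₀ ≠ e.2 ∨ ¬ Tog L c e e.2)) :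
    ∀ᶠ u in 𝓝 u₀, ∑ e ∈ S, (passed M L c d e e.2 u - passed M L c d e e.1 u) =
      ∑ e ∈ S, (passed M L c d e e.2 u₀ - passed M L c d e e.1 u₀) := by
  have : ∀ᶠ u in 𝓝 u₀, ∀ e ∈ S, passed M L c d e e.2 u - passed M L c d e e.1 u =
      passed M L c d e e.2 u₀ - passed M L c d e e.1 u₀ := by
    refine (Filter.eventually_all_finset S).2 fun e he => ?_
    filter_upwards [passed_eventually_eq h hu₀ (v := e.1) ⟨hS he, Or.inl ⟨rfl, rfl⟩⟩ (hne e he).1,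
      passed_eventually_eq h hu₀ (v := e.2) ⟨hS he, Or.inr ⟨rfl, rfl⟩⟩ (hne e he).2] with u h1 h2
    rw [h1, h2]
  filter_upwards [this] with u hu
  exact Finset.sum_congr rfl hu

lemma Tog.decide_eq {e : Pt × Pt} {v : Pt} (h : Tog L c e v) :
    tipState L v = !decide (0 < crs e c) := by
  have := OnSide.eq_decide h
  rw [← this, Bool.not_not]

lemma balance_eventually_eq (hM : Good M) (hW : Walls M L ∅) (hcW : c ∉ WSet M L)
    (hit : ∀ u : Pt, u ≠ 0 → ∃ t : ℝ, 0 < t ∧ c + t • u ∈ WSet M L) {d u₀ : Pt} (hne0 : u₀ ≠ 0)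
    (hu₀ : ∀ w, 0 < det d w → det w u₀ = 0 → ∃ k : ℝ, 0 < k ∧ w = k • u₀)
    (hd : ∀ e v v', Tip M e v v' → ∀ k : ℝ, 0 < k → v - c = k • u₀ → 0 < det d (v - c)) :
    ∀ᶠ u in 𝓝 u₀, stHit M L c u + ∑ e ∈ M, (passed M L c d e e.2 u - passed M L c d e e.1 u) =
      stHit M L c u₀ + ∑ e ∈ M, (passed M L c d e e.2 u₀ - passed M L c d e e.1 u₀) := by
  have hfirst : ∀ u : Pt, u ≠ 0 → ∃ t, FirstHit (WSet M L) c u t := fun u hu =>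
    exists_first_hit hW.isClosed hcW (hit u hu)
  obtain ⟨t₀, ht₀⟩ := hfirst u₀ hne0
  have hev0 : ∀ᶠ u in 𝓝 u₀, u ≠ 0 := continuousAt_id.eventually_ne hne0
  by_cases hT : ∃ e ∈ M, (c + t₀ • u₀ = e.1 ∧ Tog L c e e.1) ∨ (c + t₀ • u₀ = e.2 ∧ Tog L c e e.2)
  · obtain ⟨e, he, hcase⟩ := hT
    have hpe : c + t₀ • u₀ ∈ segment ℝ e.1 e.2 := by
      rcases hcase with ⟨h, -⟩ | ⟨h, -⟩ <;> rw [h]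
      exacts [left_mem_segment _ _ _, right_mem_segment _ _ _]
    have hrest := sum_eventually_eq ht₀ hu₀ (Finset.erase_subset e M) (by
      intro s hs
      obtain ⟨hse, hs⟩ := Finset.mem_erase.1 hs
      exact ⟨Or.inl fun h => hse (hM.eq_fst he hs hpe (Or.inl h)).symm,
        Or.inl fun h => hse (hM.eq_fst he hs hpe (Or.inr h)).symm⟩)
    rcases hcase with ⟨hp, hTog⟩ | ⟨hp, hTog⟩
    · have htip : Tip M e e.1 e.2 := ⟨he, Or.inl ⟨rfl, rfl⟩⟩
      have hk : e.1 - c = t₀ • u₀ := by rw [← hp]; abel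
      have hsee : Sees M L c e e.1 := ⟨hp ▸ ht₀.reach, hTog⟩
      have hdd := hd e _ _ htip t₀ ht₀.1 hk
      have hother := passed_eventually_eq ht₀ hu₀ htip.symm
        (Or.inl (by rw [hp]; exact hM.ne e he))
      have h1 : det (e.1 - c) (e.2 - e.1) = crs e c := by
        simp only [crs, det, Prod.fst_sub, Prod.snd_sub]; ring
      have key : ∀ u, u ≠ 0 → (∀ t, FirstHit (WSet M L) c u t → c + t • u = e.1 ∨
          0 < det (e.1 - c) (e.2 - e.1) * det (e.1 - c) u ∧
            st M L c (c + t • u) = decide (0 < crs e c) ∨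
          det (e.1 - c) (e.2 - e.1) * det (e.1 - c) u < 0 ∧
            st M L c (c + t • u) = tipState L e.1) →
          stHit M L c u - passed M L c d e e.1 u = 0 := by
        intro u hu h
        obtain ⟨t, ht⟩ := hfirst u hu
        rw [ht.stHit, passed, sub_eq_zero]
        refine if_congr ?_ rfl rfl
        rw [and_iff_right hsee, and_iff_right hdd]
        rcases h t ht with h | ⟨h, h'⟩ | ⟨h, h'⟩
        · rw [h, st_fst he hTog, ← h, add_sub_cancel_left, det_smul_left, det_self]
          simp
        · rw [h1] at h
          rw [h', decide_eq_true_iff]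
          exact pos_iff_pos_of_mul_pos h
        · rw [h1] at h
          rw [h', hTog.decide_eq]
          rcases mul_neg_iff.1 h with ⟨h3, h4⟩ | ⟨h3, h4⟩
          · simp [h3, h4.le]
          · simp [h3.le, h4]
      have hk0 := key u₀ hne0 fun t ht => Or.inl (by rw [ht.unique ht₀, hp])
      filter_upwards [ht₀.state_tip hM hW htip hp, hrest, hother, hev0] with u h2 h3 h4 h5
      have := key u h5 h2
      rw [← Finset.add_sum_erase M _ he, ← Finset.add_sum_erase M _ he, h3, h4]
      linarith
    · have htip : Tip M e e.2 e.1 := ⟨he, Or.inr ⟨rfl, rfl⟩⟩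
      have hk : e.2 - c = t₀ • u₀ := by rw [← hp]; abel
      have hsee : Sees M L c e e.2 := ⟨hp ▸ ht₀.reach, hTog⟩
      have hdd := hd e _ _ htip t₀ ht₀.1 hk
      have hother := passed_eventually_eq ht₀ hu₀ htip.symm
        (Or.inl (by rw [hp]; exact (hM.ne e he).symm))
      have h1 : det (e.2 - c) (e.1 - e.2) = -crs e c := by
        simp only [crs, det, Prod.fst_sub, Prod.snd_sub]; ring
      have key : ∀ u, u ≠ 0 → (∀ t, FirstHit (WSet M L) c u t → c + t • u = e.2 ∨
          0 < det (e.2 - c) (e.1 - e.2) * det (e.2 - c) u ∧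
            st M L c (c + t • u) = decide (0 < crs e c) ∨
          det (e.2 - c) (e.1 - e.2) * det (e.2 - c) u < 0 ∧
            st M L c (c + t • u) = tipState L e.2) →
          stHit M L c u + passed M L c d e e.2 u = 1 := by
        intro u hu h
        obtain ⟨t, ht⟩ := hfirst u hu
        have hiff : st M L c (c + t • u) = true ↔ ¬ 0 < det (e.2 - c) u := by
          rcases h t ht with h | ⟨h, h'⟩ | ⟨h, h'⟩
          · rw [h, st_snd hM he hTog, ← h, add_sub_cancel_left, det_smul_left, det_self]
            simp
          · rw [h1] at h
            rw [h', decide_eq_true_iff]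
            rcases mul_pos_iff.1 h with ⟨h3, h4⟩ | ⟨h3, h4⟩
            · exact iff_of_false (by linarith) (by simpa using h4)
            · exact iff_of_true (by linarith) (by simpa using h4.le)
          · rw [h1] at h
            rw [h', hTog.decide_eq]
            rcases mul_neg_iff.1 h with ⟨h3, h4⟩ | ⟨h3, h4⟩
            · exact iff_of_true (by simp; linarith) (by simpa using h4.le)
            · exact iff_of_false (by simp; linarith) (by simpa using h4)
        rw [ht.stHit, passed]
        by_cases h6 : 0 < det (e.2 - c) u
        · rw [if_neg fun h7 => hiff.1 h7 h6, if_pos ⟨hsee, hdd, h6⟩, zero_add]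
        · rw [if_pos (hiff.2 h6), if_neg fun h7 => h6 h7.2.2, add_zero]
      have hk0 := key u₀ hne0 fun t ht => Or.inl (by rw [ht.unique ht₀, hp])
      filter_upwards [ht₀.state_tip hM hW htip hp, hrest, hother, hev0] with u h2 h3 h4 h5
      have := key u h5 h2
      rw [← Finset.add_sum_erase M _ he, ← Finset.add_sum_erase M _ he, h3, h4]
      linarith
  · push Not at hT
    have hsum := sum_eventually_eq ht₀ hu₀ (Finset.Subset.refl M) (by
      intro s hs
      exact ⟨or_iff_not_imp_left.2 fun h => (hT s hs).1 (not_not.1 h),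
        or_iff_not_imp_left.2 fun h => (hT s hs).2 (not_not.1 h)⟩)
    have hst : ∀ᶠ u in 𝓝 u₀, ∀ t, FirstHit (WSet M L) c u t →
        st M L c (c + t • u) = st M L c (c + t₀ • u₀) := by
      by_cases hp : ∃ e ∈ M, c + t₀ • u₀ ∈ segment ℝ e.1 e.2
      · obtain ⟨e, he, hpe⟩ := hp
        have htip : ∀ v v', Tip M e v v' → c + t₀ • u₀ = v → ¬ Tog L c e v →
            st M L c v = decide (0 < crs e c) → ∀ᶠ u in 𝓝 u₀, ∀ t, FirstHit (WSet M L) c u t →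
            st M L c (c + t • u) = st M L c (c + t₀ • u₀) := by
          intro v v' hv hpv hnT hstv
          have hc0 : crs e c ≠ 0 := hv.crs_ne_of_reach hM hW (by rw [← hpv]; exact ht₀.reach)
          have htS : tipState L v = decide (0 < crs e c) := by
            by_contra h
            refine hnT ?_
            have h1 := onSide_of_ne hc0
            rw [Tog]
            convert h1 using 1
            revert h
            cases tipState L v <;> cases decide (0 < crs e c) <;> simp
          filter_upwards [ht₀.state_tip hM hW hv hpv] with u hu t ht
          rw [hpv, hstv]
          rcases hu t ht with h | ⟨-, h⟩ | ⟨-, h⟩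
          · rw [h, hstv]
          · exact h
          · rw [h, htS]
        by_cases hp1 : c + t₀ • u₀ = e.1
        · have hn := (hT e he).1 hp1
          exact htip e.1 e.2 ⟨he, Or.inl ⟨rfl, rfl⟩⟩ hp1 hn
            (st_of_body hM he (left_mem_segment _ _ _) fun _ => hn)
        by_cases hp2 : c + t₀ • u₀ = e.2
        · have hn := (hT e he).2 hp2
          exact htip e.2 e.1 ⟨he, Or.inr ⟨rfl, rfl⟩⟩ hp2 hn
            (st_of_body hM he (right_mem_segment _ _ _) fun _ => hn)
        exact ht₀.state_body hM hW he hpe hp1 hp2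
      · push Not at hp
        exact ht₀.state_wall hW hp
    filter_upwards [hsum, hst, hev0] with u h1 h2 h3
    obtain ⟨t, ht⟩ := hfirst u h3
    rw [h1, ht.stHit, ht₀.stHit, h2 t ht]

/-- The jumps on the left of `d` seen from `c` are balanced up to the states in directions `d`
and `-d`. -/
lemma half_balance (hM : Good M) (hW : Walls M L ∅) (hcW : c ∉ WSet M L)
    (hit : ∀ u : Pt, u ≠ 0 → ∃ t : ℝ, 0 < t ∧ c + t • u ∈ WSet M L) {d : Pt} (hd0 : d ≠ 0)
    (hd : ∀ e v v', Tip M e v v' → det d (v - c) ≠ 0) :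
    (#{e ∈ M | Sees M L c e e.1 ∧ 0 < det d (e.1 - c)} : ℤ) -
      #{e ∈ M | Sees M L c e e.2 ∧ 0 < det d (e.2 - c)} =
      stHit M L c (-d) - stHit M L c d := by
  set n : Pt := (-d.2, d.1) with hn
  have hdn : 0 < det d n := by
    have h1 : det d n = d.1 * d.1 + d.2 * d.2 := by simp [det, hn]
    rw [h1]
    by_contra! h2
    have h3 : d.1 = 0 := by nlinarith [mul_self_nonneg d.1, mul_self_nonneg d.2]
    have h4 : d.2 = 0 := by nlinarith [mul_self_nonneg d.1, mul_self_nonneg d.2]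
    exact hd0 (Prod.ext h3 h4)
  set f : ℝ → Pt := fun x => (-x) • d + (1 - x ^ 2) • n with hf
  have hfc : Continuous f := by fun_prop
  have hdf : ∀ x, det d (f x) = (1 - x ^ 2) * det d n := by
    intro x
    simp only [hf, det, Prod.fst_add, Prod.snd_add, Prod.smul_fst, Prod.smul_snd, smul_eq_mul]
    ring
  have hf1 : f 1 = -d := by simp [hf]
  have hf2 : f (-1) = d := by simp [hf]
  have hx : ∀ x ∈ Set.Icc (-1 : ℝ) 1, x = -1 ∨ x = 1 ∨ 0 < 1 - x ^ 2 := by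
    intro x hx
    rcases hx.1.eq_or_lt with h | h
    · exact Or.inl h.symm
    rcases hx.2.eq_or_lt with h' | h'
    · exact Or.inr (Or.inl h')
    · exact Or.inr (Or.inr (by nlinarith))
  have hfne : ∀ x ∈ Set.Icc (-1 : ℝ) 1, f x ≠ 0 := by
    intro x hxI h0
    rcases hx x hxI with rfl | rfl | h
    · exact hd0 (hf2.symm.trans h0)
    · exact hd0 (neg_eq_zero.1 (hf1.symm.trans h0))
    · have := hdf x
      rw [h0] at this
      have h2 := mul_pos h hdn
      rw [← this] at h2
      simp [det] at h2
  set g : Pt → ℤ := fun u =>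
    stHit M L c u + ∑ e ∈ M, (passed M L c d e e.2 u - passed M L c d e e.1 u) with hg
  have hcont : ContinuousOn (g ∘ f) (Set.Icc (-1) 1) := by
    intro x hxI
    refine ContinuousAt.continuousWithinAt ?_
    have h1 : ∀ᶠ u in 𝓝 (f x), g u = g (f x) := by
      refine balance_eventually_eq hM hW hcW hit (hfne x hxI) ?_ ?_
      · intro w hw hwf
        rw [det_swap, neg_eq_zero] at hwf
        obtain ⟨k, rfl⟩ := exists_smul_of_det_eq_zero (hfne x hxI) hwf
        refine ⟨k, ?_, rfl⟩
        rw [det_smul_right, hdf] at hw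
        have : 0 ≤ (1 - x ^ 2) * det d n := mul_nonneg (by nlinarith [hxI.1, hxI.2]) hdn.le
        by_contra! hk
        nlinarith
      · intro e v v' hv k hk hvk
        have h2 := hd e v v' hv
        rw [hvk, det_smul_right, hdf] at h2 ⊢
        rcases hx x hxI with rfl | rfl | h
        · simp at h2
        · simp at h2
        · exact mul_pos hk (mul_pos h hdn)
    exact continuousAt_const.congr ((hfc.continuousAt.eventually h1).mono fun y hy => hy.symm)
  have hconst := isPreconnected_Icc.constant hcont
    (show (-1 : ℝ) ∈ Set.Icc (-1 : ℝ) 1 by constructor <;> norm_num)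
    (show (1 : ℝ) ∈ Set.Icc (-1 : ℝ) 1 by constructor <;> norm_num)
  simp only [Function.comp_apply, hf1, hf2, hg] at hconst
  have hsum : ∀ v : Pt × Pt → Pt, ∑ e ∈ M, passed M L c d e (v e) d = 0 ∧
      ∑ e ∈ M, passed M L c d e (v e) (-d) =
        #{e ∈ M | Sees M L c e (v e) ∧ 0 < det d (v e - c)} := by
    intro v
    have hneg : ∀ w, det w (-d) = det d w := by
      intro w
      simp only [det, Prod.fst_neg, Prod.snd_neg]
      ring
    constructor
    · refine Finset.sum_eq_zero fun e _ => ?_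
      rw [passed, if_neg]
      rintro ⟨-, h1, h2⟩
      rw [det_swap] at h2
      linarith
    · rw [Finset.card_filter]
      push_cast
      refine Finset.sum_congr rfl fun e _ => ?_
      rw [passed, hneg]
      exact if_congr (by tauto) rfl rfl
  rw [Finset.sum_sub_distrib, Finset.sum_sub_distrib, (hsum fun e => e.1).1, (hsum fun e => e.2).1,
    (hsum fun e => e.1).2, (hsum fun e => e.2).2] at hconst
  linarith

lemma abs_half_balance_le (hM : Good M) (hW : Walls M L ∅) (hcW : c ∉ WSet M L)
    (hit : ∀ u : Pt, u ≠ 0 → ∃ t : ℝ, 0 < t ∧ c + t • u ∈ WSet M L) {d : Pt} (hd0 : d ≠ 0)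
    (hd : ∀ e v v', Tip M e v v' → det d (v - c) ≠ 0) :
    |(#{e ∈ M | Sees M L c e e.1 ∧ 0 < det d (e.1 - c)} : ℤ) -
      #{e ∈ M | Sees M L c e e.2 ∧ 0 < det d (e.2 - c)}| ≤ 1 := by
  rw [half_balance hM hW hcW hit hd0 hd]
  unfold stHit
  split_ifs <;> simp

/-- As many first endpoints as second endpoints are jumps seen from `c`. -/
lemma class_balance (hM : Good M) (hW : Walls M L ∅) (hcW : c ∉ WSet M L)
    (hit : ∀ u : Pt, u ≠ 0 → ∃ t : ℝ, 0 < t ∧ c + t • u ∈ WSet M L) :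
    #{e ∈ M | Sees M L c e e.1} = #{e ∈ M | Sees M L c e e.2} := by
  obtain ⟨s, hs⟩ := Infinite.exists_notMem_finset
    (M.image (fun e => (e.1 - c).2 / (e.1 - c).1) ∪ M.image (fun e => (e.2 - c).2 / (e.2 - c).1))
  have hgen : ∀ w : Pt, w ≠ 0 → w.2 / w.1 ≠ s → det (1, s) w ≠ 0 := by
    intro w hw hws h0
    simp only [det, one_mul] at h0
    by_cases h1 : w.1 = 0
    · rw [h1, mul_zero, sub_zero] at h0
      exact hw (Prod.ext h1 h0)
    · exact hws (by rw [div_eq_iff h1]; linarith)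
  have hd : ∀ e v v', Tip M e v v' → det (1, s) (v - c) ≠ 0 := by
    intro e v v' hv
    refine hgen _ (sub_ne_zero.2 fun h => hcW (h ▸ hv.mem_wset)) fun h => hs ?_
    rw [Finset.mem_union, Finset.mem_image, Finset.mem_image]
    rcases hv.2 with ⟨rfl, -⟩ | ⟨rfl, -⟩
    · exact Or.inl ⟨e, hv.1, h⟩
    · exact Or.inr ⟨e, hv.1, h⟩
  have hd0 : ((1, s) : Pt) ≠ 0 := fun h => one_ne_zero (congrArg Prod.fst h)
  have hneg : ∀ d w : Pt, det (-d) w = -det d w := by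
    intro d w
    simp only [det, Prod.fst_neg, Prod.snd_neg]
    ring
  have h1 := half_balance hM hW hcW hit hd0 hd
  have h2 := half_balance hM hW hcW hit (neg_ne_zero.2 hd0)
    (fun e v v' hv => by rw [hneg]; exact neg_ne_zero.2 (hd e v v' hv))
  rw [neg_neg] at h2
  have hsplit : ∀ v : Pt × Pt → Pt, (∀ e ∈ M, det (1, s) (v e - c) ≠ 0) →
      #{e ∈ M | Sees M L c e (v e)} =
      #{e ∈ M | Sees M L c e (v e) ∧ 0 < det (1, s) (v e - c)} +
      #{e ∈ M | Sees M L c e (v e) ∧ 0 < det (-(1, s)) (v e - c)} := by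
    intro v hv
    rw [← Finset.card_filter_add_card_filter_not (fun e => 0 < det (1, s) (v e - c)),
      Finset.filter_filter, Finset.filter_filter]
    congr 2
    refine Finset.filter_congr fun e he => and_congr_right fun _ => ?_
    rw [hneg, neg_pos, not_lt]
    exact ⟨fun h => lt_of_le_of_ne h (hv e he), le_of_lt⟩
  have h3 := hsplit (fun e => e.1) fun e he => hd e _ _ ⟨he, Or.inl ⟨rfl, rfl⟩⟩
  have h4 := hsplit (fun e => e.2) fun e he => hd e _ _ ⟨he, Or.inr ⟨rfl, rfl⟩⟩
  zify at h3 h4 ⊢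
  rw [h3, h4]
  linarith

end

section

variable {M : Finset (Pt × Pt)} {L : Set (Set Pt × Bool)} {c c' : Pt}

lemma Walls.thru' {L : Set (Set Pt × Bool)} (hW : Walls M L ∅) :
    ∀ p ∈ WSet M L, Thru (WSet M L) p := fun p hp => hW.thru p hp (Set.notMem_empty p)

lemma convex_onSide (σ : Bool) (e : Pt × Pt) : Convex ℝ {q | OnSide σ e q} := by
  have h : ∀ x y : Pt, ∀ a b : ℝ, a + b = 1 → crs e (a • x + b • y) = a * crs e x + b * crs e y := by
    intro x y a b hab
    obtain rfl : a = 1 - b := by linarith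
    rw [← crs_line]
    congr 1
    module
  intro x hx y hy a b ha hb hab
  have := h x y a b hab
  cases σ
  · simp only [Set.mem_ofPred_eq, OnSide] at hx hy ⊢
    rw [this]
    rcases ha.eq_or_lt with rfl | ha
    · obtain rfl : b = 1 := by linarith
      linarith
    · nlinarith
  · simp only [Set.mem_ofPred_eq, OnSide] at hx hy ⊢
    rw [this]
    rcases ha.eq_or_lt with rfl | ha
    · obtain rfl : b = 1 := by linarith
      linarith
    · nlinarith

/-- Points near an endpoint on one side of its edge are not on walls. -/
lemma Tip.exists_ball (hM : Good M) (hW : Walls M L ∅) {e : Pt × Pt} {v v' : Pt}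
    (h : Tip M e v v') {D : Set Pt} (hD : IsOpen D) (hv : v ∈ D) :
    ∃ ε > 0, ∀ q ∈ Metric.ball v ε, q ∈ D ∧ (q ∈ WSet M L → crs e q = 0) := by
  obtain ⟨ε, hε, hball⟩ := Metric.eventually_nhds_iff_ball.1
    ((h.near hM hW).and (hD.mem_nhds hv))
  exact ⟨ε, hε, fun q hq => ⟨(hball q hq).2, (hball q hq).1⟩⟩

lemma exists_small (v w : Pt) {ε : ℝ} (hε : 0 < ε) :
    ∃ δ > 0, δ < 1 ∧ ∀ s : ℝ, 0 ≤ s → s ≤ δ → v + s • w ∈ Metric.ball v ε := by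
  have hcont : ContinuousAt (fun s : ℝ => v + s • w) 0 := by fun_prop
  have h0 : ∀ᶠ q in 𝓝 (v + (0 : ℝ) • w), q ∈ Metric.ball v ε := by
    rw [zero_smul, add_zero]
    exact Metric.ball_mem_nhds v hε
  obtain ⟨δ, hδ, h⟩ := Metric.eventually_nhds_iff.1 (hcont.eventually h0)
  refine ⟨min (δ / 2) (1 / 2), by positivity, (min_le_right _ _).trans_lt (by norm_num),
    fun s hs0 hs => h ?_⟩
  rw [Real.dist_eq, sub_zero, abs_of_nonneg hs0]
  linarith [hs.trans (min_le_left _ _)]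

lemma Tip.exists_sees (hM : Good M) (hW : Walls M L ∅) {e : Pt × Pt} {v v' : Pt}
    (h : Tip M e v v') {D : Set Pt} (hD : IsOpen D) (hv : v ∈ D) :
    ∃ c ∈ D, Sees M L c e v := by
  obtain ⟨ε, hε, hball⟩ := h.exists_ball hM hW hD hv
  have hw : ∃ w : Pt, ∀ s : ℝ, 0 < s → OnSide (!tipState L v) e (v + s • w) := by
    have h0 : 0 < (e.2 - e.1).1 * (e.2 - e.1).1 + (e.2 - e.1).2 * (e.2 - e.1).2 := by
      by_contra! h2
      have h3 : (e.2 - e.1).1 = 0 := by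
        nlinarith [mul_self_nonneg (e.2 - e.1).1, mul_self_nonneg (e.2 - e.1).2]
      have h4 : (e.2 - e.1).2 = 0 := by
        nlinarith [mul_self_nonneg (e.2 - e.1).1, mul_self_nonneg (e.2 - e.1).2]
      exact hM.ne e h.1 (sub_eq_zero.1 (Prod.ext h3 h4)).symm
    cases !tipState L v
    · refine ⟨((e.2 - e.1).2, -(e.2 - e.1).1), fun s hs => ?_⟩
      rw [OnSide, crs_add_smul, h.crs_eq_zero, det]
      simp only
      nlinarith [mul_pos hs h0]
    · refine ⟨(-(e.2 - e.1).2, (e.2 - e.1).1), fun s hs => ?_⟩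
      rw [OnSide, crs_add_smul, h.crs_eq_zero, det]
      simp only
      nlinarith [mul_pos hs h0]
  obtain ⟨w, hw⟩ := hw
  obtain ⟨δ, hδ, -, hsmall⟩ := exists_small v w hε
  refine ⟨v + δ • w, (hball _ (hsmall δ hδ.le le_rfl)).1, fun t ht0 ht1 hmem => ?_, hw δ hδ⟩
  have heq : v + δ • w + t • (v - (v + δ • w)) = v + ((1 - t) * δ) • w := by module
  rw [heq] at hmem
  have hpos : 0 < (1 - t) * δ := mul_pos (by linarith) hδ
  exact (hw _ hpos).ne_zero ((hball _ (hsmall _ hpos.le (by nlinarith))).2 hmem)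

lemma Sees.of_vis (hM : Good M) (hW : Walls M L ∅) {e : Pt × Pt} {v v' : Pt}
    (hv : Tip M e v v') (h : Vis (WSet M L) c c') (hs : Sees M L c' e v) : Sees M L c e v := by
  have hr := h.trans_reach hW.isClosed hW.thru' hs.1
  refine ⟨hr, ?_⟩
  have h1 := hv.crs_ne_of_reach hM hW hr
  have h2 := OnSide.ne_zero hs.2
  have hS := OnSide.eq_decide hs.2
  rw [Tog, hS]
  convert onSide_of_ne h1 using 2
  by_contra hne
  have hprod : crs e c' * crs e c < 0 := by
    rcases h1.lt_or_gt with h1 | h1 <;> rcases h2.lt_or_gt with h2 | h2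
    · exact absurd (by rw [propext (iff_of_false h2.not_gt h1.not_gt)]) hne
    · exact mul_neg_of_pos_of_neg h2 h1
    · exact mul_neg_of_neg_of_pos h2 h1
    · exact absurd (by rw [propext (iff_of_true h2 h1)]) hne
  have hsub : crs e c' - crs e c ≠ 0 := by
    intro h0
    rw [sub_eq_zero.1 h0] at hprod
    exact absurd hprod (mul_self_nonneg _).not_gt
  set t := crs e c' / (crs e c' - crs e c) with ht
  have ht0 : 0 ≤ t ∧ t < 1 := by
    rcases hsub.lt_or_gt with h3 | h3
    · have : crs e c' < 0 ∧ 0 < crs e c := by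
        rcases mul_neg_iff.1 hprod with h4 | h4
        · linarith
        · exact h4
      rw [ht, le_div_iff_of_neg h3, div_lt_iff_of_neg h3]
      constructor <;> linarith
    · have : 0 < crs e c' ∧ crs e c < 0 := by
        rcases mul_neg_iff.1 hprod with h4 | h4
        · exact h4
        · linarith
      rw [ht, le_div_iff₀ h3, div_lt_iff₀ h3]
      constructor <;> linarith
  have hy := (h.symm.1.vis ht0.1 ht0.2).symm.trans_reach hW.isClosed hW.thru' hs.1
  refine hv.crs_ne_of_reach hM hW hy ?_
  rw [crs_line, ht]
  field_simp
  ring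

lemma Sees.vis (hM : Good M) (hW : Walls M L ∅) {e : Pt × Pt} {v v' : Pt}
    (hv : Tip M e v v') (h : Sees M L c e v) (h' : Sees M L c' e v) : Vis (WSet M L) c c' := by
  obtain ⟨ε, hε, hball⟩ := hv.exists_ball hM hW isOpen_univ (Set.mem_univ v)
  have key : ∀ x, Sees M L x e v → ∃ y ∈ Metric.ball v ε ∩ {q | OnSide (!tipState L v) e q},
      Vis (WSet M L) x y := by
    intro x hx
    obtain ⟨δ, hδ, hδ1, hsmall⟩ := exists_small v (x - v) hε
    refine ⟨v + δ • (x - v), ⟨hsmall δ hδ.le le_rfl, hx.2.line hv.crs_eq_zero hδ⟩, ?_⟩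
    have := hx.1.vis (t := 1 - δ) (by linarith) (by linarith)
    convert this using 1
    module
  obtain ⟨y, hy, hvis⟩ := key c h
  obtain ⟨y', hy', hvis'⟩ := key c' h'
  have hyy : Vis (WSet M L) y y' :=
    Vis.of_convex ((convex_ball v ε).inter (convex_onSide _ e))
      (fun p hp hpW => OnSide.ne_zero hp.2 ((hball p hp.1).2 hpW)) hy hy'
  exact (hvis.trans hW.isClosed hW.thru' hyy).trans hW.isClosed hW.thru' hvis'.symm

/-- The chord between two jumps of different edges seen from `c` is seen from `c`. -/
lemma Sees.chord (hM : Good M) (hW : Walls M L ∅) {e s : Pt × Pt} {v v' w w' : Pt}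
    (hv : Tip M e v v') (hw : Tip M s w w') (hes : s ≠ e) (h : Sees M L c e v)
    (h' : Sees M L c s w) {t : ℝ} (ht0 : 0 < t) (ht1 : t < 1) :
    Vis (WSet M L) c (v + t • (w - v)) := by
  refine ⟨fun r hr0 hr1 => ?_, ?_⟩
  · have := triangle_free hW.isClosed hW.thru' h.1 h'.1 (s := r * (1 - t)) (t := r * t)
      (mul_nonneg hr0 (by linarith)) (mul_nonneg hr0 ht0.le) (by nlinarith)
    convert this using 2
    module
  · rcases open_segment_free_or_subset hW.isClosed hW.thru' h.1 h'.1 with hf | hf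
    · exact hf t ht0 ht1
    exfalso
    obtain ⟨ε, hε, hball⟩ := hv.exists_ball hM hW isOpen_univ (Set.mem_univ v)
    obtain ⟨δ, hδ, hδ1, hsmall⟩ := exists_small v (w - v) hε
    have h1 := (hball _ (hsmall δ hδ.le le_rfl)).2 (hf δ hδ hδ1)
    rw [crs_line, hv.crs_eq_zero, mul_zero, zero_add] at h1
    exact hM.gp s w w' hw e hv.1 hes.symm ((mul_eq_zero.1 h1).resolve_left hδ.ne')

end

/-- A permutation compatible with colour classes which cannot be improved by a swap. -/
lemma exists_min_perm {E γ : Type*} [Fintype E] {f g : E → γ} (π₀ : Equiv.Perm E)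
    (h₀ : ∀ e, g (π₀ e) = f e) (sep : E → E → ℕ) (len : E → E → ℝ) :
    ∃ π : Equiv.Perm E, (∀ e, g (π e) = f e) ∧ ∀ e s, e ≠ s → f e = f s →
      sep e (π e) + sep s (π s) ≤ sep e (π s) + sep s (π e) ∧
      (sep e (π s) + sep s (π e) ≤ sep e (π e) + sep s (π s) →
        len e (π e) + len s (π s) ≤ len e (π s) + len s (π e)) := by
  obtain ⟨π, hπ, hmin⟩ := Finset.exists_min_image
    (univ.filter fun π : Equiv.Perm E => ∀ e, g (π e) = f e)
    (fun π => toLex (∑ e, sep e (π e), ∑ e, len e (π e))) ⟨π₀, by simpa using h₀⟩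
  have hπ' := (Finset.mem_filter.1 hπ).2
  refine ⟨π, hπ', fun e s hes hfes => ?_⟩
  set π' : Equiv.Perm E := (Equiv.swap e s).trans π with hdef
  have he : π' e = π s := by simp [hdef]
  have hs : π' s = π e := by simp [hdef]
  have hx : ∀ x, x ≠ e → x ≠ s → π' x = π x := fun x h1 h2 => by
    simp [hdef, Equiv.swap_apply_of_ne_of_ne h1 h2]
  have hmem : π' ∈ univ.filter fun π : Equiv.Perm E => ∀ e, g (π e) = f e := by
    refine Finset.mem_filter.2 ⟨Finset.mem_univ _, fun x => ?_⟩
    by_cases h1 : x = e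
    · rw [h1, he, hπ', hfes]
    by_cases h2 : x = s
    · rw [h2, hs, hπ', hfes]
    rw [hx x h1 h2, hπ']
  have hsplit : ∀ {A : Type} [AddCommMonoid A] (φ : E → E → A) (ρ : Equiv.Perm E),
      ∑ x, φ x (ρ x) = φ e (ρ e) + φ s (ρ s) + ∑ x ∈ (univ.erase e).erase s, φ x (ρ x) := by
    intro A _ φ ρ
    rw [add_assoc, Finset.add_sum_erase _ (fun x => φ x (ρ x)) (by simpa using hes.symm),
      Finset.add_sum_erase _ (fun x => φ x (ρ x)) (Finset.mem_univ e)]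
  have hrest : ∀ {A : Type} [AddCommMonoid A] (φ : E → E → A),
      ∑ x ∈ (univ.erase e).erase s, φ x (π' x) = ∑ x ∈ (univ.erase e).erase s, φ x (π x) := by
    intro A _ φ
    refine Finset.sum_congr rfl fun x hxm => ?_
    rw [hx x (Finset.ne_of_mem_erase (Finset.mem_of_mem_erase hxm)) (Finset.ne_of_mem_erase hxm)]
  have hle := hmin π' hmem
  rw [Prod.Lex.toLex_le_toLex] at hle
  simp only at hle
  rw [hsplit sep π, hsplit sep π', hsplit len π, hsplit len π', hrest sep, hrest len, he, hs] at hle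
  constructor
  · rcases hle with h | ⟨h, -⟩ <;> omega
  · intro h
    rcases hle with h' | ⟨-, h'⟩
    · omega
    · linarith

/-- The Euclidean length of a segment. -/
noncomputable def len (p q : Pt) : ℝ := dist (⟨p.1, p.2⟩ : ℂ) ⟨q.1, q.2⟩

lemma len_add_len_iff {p z q : Pt} :
    len p z + len z q = len p q ↔ ∃ t : ℝ, 0 ≤ t ∧ t ≤ 1 ∧ z = p + t • (q - p) := by
  rw [len, len, len, dist_add_dist_eq_iff]
  constructor
  · rintro ⟨t, ht, h⟩
    refine ⟨t, ht.1, ht.2, ?_⟩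
    rw [AffineMap.lineMap_apply_module'] at h
    have h1 := congrArg Complex.re h
    have h2 := congrArg Complex.im h
    simp at h1 h2
    ext <;> simp <;> linarith
  · rintro ⟨t, ht0, ht1, h⟩
    refine ⟨t, ⟨ht0, ht1⟩, ?_⟩
    rw [AffineMap.lineMap_apply_module', h]
    apply Complex.ext <;> simp <;> ring

lemma len_swap_lt {b r b' r' z : Pt} (hz : z ∈ segment ℝ b r) (hz' : z ∈ segment ℝ b' r')
    (hb : z ≠ b) (hd : det (r - b) (r' - b) ≠ 0) :
    len b r' + len b' r < len b r + len b' r' := by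
  have h1 := mem_segment_iff'.1 hz
  have h2 := len_add_len_iff.2 h1
  have h3 := len_add_len_iff.2 (mem_segment_iff'.1 hz')
  have h4 : len b' r ≤ len b' z + len z r := dist_triangle _ _ _
  have h5 : len b r' ≤ len b z + len z r' := dist_triangle _ _ _
  by_contra! h6
  obtain ⟨t, -, -, ht⟩ := len_add_len_iff.1 (show len b z + len z r' = len b r' by linarith)
  obtain ⟨s, -, -, hs⟩ := h1
  have hs0 : s ≠ 0 := by
    rintro rfl
    exact hb (by simpa using hs)
  have ht0 : t ≠ 0 := by
    rintro rfl
    exact hb (by simpa using ht)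
  have h7 : s * t * det (r - b) (r' - b) = 0 := by
    rw [mul_assoc, ← det_smul_right, ← det_smul_left]
    have : s • (r - b) = t • (r' - b) := add_left_cancel (hs.symm.trans ht)
    rw [this, det_self]
  exact mul_ne_zero (mul_ne_zero hs0 ht0) hd h7

/-- The points of `D` seeing `v` on the side where the state jumps. -/
def K (M : Finset (Pt × Pt)) (L : Set (Set Pt × Bool)) (D : Set Pt) (e : Pt × Pt) (v : Pt) :
    Set Pt := {x | x ∈ D ∧ Sees M L x e v}

section

variable {M : Finset (Pt × Pt)} {L : Set (Set Pt × Bool)} {D : Set Pt} {c c' : Pt}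

lemma K_eq (hM : Good M) (hW : Walls M L ∅) {e s : Pt × Pt} {v v' w w' : Pt}
    (hv : Tip M e v v') (hw : Tip M s w w') (h : Sees M L c e v) (h' : Sees M L c s w) :
    K M L D e v = K M L D s w := by
  ext x
  refine and_congr_right fun _ => ⟨fun hx => ?_, fun hx => ?_⟩
  · exact h'.of_vis hM hW hw (hx.vis hM hW hv h)
  · exact h.of_vis hM hW hv (hx.vis hM hW hw h')

lemma tip_fst {e : Pt × Pt} (he : e ∈ M) : Tip M e e.1 e.2 := ⟨he, Or.inl ⟨rfl, rfl⟩⟩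

lemma tip_snd {e : Pt × Pt} (he : e ∈ M) : Tip M e e.2 e.1 := ⟨he, Or.inr ⟨rfl, rfl⟩⟩

lemma K_eq_iff (hM : Good M) (hW : Walls M L ∅) {e s : Pt × Pt} {v v' w w' : Pt}
    (hv : Tip M e v v') (hw : Tip M s w w') (hc : c ∈ K M L D e v) :
    K M L D s w = K M L D e v ↔ Sees M L c s w :=
  ⟨fun h => (h ▸ hc : c ∈ K M L D s w).2, fun h => K_eq hM hW hw hv h hc.2⟩

lemma card_subtype_filter (p : Pt × Pt → Prop) : #{x : {e // e ∈ M} | p x.1} = #{e ∈ M | p e} := by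
  rw [← Finset.card_map (Function.Embedding.subtype _)]
  congr 1
  ext x
  simp
  tauto

lemma exists_class_perm (hM : Good M) (hW : Walls M L ∅)
    (hit : ∀ c ∈ D, ∀ u : Pt, u ≠ 0 → ∃ t : ℝ, 0 < t ∧ c + t • u ∈ WSet M L)
    (hD : IsOpen D) (hDt : ∀ e v v', Tip M e v v' → v ∈ D) :
    ∃ π : Equiv.Perm {e // e ∈ M}, ∀ e,
      K M L D (π e).1 (π e).1.2 = K M L D e.1 e.1.1 := by
  set f : {e // e ∈ M} → Set Pt := fun e => K M L D e.1 e.1.1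
  set g : {e // e ∈ M} → Set Pt := fun e => K M L D e.1 e.1.2
  have hcard : ∀ k, Fintype.card {e // f e = k} = Fintype.card {e // g e = k} := by
    intro k
    have hcount : ∀ c s v v', Tip M s v v' → c ∈ K M L D s v → K M L D s v = k →
        Fintype.card {e // f e = k} = Fintype.card {e // g e = k} := by
      rintro c s v v' hv hc rfl
      have h := class_balance hM hW hc.2.1.not_mem (hit c hc.1)
      rw [Fintype.card_subtype, Fintype.card_subtype]
      have h1 : ∀ x : {e // e ∈ M}, f x = K M L D s v ↔ Sees M L c x.1 x.1.1 := fun x =>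
        K_eq_iff hM hW hv (tip_fst x.2) hc
      have h2 : ∀ x : {e // e ∈ M}, g x = K M L D s v ↔ Sees M L c x.1 x.1.2 := fun x =>
        K_eq_iff hM hW hv (tip_snd x.2) hc
      simp only [h1, h2]
      rw [card_subtype_filter fun e => Sees M L c e e.1,
        card_subtype_filter fun e => Sees M L c e e.2, h]
    by_cases hf : ∃ e, f e = k
    · obtain ⟨e, rfl⟩ := hf
      obtain ⟨c, hcD, hc⟩ := (tip_fst e.2).exists_sees hM hW hD (hDt _ _ _ (tip_fst e.2))
      exact hcount c _ _ _ (tip_fst e.2) ⟨hcD, hc⟩ rfl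
    by_cases hg : ∃ e, g e = k
    · obtain ⟨e, rfl⟩ := hg
      obtain ⟨c, hcD, hc⟩ := (tip_snd e.2).exists_sees hM hW hD (hDt _ _ _ (tip_snd e.2))
      exact hcount c _ _ _ (tip_snd e.2) ⟨hcD, hc⟩ rfl
    · push Not at hf hg
      have : IsEmpty {e // f e = k} := ⟨fun e => hf e.1 e.2⟩
      have : IsEmpty {e // g e = k} := ⟨fun e => hg e.1 e.2⟩
      rw [Fintype.card_eq_zero, Fintype.card_eq_zero]
  exact ⟨Equiv.ofFiberEquiv fun k => Fintype.equivOfCardEq (hcard k),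
    fun e => Equiv.ofFiberEquiv_map (f := f) (g := g) (fun k => Fintype.equivOfCardEq (hcard k)) e⟩

/-- The number of sign changes does not increase when uncrossing. -/
lemma sep_swap_le {F : Pt → ℝ} (hF : ∀ x y t, F (x + t • (y - x)) = (1 - t) * F x + t * F y)
    {b r b' r' z : Pt} (hz : z ∈ segment ℝ b r) (hz' : z ∈ segment ℝ b' r')
    (hb : F b ≠ 0) (hr : F r ≠ 0) (hb' : F b' ≠ 0) (hr' : F r' ≠ 0) :
    (if 0 < F b ↔ 0 < F r' then 0 else 1) + (if 0 < F b' ↔ 0 < F r then 0 else 1) ≤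
      (if 0 < F b ↔ 0 < F r then 0 else 1) + (if 0 < F b' ↔ 0 < F r' then 0 else 1) := by
  obtain ⟨t, ht0, ht1, h1⟩ := mem_segment_iff'.1 hz
  obtain ⟨s, hs0, hs1, h2⟩ := mem_segment_iff'.1 hz'
  have h3 := hF b r t
  rw [← h1] at h3
  have h4 := hF b' r' s
  rw [← h2, h3] at h4
  have key : ∀ x y x' y' t s : ℝ, 0 ≤ t → t ≤ 1 → 0 ≤ s → s ≤ 1 → 0 < x → 0 < y → x' < 0 → y' < 0 →
      (1 - t) * x + t * y ≠ (1 - s) * x' + s * y' := by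
    intro x y x' y' t s ht0 ht1 hs0 hs1 hx hy hx' hy' h
    have h5 : 0 < (1 - t) * x + t * y := by
      rcases ht0.eq_or_lt with rfl | ht0
      · linarith
      · nlinarith [mul_pos ht0 hy, mul_nonneg (sub_nonneg.2 ht1) hx.le]
    nlinarith [mul_nonneg hs0 (neg_nonneg.2 hy'.le), mul_nonneg (sub_nonneg.2 hs1) (neg_nonneg.2 hx'.le)]
  by_cases h5 : 0 < F b <;> by_cases h6 : 0 < F r <;> by_cases h7 : 0 < F b' <;>
    by_cases h8 : 0 < F r' <;> simp only [h5, h6, h7, h8, iff_true, iff_false, if_true, if_false,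
      not_true_eq_false] <;> try norm_num
  · exact key _ _ _ _ _ _ ht0 ht1 hs0 hs1 h5 h6 (lt_of_le_of_ne (not_lt.1 h7) hb')
      (lt_of_le_of_ne (not_lt.1 h8) hr') h4
  · exact key _ _ _ _ _ _ hs0 hs1 ht0 ht1 h7 h8 (lt_of_le_of_ne (not_lt.1 h5) hb)
      (lt_of_le_of_ne (not_lt.1 h6) hr) h4.symm

end

lemma two_add_card_le {α : Type*} {s t : Finset α} {a b : α} (hab : a ≠ b) (has : a ∉ s)
    (hbs : b ∉ s) (hat : a ∈ t) (hbt : b ∈ t) (hst : s ⊆ t) : #s + 2 ≤ #t := by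
  have h := Finset.card_le_card (Finset.insert_subset hat (Finset.insert_subset hbt hst))
  rwa [Finset.card_insert_of_notMem (by simp [hab, has]), Finset.card_insert_of_notMem hbs] at h

section

variable {M : Finset (Pt × Pt)} {L : Set (Set Pt × Bool)} {D : Set Pt}

/-- If the gaps `G i`, `i ∈ I`, cover the free part of the line `F = 0`, then there is a
crossing-free matching of the endpoints, compatible with `M`, with at most `#I` edges crossing
this line. -/
theorem exists_perm_matching (hM : Good M) (hW : Walls M L ∅)
    (hit : ∀ c ∈ D, ∀ u : Pt, u ≠ 0 → ∃ t : ℝ, 0 < t ∧ c + t • u ∈ WSet M L)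
    (hD : IsOpen D) (hDc : Convex ℝ D) (hDt : ∀ e v v', Tip M e v v' → v ∈ D)
    {F : Pt → ℝ} {d : Pt} (hd0 : d ≠ 0) (hFd : ∀ p q, F q - F p = det d (q - p))
    (hFt : ∀ e v v', Tip M e v v' → F v ≠ 0)
    (hG : ∀ e ∈ M, ∀ s ∈ M, ∀ t ∈ M, s ≠ t → det (s.2 - e.1) (t.2 - e.1) ≠ 0)
    {ι : Type} {I : Finset ι} {G : ι → Set Pt} (hGc : ∀ i ∈ I, Convex ℝ (G i))
    (hGf : ∀ i ∈ I, ∀ p ∈ G i, p ∉ WSet M L)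
    (cover : ∀ p ∈ D, F p = 0 → p ∉ WSet M L → ∃ i ∈ I, p ∈ G i) :
    ∃ π : Equiv.Perm {e // e ∈ M},
      (∀ e, π e = e ∨ ∀ t : ℝ, 0 < t → t < 1 →
        e.1.1 + t • ((π e).1.2 - e.1.1) ∉ WSet M L) ∧
      (∀ e s, e ≠ s → ∀ z ∈ segment ℝ e.1.1 (π e).1.2, z ∉ segment ℝ s.1.1 (π s).1.2) ∧
      #{e | ¬ (0 < F e.1.1 ↔ 0 < F (π e).1.2)} ≤ #I := by
  have hF : ∀ x y t, F (x + t • (y - x)) = (1 - t) * F x + t * F y := by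
    intro x y t
    have h1 := hFd x (x + t • (y - x))
    have h2 := hFd x y
    rw [add_sub_cancel_left, det_smul_right, ← h2] at h1
    linarith
  obtain ⟨π₀, hπ₀⟩ := exists_class_perm hM hW hit hD hDt
  obtain ⟨π, hπ, hmin⟩ := exists_min_perm (f := fun e : {e // e ∈ M} => K M L D e.1 e.1.1)
    (g := fun e : {e // e ∈ M} => K M L D e.1 e.1.2) π₀ hπ₀
    (fun e s => if 0 < F e.1.1 ↔ 0 < F s.1.2 then 0 else 1) (fun e s => len e.1.1 s.1.2)
  have hne1 : ∀ e : {e // e ∈ M}, F e.1.1 ≠ 0 := fun e => hFt _ _ _ (tip_fst e.2)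
  have hne2 : ∀ e : {e // e ∈ M}, F e.1.2 ≠ 0 := fun e => hFt _ _ _ (tip_snd e.2)
  have hsees : ∀ e : {e // e ∈ M}, ∀ c ∈ K M L D e.1 e.1.1,
      Sees M L c e.1 e.1.1 ∧ Sees M L c (π e).1 (π e).1.2 := fun e c hc =>
    ⟨hc.2, (K_eq_iff hM hW (tip_fst e.2) (tip_snd (π e).2) hc).1 (hπ e)⟩
  have hex : ∀ e : {e // e ∈ M}, ∃ c, c ∈ K M L D e.1 e.1.1 := fun e => by
    obtain ⟨c, hcD, hc⟩ := (tip_fst e.2).exists_sees hM hW hD (hDt _ _ _ (tip_fst e.2))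
    exact ⟨c, hcD, hc⟩
  have hchord : ∀ e : {e // e ∈ M}, π e ≠ e → ∀ c ∈ K M L D e.1 e.1.1, ∀ t : ℝ, 0 < t → t < 1 →
      Vis (WSet M L) c (e.1.1 + t • ((π e).1.2 - e.1.1)) := fun e he c hc t ht0 ht1 =>
    (hsees e c hc).1.chord hM hW (tip_fst e.2) (tip_snd (π e).2)
      (fun h => he (Subtype.ext h)) (hsees e c hc).2 ht0 ht1
  have hends : ∀ e : {e // e ∈ M}, ∀ z ∈ segment ℝ e.1.1 (π e).1.2,
      z = e.1.1 ∨ z = (π e).1.2 ∨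
        ∃ t : ℝ, 0 < t ∧ t < 1 ∧ z = e.1.1 + t • ((π e).1.2 - e.1.1) := by
    intro e z hz
    obtain ⟨t, ht0, ht1, h⟩ := mem_segment_iff'.1 hz
    rcases ht0.eq_or_lt with rfl | ht0
    · exact Or.inl (by simpa using h)
    rcases ht1.eq_or_lt with rfl | ht1
    · exact Or.inr (Or.inl (by simpa using h))
    exact Or.inr (Or.inr ⟨t, ht0, ht1, h⟩)
  have hendW : ∀ e : {e // e ∈ M}, π e ≠ e → ∀ z ∈ segment ℝ e.1.1 (π e).1.2, z ∈ WSet M L →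
      z = e.1.1 ∨ z = (π e).1.2 := by
    intro e he z hz hzW
    rcases hends e z hz with h | h | ⟨t, ht0, ht1, rfl⟩
    · exact Or.inl h
    · exact Or.inr h
    · obtain ⟨c, hc⟩ := hex e
      exact absurd hzW (hchord e he c hc t ht0 ht1).2
  have heq1 : ∀ e s : {e // e ∈ M}, ∀ z ∈ segment ℝ e.1.1 e.1.2, z = s.1.1 ∨ z = s.1.2 → e = s :=
    fun e s z hz h => Subtype.ext (hM.eq_fst e.2 s.2 hz h)
  have hcls : ∀ e s : {e // e ∈ M}, ∀ c ∈ K M L D e.1 e.1.1, ∀ c' ∈ K M L D s.1 s.1.1,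
      Vis (WSet M L) c c' → K M L D e.1 e.1.1 = K M L D s.1 s.1.1 := fun e s c hc c' hc' h =>
    K_eq hM hW (tip_fst e.2) (tip_fst s.2) hc.2 (hc'.2.of_vis hM hW (tip_fst s.2) h)
  refine ⟨π, fun e => ?_, fun e s hes z hz hz' => ?_, ?_⟩
  · by_cases h : π e = e
    · exact Or.inl h
    · obtain ⟨c, hc⟩ := hex e
      exact Or.inr fun t ht0 ht1 => (hchord e h c hc t ht0 ht1).2
  · have hmixed : ∀ e s : {e // e ∈ M}, e ≠ s → π e = e → π s ≠ s →
        ∀ z ∈ segment ℝ e.1.1 (π e).1.2, z ∉ segment ℝ s.1.1 (π s).1.2 := by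
      intro e s hes he hs z hz hz'
      rw [he] at hz
      rcases hendW s hs z hz' (Or.inl ⟨e.1, e.2, hz⟩) with h | h
      · exact hes (heq1 e s z hz (Or.inl h))
      · have := heq1 e (π s) z hz (Or.inr h)
        exact hes (π.injective (he.trans this))
    by_cases he : π e = e <;> by_cases hs : π s = s
    · rw [he] at hz
      rw [hs] at hz'
      exact hes (Subtype.ext (hM.disj e.1 e.2 s.1 s.2 z hz hz'))
    · exact hmixed e s hes he hs z hz hz'
    · exact hmixed s e hes.symm hs he z hz' hz
    by_cases hzW : z ∈ WSet M L
    · rcases hendW e he z hz hzW with h | h <;> rcases hendW s hs z hz' hzW with h' | h'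
      · exact hes (heq1 e s z (by rw [h]; exact left_mem_segment _ _ _) (Or.inl h'))
      · have h1 := heq1 e (π s) z (by rw [h]; exact left_mem_segment _ _ _) (Or.inr h')
        rw [← h1] at h'
        exact hM.ne e.1 e.2 (h.symm.trans h')
      · have h1 := heq1 s (π e) z (by rw [h']; exact left_mem_segment _ _ _) (Or.inr h)
        rw [← h1] at h
        exact hM.ne s.1 s.2 (h'.symm.trans h)
      · exact hes (π.injective (heq1 (π e) (π s) z (by rw [h]; exact right_mem_segment _ _ _)
          (Or.inr h')))
    · have hmem : ∀ e : {e // e ∈ M}, z ∈ segment ℝ e.1.1 (π e).1.2 →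
          ∃ t : ℝ, 0 < t ∧ t < 1 ∧ z = e.1.1 + t • ((π e).1.2 - e.1.1) := by
        intro e hz
        rcases hends e z hz with rfl | rfl | h
        · exact absurd (tip_fst e.2).mem_wset hzW
        · exact absurd (tip_snd (π e).2).mem_wset hzW
        · exact h
      obtain ⟨c, hc⟩ := hex e
      obtain ⟨c', hc'⟩ := hex s
      have hcz : Vis (WSet M L) c z := by
        obtain ⟨t, ht0, ht1, rfl⟩ := hmem e hz
        exact hchord e he c hc t ht0 ht1
      have hcz' : Vis (WSet M L) c' z := by
        obtain ⟨t, ht0, ht1, h⟩ := hmem s hz'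
        rw [h]
        exact hchord s hs c' hc' t ht0 ht1
      obtain ⟨-, hlen⟩ := hmin e s hes
        (hcls e s c hc c' hc' (hcz.trans hW.isClosed hW.thru' hcz'.symm))
      have h1 := hlen (sep_swap_le hF hz hz' (hne1 e) (hne2 _) (hne1 s) (hne2 _))
      have h2 := len_swap_lt hz hz' (fun h => hzW (h ▸ (tip_fst e.2).mem_wset))
        (hG e.1 e.2 _ (π e).2 _ (π s).2 fun h => hes (π.injective (Subtype.ext h)))
      exact absurd h1 (by linarith)
  · have hgap : ∀ e : {e // e ∈ M}, ¬ (0 < F e.1.1 ↔ 0 < F (π e).1.2) →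
        ∃ i ∈ I, ∃ z ∈ G i, F z = 0 ∧ z ∈ K M L D e.1 e.1.1 := by
      intro e he
      obtain ⟨c, hc⟩ := hex e
      have hz : ∃ z ∈ D, F z = 0 ∧ Vis (WSet M L) c z := by
        rcases eq_or_ne (F c) 0 with h0 | h0
        · exact ⟨c, hc.1, h0, Vis.refl hc.2.1.not_mem⟩
        have hray : ∀ v, v ∈ D → Reach (WSet M L) c v → F v ≠ 0 → ¬ (0 < F c ↔ 0 < F v) →
            ∃ z ∈ D, F z = 0 ∧ Vis (WSet M L) c z := by
          intro v hvD hr hv hcv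
          have hpos : 0 < F c / (F c - F v) ∧ F c / (F c - F v) < 1 := by
            by_cases h1 : 0 < F c
            · have h2 : F v < 0 := lt_of_le_of_ne (not_lt.1 fun h => hcv (iff_of_true h1 h)) hv
              have h3 : 0 < F c - F v := by linarith
              rw [div_lt_one h3]
              exact ⟨div_pos h1 h3, by linarith⟩
            · have h1' : F c < 0 := lt_of_le_of_ne (not_lt.1 h1) h0
              have h2 : 0 < F v := not_le.1 fun h => hcv (iff_of_false h1 h.not_gt)
              have h3 : F c - F v < 0 := by linarith
              rw [div_lt_one_of_neg h3]
              exact ⟨div_pos_of_neg_of_neg h1' h3, by linarith⟩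
          refine ⟨_, hDc.add_smul_sub_mem hc.1 hvD ⟨hpos.1.le, hpos.2.le⟩, ?_,
            hr.vis hpos.1.le hpos.2⟩
          have h3 : F c - F v ≠ 0 := fun h => by rw [h, div_zero] at hpos; exact hpos.1.ne rfl
          rw [hF]
          field_simp
          ring
        by_cases h1 : 0 < F c ↔ 0 < F e.1.1
        · refine hray (π e).1.2 (hDt _ _ _ (tip_snd (π e).2)) (hsees e c hc).2.1 (hne2 _) ?_
          rwa [h1]
        · exact hray e.1.1 (hDt _ _ _ (tip_fst e.2)) (hsees e c hc).1.1 (hne1 _) h1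
      obtain ⟨z, hzD, hz0, hcz⟩ := hz
      obtain ⟨i, hi, hzi⟩ := cover z hzD hz0 hcz.2
      exact ⟨i, hi, z, hzi, hz0, hzD, hc.2.of_vis hM hW (tip_fst e.2) hcz.symm⟩
    refine Finset.card_le_card_of_forall_subsingleton
      (fun e i => ∃ z ∈ G i, F z = 0 ∧ z ∈ K M L D e.1 e.1.1)
      (fun e he => hgap e (Finset.mem_filter.1 he).2) fun i hi => ?_
    rintro e ⟨he, z, hzi, hz0, hze⟩ s ⟨hs, z', hzi', -, hzs⟩
    by_contra hes
    replace he := (Finset.mem_filter.1 he).2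
    replace hs := (Finset.mem_filter.1 hs).2
    have hKes := hcls e s z hze z' hzs (Vis.of_convex (hGc i hi) (hGf i hi) hzi hzi')
    have hFz : ∀ v, det d (v - z) = F v := fun v => by rw [← hFd, hz0, sub_zero]
    have hbal := abs_half_balance_le hM hW hze.2.1.not_mem (hit z hze.1) hd0
      (fun x v v' hv => by rw [hFz]; exact hFt x v v' hv)
    simp only [hFz] at hbal
    replace hbal : |(#{x ∈ M | Sees M L z x x.1 ∧ 0 < F x.1} : ℤ) -
        #{x ∈ M | Sees M L z x x.2 ∧ 0 < F x.2}| ≤ 1 := by convert hbal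
    have hcB : #{x : {e // e ∈ M} | Sees M L z x.1 x.1.1 ∧ 0 < F x.1.1} =
        #{x ∈ M | Sees M L z x x.1 ∧ 0 < F x.1} := by
      convert card_subtype_filter fun x => Sees M L z x x.1 ∧ 0 < F x.1
    have hcR : #{x : {e // e ∈ M} | Sees M L z x.1 x.1.2 ∧ 0 < F x.1.2} =
        #{x ∈ M | Sees M L z x x.2 ∧ 0 < F x.2} := by
      convert card_subtype_filter fun x => Sees M L z x x.2 ∧ 0 < F x.2
    rw [← Finset.card_map π.symm.toEmbedding] at hcR
    rw [← hcB, ← hcR] at hbal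
    have hB : univ.filter (fun x : {e // e ∈ M} => Sees M L z x.1 x.1.1 ∧ 0 < F x.1.1) =
        univ.filter fun x => K M L D x.1 x.1.1 = K M L D e.1 e.1.1 ∧ 0 < F x.1.1 :=
      Finset.filter_congr fun x _ =>
        and_congr_left fun _ => (K_eq_iff hM hW (tip_fst e.2) (tip_fst x.2) hze).symm
    have hR : (univ.filter (fun x : {e // e ∈ M} => Sees M L z x.1 x.1.2 ∧ 0 < F x.1.2)).map
          π.symm.toEmbedding =
        univ.filter fun x => K M L D x.1 x.1.1 = K M L D e.1 e.1.1 ∧ 0 < F (π x).1.2 := by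
      ext x
      simp only [Finset.mem_map_equiv, Equiv.symm_symm, Finset.mem_filter, Finset.mem_univ,
        true_and]
      rw [← K_eq_iff hM hW (tip_fst e.2) (tip_snd (π x).2) hze, hπ x]
    rw [hB, hR, abs_le] at hbal
    have hopp : ∀ x y : {e // e ∈ M}, K M L D x.1 x.1.1 = K M L D y.1 y.1.1 →
        0 < F x.1.1 → ¬ 0 < F (π x).1.2 → ¬ 0 < F y.1.1 → ¬ 0 < F (π y).1.2 := by
      intro x y hxy h1 h2 h3 h4
      have := (hmin x y (fun h => h3 (h ▸ h1)) hxy).1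
      simp [h1, h2, h3, h4] at this
    by_cases he1 : 0 < F e.1.1 <;> by_cases hs1 : 0 < F s.1.1
    · have he2 : ¬ 0 < F (π e).1.2 := fun h => he (iff_of_true he1 h)
      have hs2 : ¬ 0 < F (π s).1.2 := fun h => hs (iff_of_true hs1 h)
      have := two_add_card_le (s := univ.filter fun x : {e // e ∈ M} =>
          K M L D x.1 x.1.1 = K M L D e.1 e.1.1 ∧ 0 < F (π x).1.2)
        (t := univ.filter fun x : {e // e ∈ M} =>
          K M L D x.1 x.1.1 = K M L D e.1 e.1.1 ∧ 0 < F x.1.1) hes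
        (by simp [he2]) (by simp [hs2]) (by simp [he1]) (by simp [hs1, hKes])
        (fun x hx => by
          simp only [Finset.mem_filter, Finset.mem_univ, true_and] at hx ⊢
          exact ⟨hx.1, by_contra fun h => hopp e x hx.1.symm he1 he2 h hx.2⟩)
      omega
    · have he2 : ¬ 0 < F (π e).1.2 := fun h => he (iff_of_true he1 h)
      exact hs (iff_of_false hs1 (hopp e s hKes he1 he2 hs1))
    · have hs2 : ¬ 0 < F (π s).1.2 := fun h => hs (iff_of_true hs1 h)
      exact he (iff_of_false he1 (hopp s e hKes.symm hs1 hs2 he1))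
    · have he2 : 0 < F (π e).1.2 := by_contra fun h => he (iff_of_false he1 h)
      have hs2 : 0 < F (π s).1.2 := by_contra fun h => hs (iff_of_false hs1 h)
      have := two_add_card_le (s := univ.filter fun x : {e // e ∈ M} =>
          K M L D x.1 x.1.1 = K M L D e.1 e.1.1 ∧ 0 < F x.1.1)
        (t := univ.filter fun x : {e // e ∈ M} =>
          K M L D x.1 x.1.1 = K M L D e.1 e.1.1 ∧ 0 < F (π x).1.2) hes
        (by simp [he1]) (by simp [hs1]) (by simp [he2]) (by simp [hs2, hKes])
        (fun x hx => by
          simp only [Finset.mem_filter, Finset.mem_univ, true_and] at hx ⊢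
          exact ⟨hx.1, by_contra fun h => hopp x e hx.1 hx.2 h he1 he2⟩)
      omega

end

/-- The affine function `p ↦ a * p.1 + b * p.2 - c`. -/
def lin (a b c : ℝ) (p : Pt) : ℝ := a * p.1 + b * p.2 - c

lemma lin_line (a b c : ℝ) (x y : Pt) (t : ℝ) :
    lin a b c (x + t • (y - x)) = (1 - t) * lin a b c x + t * lin a b c y := by
  simp only [lin, Prod.fst_add, Prod.snd_add, Prod.smul_fst, Prod.smul_snd, smul_eq_mul,
    Prod.fst_sub, Prod.snd_sub]
  ring

lemma continuous_lin (a b c : ℝ) : Continuous (lin a b c) := by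
  unfold lin
  fun_prop

lemma convex_abs_lin_lt (a b c N : ℝ) : Convex ℝ {p | |lin a b c p| < N} := by
  intro p hp q hq s t hs ht hst
  have h := (convex_ball (0 : ℝ) N) (x := lin a b c p) (by simpa using hp) (y := lin a b c q)
    (by simpa using hq) hs ht hst
  have h' : s • lin a b c p + t • lin a b c q = lin a b c (s • p + t • q) := by
    simp only [lin, Prod.fst_add, Prod.snd_add, Prod.smul_fst, Prod.smul_snd, smul_eq_mul]
    linear_combination -c * hst
  rw [h'] at h
  simpa using h

/-- Every ray starting at a point with `|f| < N` along which `f` is not constant reaches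
`|f| = N`. -/
lemma exists_abs_lin_eq {a b c N : ℝ} {p u : Pt} (hp : |lin a b c p| < N)
    (hu : a * u.1 + b * u.2 ≠ 0) : ∃ t : ℝ, 0 < t ∧ |lin a b c (p + t • u)| = N := by
  have hN : 0 < N := (abs_nonneg _).trans_lt hp
  rw [abs_lt] at hp
  have hlin : ∀ t : ℝ, lin a b c (p + t • u) = lin a b c p + t * (a * u.1 + b * u.2) := fun t => by
    simp only [lin, Prod.fst_add, Prod.snd_add, Prod.smul_fst, Prod.smul_snd, smul_eq_mul]
    ring
  rcases lt_or_gt_of_ne hu with h | h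
  · refine ⟨(-N - lin a b c p) / (a * u.1 + b * u.2), div_pos_of_neg_of_neg (by linarith) h, ?_⟩
    rw [hlin, div_mul_cancel₀ _ hu, add_sub_cancel, abs_neg, abs_of_pos hN]
  · refine ⟨(N - lin a b c p) / (a * u.1 + b * u.2), div_pos (by linarith) h, ?_⟩
    rw [hlin, div_mul_cancel₀ _ hu, add_sub_cancel, abs_of_pos hN]

/-- The successor function of a finite set of reals. -/
lemma exists_succ (K : Finset ℝ) : ∃ s : ℝ → ℝ, ∀ l, (∃ k ∈ K, l < k) →
    s l ∈ K ∧ l < s l ∧ ∀ k ∈ K, l < k → s l ≤ k := by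
  have : ∀ l, ∃ r, (∃ k ∈ K, l < k) → r ∈ K ∧ l < r ∧ ∀ k ∈ K, l < k → r ≤ k := by
    intro l
    by_cases h : ∃ k ∈ K, l < k
    · obtain ⟨r, hr, hmin⟩ := Finset.exists_min_image {k ∈ K | l < k} id
        (h.imp fun k hk => Finset.mem_filter.2 hk)
      rw [Finset.mem_filter] at hr
      exact ⟨r, fun _ => ⟨hr.1, hr.2, fun k hk hlk => hmin k (Finset.mem_filter.2 ⟨hk, hlk⟩)⟩⟩
    · exact ⟨0, fun h' => absurd h' h⟩
  choose s hs using this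
  exact ⟨s, hs⟩

/-- A sign sequence with different signs at `p` and `q` changes its sign between `p` and `q`. -/
lemma exists_change {K : Finset ℝ} {s : ℝ → ℝ} (hs : ∀ l, (∃ k ∈ K, l < k) →
      s l ∈ K ∧ l < s l ∧ ∀ k ∈ K, l < k → s l ≤ k) {sg : ℝ → Bool} {p q : ℝ} (hp : p ∈ K)
    (hq : q ∈ K) (hpq : p < q) (h : sg p ≠ sg q) :
    ∃ l ∈ K, p ≤ l ∧ l < q ∧ sg l ≠ sg (s l) := by
  obtain ⟨l, hl, hmax⟩ := Finset.exists_max_image {k ∈ K | p ≤ k ∧ k < q ∧ sg k = sg p} id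
    ⟨p, by simp [hp, hpq]⟩
  simp only [Finset.mem_filter, id] at hl hmax
  obtain ⟨hlK, hpl, hlq, hsl⟩ := hl
  obtain ⟨h1, h2, h3⟩ := hs l ⟨q, hq, hlq⟩
  refine ⟨l, hlK, hpl, hlq, fun h' => ?_⟩
  rcases (h3 q hq hlq).lt_or_eq with h4 | h4
  · exact absurd (hmax (s l) ⟨h1, (hpl.trans_lt h2).le, h4, h'.symm.trans hsl⟩) h2.not_ge
  · exact h (by rw [← hsl, h', h4])

theorem Walls.close {M : Finset (Pt × Pt)} (hM : Good M) {L : Set (Set Pt × Bool)} {U : Set Pt}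
    (h : Walls M L U) {κ : Type} (x y : κ → Pt) (σ : κ → Bool) (S : Finset κ)
    (hne : ∀ k ∈ S, x k ≠ y k) (hx : ∀ k ∈ S, Att M L (x k) (y k) (σ k))
    (hy : ∀ k ∈ S, Att M L (y k) (x k) (σ k))
    (hfree : ∀ k ∈ S, ∀ p ∈ openSegment ℝ (x k) (y k), p ∉ WSet M L)
    (hdisj : ∀ k ∈ S, ∀ j ∈ S, k ≠ j →
      Disjoint (openSegment ℝ (x k) (y k)) (openSegment ℝ (x j) (y j))) :
    ∃ L', Walls M L' U ∧
      (∀ p, p ∈ WSet M L' ↔ p ∈ WSet M L ∨ ∃ k ∈ S, p ∈ openSegment ℝ (x k) (y k)) ∧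
      ∀ p q ρ, Att M L p q ρ → Att M L' p q ρ := by
  induction S using Finset.induction_on with
  | empty => exact ⟨L, h, by simp, fun p q ρ h => h⟩
  | @insert k S hk ih =>
    simp only [Finset.forall_mem_insert] at hne hx hy hfree
    obtain ⟨L', hW, hmem, hatt⟩ := ih hne.2 hx.2 hy.2 hfree.2 fun i hi j hj =>
      hdisj i (Finset.mem_insert_of_mem hi) j (Finset.mem_insert_of_mem hj)
    have hfree' : ∀ t : ℝ, 0 < t → t < 1 → x k + t • (y k - x k) ∉ WSet M L' := by
      intro t ht0 ht1 hW'
      have hmo : x k + t • (y k - x k) ∈ openSegment ℝ (x k) (y k) :=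
        mem_openSegment_iff'.2 ⟨t, ht0, ht1, rfl⟩
      rcases (hmem _).1 hW' with h' | ⟨j, hj, h'⟩
      · exact hfree.1 _ hmo h'
      · exact Set.disjoint_left.1 (hdisj k (Finset.mem_insert_self _ _) j
          (Finset.mem_insert_of_mem hj) (by rintro rfl; exact hk hj)) hmo h'
    have hxk := hatt _ _ _ hx.1
    have hyk := hatt _ _ _ hy.1
    have hW2 := hW.add hM hne.1 hfree' hyk (Or.inl hxk)
    rw [Set.sdiff_singleton_eq_self fun hU => by
      obtain ⟨e, v', ht⟩ := hW.tips _ hU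
      exact hxk.ntip _ _ _ ht rfl] at hW2
    refine ⟨_, hW2, fun p => ?_, fun p q ρ hp =>
      (hatt p q ρ hp).insert (U := U) hfree' hyk (Or.inl hxk)⟩
    rw [WSet.insert_mem, hmem, Finset.exists_mem_insert, ← insert_endpoints_openSegment]
    simp only [Set.mem_insert_iff]
    constructor
    · rintro ((rfl | rfl | h') | h' | h')
      exacts [Or.inl hx.1.mem, Or.inl hy.1.mem, Or.inr (Or.inl h'), Or.inl h', Or.inr (Or.inr h')]
    · rintro (h' | h' | h')
      exacts [Or.inr (Or.inl h'), Or.inl (Or.inr (Or.inr h')), Or.inr (Or.inr h')]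

/-- The point with coordinate `t` on the line `a * x + b * y = c`. -/
noncomputable def onLine (a b c t : ℝ) : Pt :=
  ((a * c + t * b) / (a ^ 2 + b ^ 2), (b * c - t * a) / (a ^ 2 + b ^ 2))

section

variable {a b c : ℝ} (hab : 0 < a ^ 2 + b ^ 2)
include hab

lemma lin_onLine (t : ℝ) : lin a b c (onLine a b c t) = 0 := by
  simp only [lin, onLine]
  field_simp
  ring

lemma lin_onLine' (t : ℝ) : lin b (-a) 0 (onLine a b c t) = t := by
  simp only [lin, onLine]
  field_simp
  ring

lemma onLine_lin {p : Pt} (h : lin a b c p = 0) : onLine a b c (lin b (-a) 0 p) = p := by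
  simp only [lin, onLine] at h ⊢
  obtain rfl : c = a * p.1 + b * p.2 := by linarith
  ext <;> simp only <;> rw [div_eq_iff hab.ne'] <;> ring

lemma crs_onLine (e : Pt × Pt) (s t : ℝ) :
    (crs e (onLine a b c t) - crs e (onLine a b c s)) * (a ^ 2 + b ^ 2) =
      (t - s) * (lin a b c e.1 - lin a b c e.2) := by
  simp only [crs, det, onLine, lin, Prod.fst_sub, Prod.snd_sub]
  field_simp
  ring

end

lemma onLine_add (a b c s r t : ℝ) :
    onLine a b c s + t • (onLine a b c r - onLine a b c s) = onLine a b c (s + t * (r - s)) := by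
  ext <;> simp only [onLine, Prod.fst_add, Prod.snd_add, Prod.smul_fst, Prod.smul_snd, smul_eq_mul,
    Prod.fst_sub, Prod.snd_sub] <;> ring

lemma mem_openSegment_onLine {a b c l r : ℝ} (hlr : l < r) {p : Pt} :
    p ∈ openSegment ℝ (onLine a b c l) (onLine a b c r) ↔
      ∃ t, l < t ∧ t < r ∧ p = onLine a b c t := by
  rw [mem_openSegment_iff']
  have h0 : 0 < r - l := sub_pos.2 hlr
  constructor
  · rintro ⟨t, ht0, ht1, rfl⟩
    exact ⟨_, by nlinarith, by nlinarith, onLine_add ..⟩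
  · rintro ⟨t, ht0, ht1, rfl⟩
    refine ⟨(t - l) / (r - l), div_pos (by linarith) h0, (div_lt_one h0).2 (by linarith), ?_⟩
    rw [onLine_add, div_mul_cancel₀ _ h0.ne', add_sub_cancel]

lemma Thru.of_add {W : Set Pt} {p d : Pt} (hd : d ≠ 0) (h : ∀ t : ℝ, p + t • d ∈ W) : Thru W p :=
  ⟨d, hd, 1, one_pos, fun t _ => h t⟩

lemma exists_lin_eq_zero_iff {a b c : ℝ} {x y : Pt} (hx : lin a b c x ≠ 0)
    (hy : lin a b c y ≠ 0) :
    (∃ p ∈ segment ℝ x y, lin a b c p = 0) ↔ ¬ (0 < lin a b c x ↔ 0 < lin a b c y) := by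
  constructor
  · rintro ⟨p, hp, h0⟩ h
    obtain ⟨r, hr0, hr1, rfl⟩ := mem_segment_iff'.1 hp
    rw [lin_line] at h0
    rcases hr1.eq_or_lt with rfl | hr1
    · exact hy (by linarith)
    replace hr1 := sub_pos.2 hr1
    rcases lt_or_gt_of_ne hx with h1 | h1
    · have h2 : lin a b c y ≤ 0 := not_lt.1 fun h' => (h.2 h').not_gt h1
      nlinarith [mul_neg_of_pos_of_neg hr1 h1]
    · nlinarith [mul_pos hr1 h1, h.1 h1]
  · intro h
    have hd : lin a b c x - lin a b c y ≠ 0 := fun h' => h (by rw [sub_eq_zero.1 h'])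
    refine ⟨x + (lin a b c x / (lin a b c x - lin a b c y)) • (y - x),
      mem_segment_iff'.2 ⟨_, ?_, ?_, rfl⟩, ?_⟩
    · rcases lt_or_gt_of_ne hx with h1 | h1
      · have : 0 < lin a b c y := not_le.1 fun h' => h (iff_of_false h1.not_gt h'.not_gt)
        exact (div_pos_of_neg_of_neg h1 (by linarith)).le
      · have : lin a b c y ≤ 0 := not_lt.1 fun h' => h (iff_of_true h1 h')
        exact (div_pos h1 (by linarith)).le
    · rcases lt_or_gt_of_ne hx with h1 | h1
      · have : 0 < lin a b c y := not_le.1 fun h' => h (iff_of_false h1.not_gt h'.not_gt)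
        rw [div_le_one_of_neg (by linarith)]
        linarith
      · have : lin a b c y ≤ 0 := not_lt.1 fun h' => h (iff_of_true h1 h')
        rw [div_le_one (by linarith)]
        linarith
    · rw [lin_line]
      field_simp
      ring

/-- The walls bounding a large square around all segments. -/
lemma walls_box {M : Finset (Pt × Pt)} (hM : Good M) {a b c N : ℝ} (hab : 0 < a ^ 2 + b ^ 2)
    (hb : ∀ e ∈ M, ∀ p ∈ segment ℝ e.1 e.2, |lin a b c p| < N ∧ |lin b (-a) 0 p| < N) (τ : Bool) :
    Walls M {({p | |lin a b c p| = N ∨ |lin b (-a) 0 p| = N}, τ)} {v | ∃ e v', Tip M e v v'} := by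
  have hout : ∀ e ∈ M, ∀ p ∈ segment ℝ e.1 e.2, ¬ (|lin a b c p| = N ∨ |lin b (-a) 0 p| = N) :=
    fun e he p hp h => h.elim (hb e he p hp).1.ne (hb e he p hp).2.ne
  refine ⟨Set.finite_singleton _, ?_, fun v hv => hv, ?_, ?_, ?_, ?_, ?_⟩
  · rintro A rfl
    exact (isClosed_eq (continuous_lin a b c).abs continuous_const).union
      (isClosed_eq (continuous_lin b (-a) 0).abs continuous_const)
  · rintro p (⟨e, he, hpe⟩ | ⟨A, rfl, hp⟩) hpU
    · obtain ⟨t, ht0, ht1, rfl⟩ := mem_segment_iff'.1 hpe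
      have h0 : 0 < t := ht0.lt_of_ne (by
        rintro rfl
        exact hpU ⟨e, e.2, he, Or.inl ⟨by simp, rfl⟩⟩)
      have h1 : t < 1 := ht1.lt_of_ne (by
        rintro rfl
        exact hpU ⟨e, e.1, he, Or.inr ⟨by simp, rfl⟩⟩)
      refine ⟨e.2 - e.1, sub_ne_zero.2 (hM.ne e he).symm, min t (1 - t),
        lt_min h0 (by linarith), fun s hs => Or.inl ⟨e, he, mem_segment_iff'.2
          ⟨t + s, ?_, ?_, by module⟩⟩⟩ <;>
      · rw [lt_min_iff, abs_lt, abs_lt] at hs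
        linarith
    · rcases hp with hp | hp
      · refine Thru.of_add (d := (b, -a)) ?_ fun t => Or.inr ⟨_, rfl, Or.inl ?_⟩
        · intro h
          simp only [Prod.mk_eq_zero, neg_eq_zero] at h
          simp [h.1, h.2] at hab
        · rw [← hp]
          congr 1
          simp only [lin, Prod.fst_add, Prod.snd_add, Prod.smul_fst, Prod.smul_snd, smul_eq_mul]
          ring
      · refine Thru.of_add (d := (a, b)) ?_ fun t => Or.inr ⟨_, rfl, Or.inr ?_⟩
        · intro h
          simp only [Prod.mk_eq_zero] at h
          simp [h.1, h.2] at hab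
        · rw [← hp]
          congr 1
          simp only [lin, Prod.fst_add, Prod.snd_add, Prod.smul_fst, Prod.smul_snd, smul_eq_mul]
          ring
  · rintro A rfl A' rfl p - - -
    rfl
  · rintro A rfl e he p hp hpe
    exact absurd hp (hout e he p hpe)
  · rintro e v v' ht - A rfl hv
    exact hout e ht.1 v ht.mem hv
  · intro e v v' ht hv
    exact absurd ⟨e, v', ht⟩ hv

/-- Among signs `s, s', s, s'` at four increasing places with `s ≠ s'`, a sign sequence changes at
least three times. -/
lemma card_const_add_three_le {K : Finset ℝ} {s : ℝ → ℝ} (hs : ∀ l, (∃ k ∈ K, l < k) →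
      s l ∈ K ∧ l < s l ∧ ∀ k ∈ K, l < k → s l ≤ k) {sg : ℝ → Bool} {p₀ p₁ p₂ p₃ : ℝ}
    (h0 : p₀ ∈ K) (h1 : p₁ ∈ K) (h2 : p₂ ∈ K) (h3 : p₃ ∈ K) (h01 : p₀ < p₁) (h12 : p₁ < p₂)
    (h23 : p₂ < p₃) (g01 : sg p₀ ≠ sg p₁) (g12 : sg p₁ ≠ sg p₂) (g23 : sg p₂ ≠ sg p₃) :
    #{l ∈ K | l ≠ p₃ ∧ sg l = sg (s l)} + 4 ≤ #K := by
  obtain ⟨l₀, hl₀, -, hu₀, hc₀⟩ := exists_change hs h0 h1 h01 g01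
  obtain ⟨l₁, hl₁, hd₁, hu₁, hc₁⟩ := exists_change hs h1 h2 h12 g12
  obtain ⟨l₂, hl₂, hd₂, hu₂, hc₂⟩ := exists_change hs h2 h3 h23 g23
  have hlt₀ : l₀ < l₁ := hu₀.trans_le hd₁
  have hlt₁ : l₁ < l₂ := hu₁.trans_le hd₂
  have hT : #({l₀, l₁, l₂, p₃} : Finset ℝ) = 4 := by
    rw [Finset.card_insert_of_notMem, Finset.card_insert_of_notMem, Finset.card_pair hu₂.ne]
    · simp [hlt₁.ne, (hlt₁.trans hu₂).ne]
    · simp [hlt₀.ne, (hlt₀.trans hlt₁).ne, ((hlt₀.trans hlt₁).trans hu₂).ne]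
  rw [← hT, ← Finset.card_union_of_disjoint]
  · refine Finset.card_le_card (Finset.union_subset (Finset.filter_subset _ _) ?_)
    simp [Finset.insert_subset_iff, hl₀, hl₁, hl₂, h3]
  · simp only [Finset.disjoint_insert_right, Finset.disjoint_singleton_right, Finset.mem_filter]
    tauto

set_option maxHeartbeats 1000000 in
theorem exists_sys {M : Finset (Pt × Pt)} (hM : Good M) {a b c : ℝ} (hab : 0 < a ^ 2 + b ^ 2)
    (hFt : ∀ e v v', Tip M e v v' → lin a b c v ≠ 0)
    (hpos : ∃ e ∈ M, 0 < lin a b c e.1 ∧ lin a b c e.2 < 0)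
    (hneg : ∃ e ∈ M, lin a b c e.1 < 0 ∧ 0 < lin a b c e.2) :
    ∃ (D : Set Pt) (I : Finset ℝ) (L : Set (Set Pt × Bool)) (G : ℝ → Set Pt),
      IsOpen D ∧ Convex ℝ D ∧ (∀ e v v', Tip M e v v' → v ∈ D) ∧
      Sys M (lin a b c) D I L {v | ∃ e v', Tip M e v v'} G ∧
      #I + 2 ≤ #{e ∈ M | ¬ (0 < lin a b c e.1 ↔ 0 < lin a b c e.2)} := by
  set F := lin a b c with hFdef
  set H := lin b (-a) 0 with hHdef
  set φ := onLine a b c with hφ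
  have hFφ : ∀ t, F (φ t) = 0 := lin_onLine hab
  have hHφ : ∀ t, H (φ t) = t := lin_onLine' hab
  have hφH : ∀ p, F p = 0 → φ (H p) = p := fun p => onLine_lin hab
  have hφi : ∀ s t, φ s = φ t → s = t := fun s t h => by rw [← hHφ s, h, hHφ]
  have hne1 : ∀ e ∈ M, F e.1 ≠ 0 := fun e he => hFt e _ _ (tip_fst he)
  have hne2 : ∀ e ∈ M, F e.2 ≠ 0 := fun e he => hFt e _ _ (tip_snd he)
  have hfin : ∃ N : ℝ, ∀ e ∈ M, |F e.1| < N ∧ |F e.2| < N ∧ |H e.1| < N ∧ |H e.2| < N := by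
    refine ⟨1 + ∑ e ∈ M, (|F e.1| + |F e.2| + |H e.1| + |H e.2|), fun e he => ?_⟩
    have := Finset.single_le_sum (f := fun e : Pt × Pt => |F e.1| + |F e.2| + |H e.1| + |H e.2|)
      (fun e _ => by positivity) he
    have h1 := abs_nonneg (F e.1)
    have h2 := abs_nonneg (F e.2)
    have h3 := abs_nonneg (H e.1)
    have h4 := abs_nonneg (H e.2)
    refine ⟨?_, ?_, ?_, ?_⟩ <;> linarith
  obtain ⟨N, hN⟩ := hfin
  have hN0 : 0 < N := by
    obtain ⟨e, he, -⟩ := hpos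
    exact (abs_nonneg _).trans_lt (hN e he).1
  set D : Set Pt := {p | |F p| < N} ∩ {p | |H p| < N} with hDdef
  have hDc : Convex ℝ D := (convex_abs_lin_lt a b c N).inter (convex_abs_lin_lt b (-a) 0 N)
  have hDo : IsOpen D :=
    (isOpen_lt (continuous_lin a b c).abs continuous_const).inter
      (isOpen_lt (continuous_lin b (-a) 0).abs continuous_const)
  have hDs : ∀ e ∈ M, ∀ p ∈ segment ℝ e.1 e.2, p ∈ D := fun e he p hp =>
    hDc.segment_subset ⟨(hN e he).1, (hN e he).2.2.1⟩ ⟨(hN e he).2.1, (hN e he).2.2.2⟩ hp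
  -- the crossing points
  have hiff : ∀ e ∈ M, (∃ t, φ t ∈ segment ℝ e.1 e.2) → ¬ (0 < F e.1 ↔ 0 < F e.2) := by
    rintro e he ⟨t, ht⟩
    exact (exists_lin_eq_zero_iff (hne1 e he) (hne2 e he)).1 ⟨_, ht, hFφ t⟩
  have hex : ∀ e ∈ M, ¬ (0 < F e.1 ↔ 0 < F e.2) → ∃ t, φ t ∈ segment ℝ e.1 e.2 := by
    intro e he h
    obtain ⟨p, hp, hp0⟩ := (exists_lin_eq_zero_iff (hne1 e he) (hne2 e he)).2 h
    exact ⟨_, (hφH p hp0).symm ▸ hp⟩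
  have huniq : ∀ e ∈ M, ∀ s t, φ s ∈ segment ℝ e.1 e.2 → φ t ∈ segment ℝ e.1 e.2 → s = t := by
    intro e he s t hs ht
    have h1 := crs_onLine hab (c := c) e s t
    rw [← hφ, crs_eq_zero_of_mem hs, crs_eq_zero_of_mem ht, sub_zero, zero_mul] at h1
    rcases mul_eq_zero.1 h1.symm with h2 | h2
    · linarith
    · exact absurd (by rw [← hFdef, sub_eq_zero] at h2; rw [h2]) (hiff e he ⟨s, hs⟩)
  set C := M.filter fun e => ¬ (0 < F e.1 ↔ 0 < F e.2) with hC
  have hex' : ∀ e, ∃ t, e ∈ C → φ t ∈ segment ℝ e.1 e.2 := by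
    intro e
    by_cases he : e ∈ C
    · obtain ⟨t, ht⟩ := hex e (Finset.mem_filter.1 he).1 (Finset.mem_filter.1 he).2
      exact ⟨t, fun _ => ht⟩
    · exact ⟨0, fun h => absurd h he⟩
  choose ξ hξ using hex'
  have hmemC : ∀ e ∈ M, ∀ t, φ t ∈ segment ℝ e.1 e.2 → e ∈ C ∧ t = ξ e := by
    intro e he t ht
    have heC : e ∈ C := Finset.mem_filter.2 ⟨he, hiff e he ⟨t, ht⟩⟩
    exact ⟨heC, huniq e he _ _ ht (hξ e heC)⟩
  have hξN : ∀ e ∈ C, -N < ξ e ∧ ξ e < N := by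
    intro e he
    have := (hDs e (Finset.mem_filter.1 he).1 _ (hξ e he)).2
    rw [Set.mem_ofPred_eq, hHφ, abs_lt] at this
    exact this
  set K : Finset ℝ := insert (-N) (insert N (C.image ξ)) with hK
  obtain ⟨s, hs⟩ := exists_succ K
  have hNK : N ∈ K := by simp [hK]
  have hNK' : -N ∈ K := by simp [hK]
  have hKN : ∀ k ∈ K, -N ≤ k ∧ k ≤ N := by
    intro k hk
    simp only [hK, Finset.mem_insert, Finset.mem_image] at hk
    rcases hk with rfl | rfl | ⟨e, he, rfl⟩
    · constructor <;> linarith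
    · constructor <;> linarith
    · exact ⟨(hξN e he).1.le, (hξN e he).2.le⟩
  have hξK : ∀ e ∈ C, ξ e ∈ K := fun e he => by
    simp only [hK, Finset.mem_insert, Finset.mem_image]
    exact Or.inr (Or.inr ⟨e, he, rfl⟩)
  -- the signs
  set g : ℝ → Bool := fun k => decide (∃ e ∈ M, φ k ∈ segment ℝ e.1 e.2 ∧ 0 < F e.1) with hg
  have hgξ : ∀ e ∈ C, g (ξ e) = decide (0 < F e.1) := by
    intro e he
    have heM := (Finset.mem_filter.1 he).1
    simp only [hg, decide_eq_decide]
    constructor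
    · rintro ⟨e', he', h1, h2⟩
      rwa [hM.disj e heM e' he' _ (hξ e he) h1]
    · exact fun h => ⟨e, heM, hξ e he, h⟩
  obtain ⟨p₁, p₂, hp₁, hp₂, hp12, hg12⟩ : ∃ p₁ p₂, p₁ ∈ C.image ξ ∧ p₂ ∈ C.image ξ ∧ p₁ < p₂ ∧
      g p₁ ≠ g p₂ := by
    obtain ⟨e, he, he1, he2⟩ := hpos
    obtain ⟨e', he', he1', he2'⟩ := hneg
    have heC : e ∈ C := Finset.mem_filter.2 ⟨he, fun h => he2.not_gt (h.1 he1)⟩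
    have heC' : e' ∈ C := Finset.mem_filter.2 ⟨he', fun h => he1'.not_gt (h.2 he2')⟩
    have hgg : g (ξ e) ≠ g (ξ e') := by
      rw [hgξ e heC, hgξ e' heC']
      simp [he1, he1'.not_gt]
    rcases lt_or_gt_of_ne (fun h => hgg (by rw [h]) : ξ e ≠ ξ e') with h | h
    · exact ⟨_, _, Finset.mem_image_of_mem _ heC, Finset.mem_image_of_mem _ heC', h, hgg⟩
    · exact ⟨_, _, Finset.mem_image_of_mem _ heC', Finset.mem_image_of_mem _ heC, h, hgg.symm⟩
  have hXN : ∀ k ∈ C.image ξ, -N < k ∧ k < N ∧ k ∈ K := by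
    intro k hk
    obtain ⟨e, he, rfl⟩ := Finset.mem_image.1 hk
    exact ⟨(hξN e he).1, (hξN e he).2, hξK e he⟩
  set sg : ℝ → Bool := fun k => if k = -N then g p₂ else if k = N then g p₁ else g k with hsg
  have hsgξ : ∀ k ∈ C.image ξ, sg k = g k := fun k hk => by
    simp only [hsg, if_neg (hXN k hk).1.ne', if_neg (hXN k hk).2.1.ne]
  have hsg0 : sg (-N) = g p₂ := by simp [hsg]
  have hsg1 : sg N = g p₁ := by
    simp only [hsg, if_true]
    rw [if_neg (by linarith)]
  have hcard := card_const_add_three_le hs (sg := sg) hNK' (hXN p₁ hp₁).2.2 (hXN p₂ hp₂).2.2 hNK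
    (hXN p₁ hp₁).1 hp12 (hXN p₂ hp₂).2.1 (by rw [hsg0, hsgξ p₁ hp₁]; exact hg12.symm)
    (by rw [hsgξ p₁ hp₁, hsgξ p₂ hp₂]; exact hg12) (by rw [hsg1, hsgξ p₂ hp₂]; exact hg12.symm)
  have hKc : #K ≤ #C + 2 :=
    (Finset.card_insert_le _ _).trans (Nat.succ_le_succ ((Finset.card_insert_le _ _).trans
      (Nat.succ_le_succ Finset.card_image_le)))
  -- attaching walls to the crossing points
  have hside : ∀ e ∈ C, ∀ r, (ξ e < r → OnSide (g (ξ e)) e (φ r)) ∧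
      (r < ξ e → OnSide (!g (ξ e)) e (φ r)) := by
    intro e he r
    obtain ⟨heM, hsgn⟩ := Finset.mem_filter.1 he
    have h1 := crs_onLine hab (c := c) e (ξ e) r
    rw [← hφ, crs_eq_zero_of_mem (hξ e he), sub_zero, ← hFdef] at h1
    rw [hgξ e he]
    rcases lt_or_gt_of_ne (hne1 e heM) with h2 | h2
    · have h3 : 0 < F e.2 := not_le.1 fun h' => hsgn (iff_of_false h2.not_gt h'.not_gt)
      simp only [h2.not_gt, decide_false, OnSide, Bool.not_false]
      refine ⟨fun h4 => ?_, fun h4 => ?_⟩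
      · have := mul_neg_of_pos_of_neg (sub_pos.2 h4) (by linarith : F e.1 - F e.2 < 0)
        rw [← h1] at this
        exact neg_of_mul_neg_left this hab.le
      · have := mul_pos_of_neg_of_neg (sub_neg.2 h4) (by linarith : F e.1 - F e.2 < 0)
        rw [← h1] at this
        exact pos_of_mul_pos_left this hab.le
    · have h3 : F e.2 < 0 := lt_of_le_of_ne (not_lt.1 fun h' => hsgn (iff_of_true h2 h'))
        (hne2 e heM)
      simp only [h2, decide_true, OnSide, Bool.not_true]
      refine ⟨fun h4 => ?_, fun h4 => ?_⟩
      · have := mul_pos (sub_pos.2 h4) (by linarith : 0 < F e.1 - F e.2)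
        rw [← h1] at this
        exact pos_of_mul_pos_left this hab.le
      · have := mul_neg_of_neg_of_pos (sub_neg.2 h4) (by linarith : 0 < F e.1 - F e.2)
        rw [← h1] at this
        exact neg_of_mul_neg_left this hab.le
  have hW0 := walls_box hM hab (c := c) hDs (g p₂)
  set L₀ : Set (Set Pt × Bool) := {({p | |lin a b c p| = N ∨ |lin b (-a) 0 p| = N}, g p₂)} with hL₀
  have hatt : ∀ k ∈ K, ∀ r σ, (k = -N → σ = g p₂) → (k = N → σ = g p₂) →
      (∀ e ∈ C, k = ξ e → OnSide σ e (φ r)) → Att M L₀ (φ k) (φ r) σ := by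
    intro k hk r σ h1 h2 h3
    refine ⟨?_, fun e v v' ht h => hFt e v v' ht (h ▸ hFφ k), ?_, ?_⟩
    · simp only [hK, Finset.mem_insert, Finset.mem_image] at hk
      rcases hk with hk | hk | ⟨e, he, rfl⟩
      · refine Or.inr ⟨_, rfl, Or.inr ?_⟩
        rw [← hHdef, hHφ, hk, abs_neg, abs_of_pos hN0]
      · refine Or.inr ⟨_, rfl, Or.inr ?_⟩
        rw [← hHdef, hHφ, hk, abs_of_pos hN0]
      · exact Or.inl ⟨e, (Finset.mem_filter.1 he).1, hξ e he⟩
    · rintro A rfl - hn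
      simp only [hK, Finset.mem_insert, Finset.mem_image] at hk
      rcases hk with hk | hk | ⟨e, he, rfl⟩
      · exact (h1 hk).symm
      · exact (h2 hk).symm
      · exact absurd (hξ e he) (hn e (Finset.mem_filter.1 he).1)
    · intro e he hke
      exact h3 e (hmemC e he k hke).1 (hmemC e he k hke).2
  have hgp : (!g p₁) = g p₂ := by
    revert hg12
    cases g p₁ <;> cases g p₂ <;> simp
  have hattE : ∀ k ∈ K, k ≠ N → ∀ r, k < r → Att M L₀ (φ k) (φ r) (sg k) := by
    intro k hk hkN r hkr
    refine hatt k hk r _ (fun h => by rw [h, hsg0]) (fun h => absurd h hkN) ?_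
    rintro e he rfl
    rw [hsgξ _ (Finset.mem_image_of_mem ξ he)]
    exact (hside e he r).1 hkr
  have hattW : ∀ k ∈ K, k ≠ -N → ∀ r, r < k → Att M L₀ (φ k) (φ r) (!sg k) := by
    intro k hk hkN r hkr
    refine hatt k hk r _ (fun h => absurd h hkN) (fun h => by rw [h, hsg1, hgp]) ?_
    rintro e he rfl
    rw [hsgξ _ (Finset.mem_image_of_mem ξ he)]
    exact (hside e he r).2 hkr
  -- the windows between the crossing points
  have hwin : ∀ l ∈ K, l ≠ N → s l ∈ K ∧ l < s l ∧ ∀ k ∈ K, l < k → s l ≤ k := fun l hl hlN =>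
    hs l ⟨N, hNK, (hKN l hl).2.lt_of_ne hlN⟩
  have hfree : ∀ l ∈ K, l ≠ N → ∀ p ∈ openSegment ℝ (φ l) (φ (s l)), p ∉ WSet M L₀ := by
    intro l hl hlN p hp hpW
    obtain ⟨h1, h2, h3⟩ := hwin l hl hlN
    obtain ⟨t, ht1, ht2, rfl⟩ := (mem_openSegment_onLine h2).1 hp
    rcases hpW with ⟨e, he, hpe⟩ | ⟨A, rfl, hp' | hp'⟩
    · obtain ⟨heC, hte⟩ := hmemC e he t hpe
      exact ht2.not_ge (h3 t (hte ▸ hξK e heC) ht1)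
    · rw [lin_onLine hab, abs_zero] at hp'
      exact hN0.ne hp'
    · rw [lin_onLine' hab] at hp'
      have h4 := (hKN l hl).1
      have h5 := (hKN _ h1).2
      exact (abs_lt.2 ⟨by linarith, by linarith⟩ : |t| < N).ne hp'
  have hdisj : ∀ l ∈ K, l ≠ N → ∀ m ∈ K, m ≠ N → l ≠ m →
      Disjoint (openSegment ℝ (φ l) (φ (s l))) (openSegment ℝ (φ m) (φ (s m))) := by
    intro l hl hlN m hm hmN hlm
    obtain ⟨-, h2, h3⟩ := hwin l hl hlN
    obtain ⟨-, h2', h3'⟩ := hwin m hm hmN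
    refine Set.disjoint_left.2 fun p hp hp' => ?_
    obtain ⟨t, ht1, ht2, rfl⟩ := (mem_openSegment_onLine h2).1 hp
    obtain ⟨t', ht1', ht2', htt⟩ := (mem_openSegment_onLine h2').1 hp'
    obtain rfl := hφi _ _ htt
    rcases lt_or_gt_of_ne hlm with h | h
    · have := h3 m hm h
      linarith
    · have := h3' l hl h
      linarith
  have hsN : ∀ l ∈ K, l ≠ N → s l ≠ -N := fun l hl hlN =>
    ((hKN l hl).1.trans_lt (hwin l hl hlN).2.1).ne'
  set S : Finset ℝ := {l ∈ K | l ≠ N ∧ sg l ≠ sg (s l)} with hS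
  have hSm : ∀ l ∈ S, l ∈ K ∧ l ≠ N ∧ sg l ≠ sg (s l) := fun l hl => Finset.mem_filter.1 hl
  obtain ⟨L, hL, hmem, hattL⟩ := hW0.close hM φ (fun l => φ (s l)) sg S
    (fun l hl h => (hwin l (hSm l hl).1 (hSm l hl).2.1).2.1.ne (hφi _ _ h))
    (fun l hl => hattE l (hSm l hl).1 (hSm l hl).2.1 _ (hwin l (hSm l hl).1 (hSm l hl).2.1).2.1)
    (fun l hl => by
      obtain ⟨h1, h2, h3⟩ := hSm l hl
      have := hattW (s l) (hwin l h1 h2).1 (hsN l h1 h2) l (hwin l h1 h2).2.1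
      rwa [show (!sg (s l)) = sg l by revert h3; cases sg l <;> cases sg (s l) <;> simp] at this)
    (fun l hl => hfree l (hSm l hl).1 (hSm l hl).2.1)
    (fun l hl m hm => hdisj l (hSm l hl).1 (hSm l hl).2.1 m (hSm m hm).1 (hSm m hm).2.1)
  refine ⟨D, {l ∈ K | l ≠ N ∧ sg l = sg (s l)}, L, fun l => openSegment ℝ (φ l) (φ (s l)), hDo, hDc,
    fun e v v' ht => hDs e ht.1 v ht.mem, ⟨hL, ?_, ?_, ?_, ?_⟩, by omega⟩
  · intro p hp u hu
    have hbox : ∀ q, |lin a b c q| = N ∨ |lin b (-a) 0 q| = N → q ∈ WSet M L := fun q hq =>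
      (hmem q).2 (Or.inl (Or.inr ⟨_, rfl, hq⟩))
    by_cases h : a * u.1 + b * u.2 = 0
    · obtain ⟨t, ht, h'⟩ := exists_abs_lin_eq (a := b) (b := -a) (u := u) hp.2 fun h' => hu (by
        have h1 : (a ^ 2 + b ^ 2) * u.1 = 0 := by linear_combination a * h + b * h'
        have h2 : (a ^ 2 + b ^ 2) * u.2 = 0 := by linear_combination b * h - a * h'
        exact Prod.ext ((mul_eq_zero.1 h1).resolve_left hab.ne')
          ((mul_eq_zero.1 h2).resolve_left hab.ne'))
      exact ⟨t, ht, hbox _ (Or.inr h')⟩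
    · obtain ⟨t, ht, h'⟩ := exists_abs_lin_eq hp.1 h
      exact ⟨t, ht, hbox _ (Or.inl h')⟩
  · intro l hl
    obtain ⟨h1, h2, h3⟩ := Finset.mem_filter.1 hl
    obtain ⟨h4, h5, -⟩ := hwin l h1 h2
    refine ⟨sg l, φ l, φ (s l), hFφ _, hFφ _, fun h => h5.ne (hφi _ _ h), rfl, fun p hp hpL => ?_,
      hattL _ _ _ (hattE l h1 h2 _ h5), ?_⟩
    · rcases (hmem p).1 hpL with h | ⟨m, hm, h⟩
      · exact hfree l h1 h2 p hp h
      · exact Set.disjoint_left.1 (hdisj l h1 h2 m (hSm m hm).1 (hSm m hm).2.1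
          (by rintro rfl; exact (hSm _ hm).2.2 h3)) hp h
    · rw [h3]
      exact hattL _ _ _ (hattW _ h4 (hsN l h1 h2) _ h5)
  · intro l hl m hm
    exact hdisj l (Finset.mem_filter.1 hl).1 (Finset.mem_filter.1 hl).2.1 m
      (Finset.mem_filter.1 hm).1 (Finset.mem_filter.1 hm).2.1
  · intro p hp hp0 hpL
    have hpW : p ∉ WSet M L₀ := fun h => hpL ((hmem p).2 (Or.inl h))
    obtain ⟨t, rfl⟩ : ∃ t, p = φ t := ⟨H p, (hφH p hp0).symm⟩
    have htN : |t| < N := by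
      have := hp.2
      rwa [Set.mem_ofPred_eq, hHφ] at this
    rw [abs_lt] at htN
    have htK : t ∉ K := fun h => hpW (hattE t h htN.2.ne N htN.2).mem
    obtain ⟨l, hl, hmax⟩ := Finset.exists_max_image {k ∈ K | k < t} id
      ⟨-N, Finset.mem_filter.2 ⟨hNK', htN.1⟩⟩
    simp only [Finset.mem_filter, id] at hl hmax
    have hlN : l ≠ N := (hl.2.trans htN.2).ne
    obtain ⟨h1, h2, -⟩ := hwin l hl.1 hlN
    have hts : t < s l := by
      refine lt_of_le_of_ne (not_lt.1 fun h => h2.not_ge (hmax _ ⟨h1, h⟩)) ?_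
      rintro rfl
      exact htK h1
    have hmo : φ t ∈ openSegment ℝ (φ l) (φ (s l)) :=
      (mem_openSegment_onLine h2).2 ⟨t, hl.2, hts, rfl⟩
    refine ⟨l, Finset.mem_filter.2 ⟨hl.1, hlN, ?_⟩, hmo⟩
    by_contra h
    exact hpL ((hmem _).2 (Or.inr ⟨l, Finset.mem_filter.2 ⟨hl.1, hlN, h⟩, hmo⟩))

lemma GenPos.det_ne_zero {S : Finset Pt} (hS : GenPos S) {p q r : Pt} (hp : p ∈ S) (hq : q ∈ S)
    (hr : r ∈ S) (hpq : p ≠ q) (hpr : p ≠ r) (hqr : q ≠ r) : det (q - p) (r - p) ≠ 0 := by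
  intro h
  obtain ⟨k, hk⟩ := exists_smul_of_det_eq_zero (sub_ne_zero.2 hpq.symm) h
  refine hS p hp q hq r hr hpq hpr hqr ((collinear_iff_of_mem (p₀ := p) (by simp)).2 ⟨q - p, ?_⟩)
  simp only [Set.mem_insert_iff, Set.mem_singleton_iff, forall_eq_or_imp, forall_eq, vadd_eq_add]
  exact ⟨⟨0, by simp⟩, ⟨1, by simp⟩, ⟨k, by rw [← hk, sub_add_cancel]⟩⟩

lemma IsBRMatching.good {B R : Finset Pt} (hdisj : B ∩ R = ∅) (hgen : GenPos (B ∪ R))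
    {M : Finset (Pt × Pt)} (hM : IsBRMatching B R M) : Good M := by
  have hne : ∀ e ∈ M, ∀ s ∈ M, e.1 ≠ s.2 := fun e he s hs h =>
    Finset.disjoint_left.1 (Finset.disjoint_iff_inter_eq_empty.2 hdisj) (hM.1 e he).1
      (h ▸ (hM.1 s hs).2)
  have hd : ∀ e ∈ M, ∀ s ∈ M, ∀ p ∈ segment ℝ e.1 e.2, p ∈ segment ℝ s.1 s.2 → e = s :=
    fun e he s hs p hp hp' => by_contra fun h =>
      Set.notMem_empty p (hM.2.2.2 e he s hs h ▸ ⟨hp, hp'⟩)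
  refine ⟨fun e he => hne e he e he, hd, fun e v v' ht s hs hse => ?_⟩
  have hv : v ∈ B ∪ R := by
    rcases ht.2 with ⟨rfl, -⟩ | ⟨rfl, -⟩
    exacts [Finset.mem_union_left _ (hM.1 e ht.1).1, Finset.mem_union_right _ (hM.1 e ht.1).2]
  refine hgen.det_ne_zero (Finset.mem_union_left _ (hM.1 s hs).1)
    (Finset.mem_union_right _ (hM.1 s hs).2) hv (hne s hs s hs) ?_ ?_
  · rintro rfl
    exact hse (hd s hs e ht.1 _ (left_mem_segment _ _ _) ht.mem)
  · rintro rfl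
    exact hse (hd s hs e ht.1 _ (right_mem_segment _ _ _) ht.mem)

lemma crosses_iff {a b c : ℝ} {e : Pt × Pt} (h1 : lin a b c e.1 ≠ 0) (h2 : lin a b c e.2 ≠ 0) :
    Crosses a b c e ↔ ¬ (0 < lin a b c e.1 ↔ 0 < lin a b c e.2) := by
  rw [← exists_lin_eq_zero_iff h1 h2]
  simp only [Crosses, lin, sub_eq_zero]

lemma IsBRMatching.card_fst {B R : Finset Pt} {M : Finset (Pt × Pt)} (hM : IsBRMatching B R M)
    (p : Pt → Prop) : #{e ∈ M | p e.1} = #{v ∈ B | p v} := by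
  refine Finset.card_bij (fun e _ => e.1) (fun e he => ?_) (fun e he s hs h => ?_) fun v hv => ?_
  · rw [Finset.mem_filter] at he ⊢
    exact ⟨(hM.1 e he.1).1, he.2⟩
  · rw [Finset.mem_filter] at he hs
    exact (hM.2.1 _ (hM.1 e he.1).1).unique ⟨he.1, rfl⟩ ⟨hs.1, h.symm⟩
  · rw [Finset.mem_filter] at hv
    obtain ⟨e, ⟨he, rfl⟩, -⟩ := hM.2.1 v hv.1
    exact ⟨e, Finset.mem_filter.2 ⟨he, hv.2⟩, rfl⟩

lemma IsBRMatching.card_snd {B R : Finset Pt} {M : Finset (Pt × Pt)} (hM : IsBRMatching B R M)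
    (p : Pt → Prop) : #{e ∈ M | p e.2} = #{v ∈ R | p v} := by
  refine Finset.card_bij (fun e _ => e.2) (fun e he => ?_) (fun e he s hs h => ?_) fun v hv => ?_
  · rw [Finset.mem_filter] at he ⊢
    exact ⟨(hM.1 e he.1).2, he.2⟩
  · rw [Finset.mem_filter] at he hs
    exact (hM.2.2.1 _ (hM.1 e he.1).2).unique ⟨he.1, rfl⟩ ⟨hs.1, h.symm⟩
  · rw [Finset.mem_filter] at hv
    obtain ⟨e, ⟨he, rfl⟩, -⟩ := hM.2.2.1 v hv.1
    exact ⟨e, Finset.mem_filter.2 ⟨he, hv.2⟩, rfl⟩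

/-- If two predicates hold equally often, then each difference of the two is inhabited as soon as
one is. -/
lemma exists_and_not_of_card_eq {α : Type*} {M : Finset α} {p q : α → Prop}
    (h : #{e ∈ M | p e} = #{e ∈ M | q e}) (hne : ∃ e ∈ M, ¬ (p e ↔ q e)) :
    ∃ e ∈ M, p e ∧ ¬ q e := by
  by_contra! hc
  have := Finset.eq_of_subset_of_card_le
    (fun e he => Finset.mem_filter.2 ⟨(Finset.mem_filter.1 he).1,
      hc e (Finset.mem_filter.1 he).1 (Finset.mem_filter.1 he).2⟩ :
      M.filter p ⊆ M.filter q) h.ge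
  obtain ⟨e, he, hpq⟩ := hne
  have := congrArg (e ∈ ·) this
  simp only [Finset.mem_filter, he, true_and, eq_iff_iff] at this
  exact hpq this

end

/-- If at least one edge of the BR-matching `M` crosses the
ham-sandwich cut `ℓ`, then there is a BR-matching `M'` compatible with `M` whose number
of edges crossing `ℓ` is at most `|C_{M,ℓ}| - 2`. -/
theorem exists_compatible_matching_two_fewer_crossings (n : ℕ) (B R : Finset Pt)
    (hdisj : B ∩ R = ∅) (hB : B.card = n) (hR : R.card = n)
    (hgen : GenPos (B ∪ R))
    (M : Finset (Pt × Pt)) (hM : IsBRMatching B R M)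
    (a b c : ℝ) (hcut : IsHamSandwichCut a b c B R n)
    (hcross : ∃ e ∈ M, Crosses a b c e) :
    ∃ M' : Finset (Pt × Pt), IsBRMatching B R M' ∧ Compatible M M' ∧
      (M'.filter fun e => Crosses a b c e).card ≤
        (M.filter fun e => Crosses a b c e).card - 2 := by
  obtain ⟨hab, hoff, hbal⟩ := hcut
  have hgood := hM.good hdisj hgen
  have hd0 : ((b, -a) : Pt) ≠ 0 := fun h => hab (by
    rw [Prod.mk_eq_zero, neg_eq_zero] at h
    rw [h.1, h.2])
  have hab' : 0 < a ^ 2 + b ^ 2 := by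
    by_contra! h
    have ha : a = 0 := by nlinarith [sq_nonneg a, sq_nonneg b]
    have hb : b = 0 := by nlinarith [sq_nonneg a, sq_nonneg b]
    exact hab (by rw [ha, hb])
  have hF1 : ∀ e ∈ M, lin a b c e.1 ≠ 0 := fun e he =>
    sub_ne_zero.2 (hoff _ (Finset.mem_union_left _ (hM.1 e he).1))
  have hF2 : ∀ e ∈ M, lin a b c e.2 ≠ 0 := fun e he =>
    sub_ne_zero.2 (hoff _ (Finset.mem_union_right _ (hM.1 e he).2))
  have hFt : ∀ e v v', Tip M e v v' → lin a b c v ≠ 0 := by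
    rintro e v v' ⟨he, ⟨rfl, -⟩ | ⟨rfl, -⟩⟩
    exacts [hF1 e he, hF2 e he]
  have hcount : #{e ∈ M | 0 < lin a b c e.1} = #{e ∈ M | 0 < lin a b c e.2} := by
    have h1 := hM.card_fst fun v => 0 < lin a b c v
    have h2 := hM.card_snd fun v => 0 < lin a b c v
    have h3 : #{v ∈ B | 0 < lin a b c v} = #{v ∈ R | 0 < lin a b c v} := by
      simp only [lin, sub_pos]
      rcases hbal with ⟨-, -, h, h'⟩ | ⟨-, -, h, h'⟩ <;> exact h.trans h'.symm
    convert h1.trans (Eq.trans ?_ h2.symm)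
    convert h3
  obtain ⟨e₀, he₀, hc₀⟩ := hcross
  rw [crosses_iff (hF1 e₀ he₀) (hF2 e₀ he₀)] at hc₀
  obtain ⟨e₁, he₁, hp₁, hn₁⟩ := exists_and_not_of_card_eq
    (p := fun e : Pt × Pt => 0 < lin a b c e.1) (q := fun e => 0 < lin a b c e.2)
    (by convert hcount) ⟨e₀, he₀, hc₀⟩
  obtain ⟨e₂, he₂, hp₂, hn₂⟩ := exists_and_not_of_card_eq
    (p := fun e : Pt × Pt => 0 < lin a b c e.2) (q := fun e => 0 < lin a b c e.1)
    (by convert hcount.symm) ⟨e₀, he₀, fun h => hc₀ h.symm⟩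
  obtain ⟨D, I, L₀, G₀, hDo, hDc, hDt, hsys, hcard⟩ := exists_sys hgood hab' hFt
    ⟨e₁, he₁, hp₁, (not_lt.1 hn₁).lt_of_ne (hF2 e₁ he₁)⟩
    ⟨e₂, he₂, (not_lt.1 hn₂).lt_of_ne (hF1 e₂ he₂), hp₂⟩
  have hUfin : {v | ∃ e v', Tip M e v v'}.Finite := by
    refine (M.image Prod.fst ∪ M.image Prod.snd).finite_toSet.subset ?_
    rintro v ⟨e, v', he, ⟨rfl, -⟩ | ⟨rfl, -⟩⟩
    · exact Finset.mem_union_left _ (Finset.mem_image_of_mem _ he)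
    · exact Finset.mem_union_right _ (Finset.mem_image_of_mem _ he)
  obtain ⟨L, G, hs⟩ := hsys.exists_done hgood (lin_line a b c) hFt hDt hUfin
  obtain ⟨π, hπ, hπd, hπc⟩ := exists_perm_matching hgood hs.walls hs.hit hDo hDc hDt hd0
    (F := lin a b c) (fun p q => by
      simp only [lin, det, Prod.fst_sub, Prod.snd_sub]
      ring) hFt
    (fun e he s hs t ht hst => hgen.det_ne_zero (Finset.mem_union_left _ (hM.1 e he).1)
      (Finset.mem_union_right _ (hM.1 s hs).2) (Finset.mem_union_right _ (hM.1 t ht).2)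
      (fun h => Finset.disjoint_left.1 (Finset.disjoint_iff_inter_eq_empty.2 hdisj) (hM.1 e he).1
        (h ▸ (hM.1 s hs).2))
      (fun h => Finset.disjoint_left.1 (Finset.disjoint_iff_inter_eq_empty.2 hdisj) (hM.1 e he).1
        (h ▸ (hM.1 t ht).2))
      (fun h => hst ((hM.2.2.1 _ (hM.1 s hs).2).unique ⟨hs, rfl⟩ ⟨ht, h.symm⟩)))
    (fun i hi => by
      obtain ⟨σ, x, y, -, -, -, hg, -⟩ := hs.gap i hi
      exact hg ▸ convex_openSegment x y)
    (fun i hi => by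
      obtain ⟨σ, x, y, -, -, -, -, hg, -⟩ := hs.gap i hi
      exact hg) hs.cover
  refine ⟨univ.image fun e : {e // e ∈ M} => (e.1.1, (π e).1.2), ⟨?_, ?_, ?_, ?_⟩, ?_, ?_⟩
  · simp only [Finset.forall_mem_image, Finset.mem_univ, forall_true_left]
    exact fun e => ⟨(hM.1 e.1 e.2).1, (hM.1 _ (π e).2).2⟩
  · intro v hv
    obtain ⟨e, ⟨he, rfl⟩, huniq⟩ := hM.2.1 v hv
    refine ⟨(e.1, (π ⟨e, he⟩).1.2),
      ⟨Finset.mem_image.2 ⟨⟨e, he⟩, Finset.mem_univ _, rfl⟩, rfl⟩, ?_⟩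
    rintro s ⟨hs, hse⟩
    obtain ⟨f, -, rfl⟩ := Finset.mem_image.1 hs
    obtain rfl : f = ⟨e, he⟩ := Subtype.ext (huniq f.1 ⟨f.2, hse⟩)
    rfl
  · intro v hv
    obtain ⟨e, ⟨he, rfl⟩, huniq⟩ := hM.2.2.1 v hv
    refine ⟨((π.symm ⟨e, he⟩).1.1, e.2),
      ⟨Finset.mem_image.2 ⟨π.symm ⟨e, he⟩, Finset.mem_univ _, by simp⟩, rfl⟩, ?_⟩
    rintro s ⟨hs, hse⟩
    obtain ⟨f, -, rfl⟩ := Finset.mem_image.1 hs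
    have hf : π f = ⟨e, he⟩ := Subtype.ext (huniq (π f).1 ⟨(π f).2, hse⟩)
    rw [← hf, Equiv.symm_apply_apply, hf]
  · intro e he s hs hes
    obtain ⟨f, -, rfl⟩ := Finset.mem_image.1 he
    obtain ⟨g, -, rfl⟩ := Finset.mem_image.1 hs
    exact Set.eq_empty_of_forall_notMem fun z hz =>
      hπd f g (fun h => hes (by rw [h])) z hz.1 hz.2
  · intro e he s hs
    obtain ⟨f, -, rfl⟩ := Finset.mem_image.1 hs
    by_cases hef : e = (f.1.1, (π f).1.2)
    · exact Or.inl hef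
    refine Or.inr ?_
    rintro z ⟨hz, hz'⟩
    rcases hπ f with h | h
    · rw [h] at hz' hef
      exact absurd (hgood.disj e he f.1 f.2 z hz hz') hef
    · rcases mem_segment_of_wset h hz' (Or.inl ⟨e, he, hz⟩) with rfl | rfl
      · obtain rfl := hgood.disj e he f.1 f.2 _ hz (left_mem_segment _ _ _)
        exact ⟨Or.inl rfl, Or.inl rfl⟩
      · obtain rfl := hgood.disj e he _ (π f).2 _ hz (right_mem_segment _ _ _)
        exact ⟨Or.inr rfl, Or.inr rfl⟩
  · have h1 : #{e ∈ M | Crosses a b c e} = #{e ∈ M | ¬ (0 < lin a b c e.1 ↔ 0 < lin a b c e.2)} :=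
      congrArg _ (Finset.filter_congr fun e he => crosses_iff (hF1 e he) (hF2 e he))
    have h2 : #{e ∈ univ.image fun e : {e // e ∈ M} => (e.1.1, (π e).1.2) | Crosses a b c e} ≤
        #{e : {e // e ∈ M} | ¬ (0 < lin a b c e.1.1 ↔ 0 < lin a b c (π e).1.2)} := by
      rw [Finset.filter_image]
      refine Finset.card_image_le.trans (Finset.card_le_card fun e he => ?_)
      rw [Finset.mem_filter] at he ⊢
      exact ⟨he.1, (crosses_iff (e := (e.1.1, (π e).1.2)) (hF1 e.1 e.2) (hF2 (π e).1 (π e).2)).1 he.2⟩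
    rw [h1]
    omega
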